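/- arXiv:1107.2843 — 4 statements merged into one kernel-verified Lean document; each statement's English description precedes it below -/
import Mathlib

section
/- Let F be a free group (on some set of generators), and for w ∈ F let |w| denote the length of the reduced word representing w. Let C be a nontrivial element of F whose orientable genus equals g (i.e., g is the least positive integer such that C is a product of g commutators in F). Then there exist elements a_1, b_1, …, a_g, b_g ∈ F such that C = [a_1,b_1]·[a_2,b_2]·…·[a_g,b_g] and |a_i| < 2|C| and |b_i| < 2|C| for every i = 1,…,g. -/
/-! ## The Heisenberg invariant -/

/-- The rational Heisenberg group. -/
@[ext] structure Heis where
  a : ℚ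
  b : ℚ
  c : ℚ

namespace Heis

instance : Mul Heis := ⟨fun x y => ⟨x.a + y.a, x.b + y.b, x.c + y.c + x.a * y.b⟩⟩
instance : One Heis := ⟨⟨0, 0, 0⟩⟩
instance : Inv Heis := ⟨fun x => ⟨-x.a, -x.b, -x.c + x.a * x.b⟩⟩

@[simp] lemma mul_a (x y : Heis) : (x * y).a = x.a + y.a := rfl
@[simp] lemma mul_b (x y : Heis) : (x * y).b = x.b + y.b := rfl
@[simp] lemma mul_c (x y : Heis) : (x * y).c = x.c + y.c + x.a * y.b := rfl
@[simp] lemma one_a : (1 : Heis).a = 0 := rfl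
@[simp] lemma one_b : (1 : Heis).b = 0 := rfl
@[simp] lemma one_c : (1 : Heis).c = 0 := rfl
@[simp] lemma inv_a (x : Heis) : (x⁻¹).a = -x.a := rfl
@[simp] lemma inv_b (x : Heis) : (x⁻¹).b = -x.b := rfl
@[simp] lemma inv_c (x : Heis) : (x⁻¹).c = -x.c + x.a * x.b := rfl

instance : Group Heis := Group.ofLeftAxioms
  (by intro x y z; ext <;> simp <;> ring)
  (by intro x; ext <;> simp)
  (by intro x; ext <;> simp)

/-- First coordinate as a homomorphism. -/
def aHom : Heis →* Multiplicative ℚ where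
  toFun x := Multiplicative.ofAdd x.a
  map_one' := rfl
  map_mul' _ _ := rfl

/-- Second coordinate as a homomorphism. -/
def bHom : Heis →* Multiplicative ℚ where
  toFun x := Multiplicative.ofAdd x.b
  map_one' := rfl
  map_mul' _ _ := rfl

end Heis

section Invariant

variable {X : Type} [DecidableEq X]

/-- Homomorphism to the Heisenberg group attached to two labels. -/
def hs (p q : X) : FreeGroup X →* Heis :=
  FreeGroup.lift fun z => ⟨if z = p then 1 else 0, if z = q then 1 else 0, 0⟩

/-- Exponent sum homomorphism. -/
def exH (p : X) : FreeGroup X →* Multiplicative ℚ :=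
  FreeGroup.lift fun z => Multiplicative.ofAdd (if z = p then 1 else 0)

/-- Exponent sum. -/
def ex (p : X) (u : FreeGroup X) : ℚ := (exH p u).toAdd

/-- Intersection number. -/
def inum (p q : X) (u : FreeGroup X) : ℚ := (hs p q u).c

lemma hs_a (p q : X) (u : FreeGroup X) : (hs p q u).a = ex p u := by
  have : Heis.aHom.comp (hs p q) = exH p := by
    ext z; simp [hs, exH, Heis.aHom]
  have h := DFunLike.congr_fun this u
  exact congrArg Multiplicative.toAdd h

lemma hs_b (p q : X) (u : FreeGroup X) : (hs p q u).b = ex q u := by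
  have : Heis.bHom.comp (hs p q) = exH q := by
    ext z; simp [hs, exH, Heis.bHom]
  have h := DFunLike.congr_fun this u
  exact congrArg Multiplicative.toAdd h

lemma ex_mul (p : X) (u v : FreeGroup X) : ex p (u * v) = ex p u + ex p v := by
  simp [ex]

lemma ex_inv (p : X) (u : FreeGroup X) : ex p u⁻¹ = - ex p u := by
  simp [ex]

lemma ex_one (p : X) : ex p (1 : FreeGroup X) = 0 := by simp [ex]

lemma inum_one (p q : X) : inum p q (1 : FreeGroup X) = 0 := by simp [inum]

lemma inum_mul (p q : X) (u v : FreeGroup X) :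
    inum p q (u * v) = inum p q u + inum p q v + ex p u * ex q v := by
  simp [inum, hs_a, hs_b]

/-- Sign of a letter. -/
def sgn (b : Bool) : ℚ := if b then 1 else -1

lemma ex_letter (p z : X) (b : Bool) :
    ex p (FreeGroup.mk [(z, b)]) = if z = p then sgn b else 0 := by
  cases b <;> by_cases h : z = p <;> simp [ex, exH, sgn, h]

lemma inum_letter (p q z : X) (h : p ≠ q) (b : Bool) :
    inum p q (FreeGroup.mk [(z, b)]) = 0 := by
  cases b <;> by_cases h1 : z = p <;> by_cases h2 : z = q <;> simp [inum, hs, h1, h2]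
  all_goals grind

omit [DecidableEq X] in
lemma mk_cons' (l : X × Bool) (U : List (X × Bool)) :
    (FreeGroup.mk (l :: U)) = FreeGroup.mk [l] * FreeGroup.mk U := by
  simp [FreeGroup.mul_mk]

lemma ex_block (p : X) (U : List (X × Bool)) (hU : ∀ l ∈ U, l.1 ≠ p) :
    ex p (FreeGroup.mk U) = 0 := by
  induction U with
  | nil => exact ex_one p
  | cons l U ih =>
    rw [mk_cons', ex_mul, ih (fun l hl => hU l (by simp [hl]))]
    have := hU l (by simp)
    obtain ⟨z, b⟩ := l
    rw [ex_letter, if_neg this]; simp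

lemma inum_block_left (p q : X) (h : p ≠ q) (U : List (X × Bool)) (hU : ∀ l ∈ U, l.1 ≠ p) :
    inum p q (FreeGroup.mk U) = 0 := by
  induction U with
  | nil => exact inum_one p q
  | cons l U ih =>
    rw [mk_cons', inum_mul, ih (fun l hl => hU l (by simp [hl]))]
    have := hU l (by simp)
    obtain ⟨z, b⟩ := l
    rw [ex_letter, if_neg this, inum_letter _ _ _ h]; simp

lemma inum_block_right (p q : X) (h : p ≠ q) (U : List (X × Bool)) (hU : ∀ l ∈ U, l.1 ≠ q) :
    inum p q (FreeGroup.mk U) = 0 := by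
  induction U with
  | nil => exact inum_one p q
  | cons l U ih =>
    rw [mk_cons', inum_mul, ih (fun l hl => hU l (by simp [hl])),
      ex_block q U (fun l hl => hU l (by simp [hl]))]
    obtain ⟨z, b⟩ := l
    rw [inum_letter _ _ _ h]; simp

/-- The word with a handle. -/
def hword (A B D E G : List (X × Bool)) (x y : X) (b c : Bool) : List (X × Bool) :=
  A ++ (x, b) :: (B ++ (y, c) :: (D ++ (x, !b) :: (E ++ (y, !c) :: G)))

omit [DecidableEq X] in
lemma mk_append' (U V : List (X × Bool)) :
    FreeGroup.mk (U ++ V) = FreeGroup.mk U * FreeGroup.mk V := by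
  simp [FreeGroup.mul_mk]

lemma mk_hword (A B D E G : List (X × Bool)) (x y : X) (b c : Bool) :
    FreeGroup.mk (hword A B D E G x y b c) = FreeGroup.mk A * (FreeGroup.mk [(x, b)] *
      (FreeGroup.mk B * (FreeGroup.mk [(y, c)] * (FreeGroup.mk D * (FreeGroup.mk [(x, !b)] *
      (FreeGroup.mk E * (FreeGroup.mk [(y, !c)] * FreeGroup.mk G))))))) := by
  rw [hword, mk_append', mk_cons' _ (_ ++ _), mk_append', mk_cons' _ (_ ++ _), mk_append',
    mk_cons' _ (_ ++ _), mk_append', mk_cons' _ G]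

lemma sgn_not (b : Bool) : sgn (!b) = - sgn b := by cases b <;> simp [sgn]
lemma sgn_sq (b : Bool) : sgn b * sgn b = 1 := by cases b <;> simp [sgn]

section
variable (A B D E G : List (X × Bool)) (x y : X) (b c : Bool) (hxy : x ≠ y)
    (hx : ∀ l ∈ A ++ B ++ D ++ E ++ G, l.1 ≠ x)
    (hy : ∀ l ∈ A ++ B ++ D ++ E ++ G, l.1 ≠ y)

include hxy hx hy in
lemma inum_xy : inum x y (FreeGroup.mk (hword A B D E G x y b c)) = sgn b * sgn c := by
  rw [mk_hword]
  simp only [List.mem_append] at hx hy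
  simp only [inum_mul, ex_mul, inum_letter _ _ _ hxy, ex_letter]
  rw [ex_block x A (by grind), ex_block x B (by grind), ex_block x D (by grind),
    ex_block x E (by grind),
    ex_block y B (by grind), ex_block y D (by grind),
    ex_block y E (by grind), ex_block y G (by grind),
    inum_block_left x y hxy A (by grind), inum_block_left x y hxy B (by grind),
    inum_block_left x y hxy D (by grind), inum_block_left x y hxy E (by grind),
    inum_block_left x y hxy G (by grind)]
  simp [hxy, hxy.symm, sgn_not]

include hxy hx in
lemma inum_xq (q : X) (hqx : q ≠ x) (hqy : q ≠ y) :
    inum x q (FreeGroup.mk (hword A B D E G x y b c)) =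
      sgn b * (ex q (FreeGroup.mk B) + ex q (FreeGroup.mk D)) := by
  rw [mk_hword]
  simp only [List.mem_append] at hx
  simp only [inum_mul, ex_mul, inum_letter _ _ _ hqx.symm, ex_letter]
  rw [ex_block x A (by grind), ex_block x B (by grind), ex_block x D (by grind),
    ex_block x E (by grind),
    inum_block_left x q hqx.symm A (by grind), inum_block_left x q hqx.symm B (by grind),
    inum_block_left x q hqx.symm D (by grind), inum_block_left x q hqx.symm E (by grind),
    inum_block_left x q hqx.symm G (by grind)]
  simp [hxy, hxy.symm, hqx.symm, hqy.symm, sgn_not]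
  ring

include hxy hy in
lemma inum_yq (q : X) (hqx : q ≠ x) (hqy : q ≠ y) :
    inum y q (FreeGroup.mk (hword A B D E G x y b c)) =
      sgn c * (ex q (FreeGroup.mk D) + ex q (FreeGroup.mk E)) := by
  rw [mk_hword]
  simp only [List.mem_append] at hy
  simp only [inum_mul, ex_mul, inum_letter _ _ _ hqy.symm, ex_letter]
  rw [ex_block y A (by grind), ex_block y B (by grind), ex_block y D (by grind),
    ex_block y E (by grind),
    inum_block_left y q hqy.symm A (by grind), inum_block_left y q hqy.symm B (by grind),
    inum_block_left y q hqy.symm D (by grind), inum_block_left y q hqy.symm E (by grind),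
    inum_block_left y q hqy.symm G (by grind)]
  simp [hxy, hxy.symm, hqx.symm, hqy.symm, sgn_not]
  ring

lemma inum_pq (p q : X) (hpq : p ≠ q) (hpx : p ≠ x) (hpy : p ≠ y) (hqx : q ≠ x) (hqy : q ≠ y) :
    inum p q (FreeGroup.mk (hword A B D E G x y b c)) =
    inum p q (FreeGroup.mk (A ++ (E ++ (D ++ (B ++ G))))) +
     ((ex p (FreeGroup.mk B) + ex p (FreeGroup.mk D)) *
        (ex q (FreeGroup.mk D) + ex q (FreeGroup.mk E)) -
      (ex q (FreeGroup.mk B) + ex q (FreeGroup.mk D)) *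
        (ex p (FreeGroup.mk D) + ex p (FreeGroup.mk E))) := by
  rw [mk_hword, mk_append', mk_append', mk_append', mk_append']
  simp only [inum_mul, ex_mul, inum_letter _ _ _ hpq, ex_letter]
  simp [hpx.symm, hpy.symm, hqx.symm, hqy.symm]
  ring
end

/-- The commutator used in the statement. -/
def cmt {G : Type*} [Group G] (t : G × G) : G := t.1⁻¹ * t.2⁻¹ * t.1 * t.2

/-- Quadratic words: letters are distinct and closed under inversion. -/
def Quad (w : List (X × Bool)) : Prop := w.Nodup ∧ ∀ z b, (z, b) ∈ w → (z, !b) ∈ w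

omit [DecidableEq X] in
lemma nodup_two {A G : List (X × Bool)} {l m : X × Bool} (h : (A ++ l :: m :: G).Nodup) :
    l ≠ m ∧ l ∉ A ++ G ∧ m ∉ A ++ G ∧ (A ++ G).Nodup := by
  have hp : (A ++ l :: m :: G).Perm (l :: m :: (A ++ G)) :=
    List.perm_middle.trans (List.perm_middle.cons l)
  have h' := hp.nodup_iff.1 h
  simp only [List.nodup_cons, List.mem_cons, not_or] at h'
  tauto

omit [DecidableEq X] in
lemma nodup_hword {A B D E G : List (X × Bool)} {x y : X} {b c : Bool}
    (h : (hword A B D E G x y b c).Nodup) :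
    x ≠ y ∧ (∀ d, (x, d) ∉ A ++ (E ++ (D ++ (B ++ G)))) ∧
      (∀ d, (y, d) ∉ A ++ (E ++ (D ++ (B ++ G)))) ∧ (A ++ (E ++ (D ++ (B ++ G)))).Nodup := by
  classical
  have hp : (hword A B D E G x y b c).Perm
      ((x, b) :: (x, !b) :: (y, c) :: (y, !c) :: (A ++ (E ++ (D ++ (B ++ G))))) := by
    rw [List.perm_iff_count]
    intro l
    simp only [hword, List.count_append, List.count_cons]
    omega
  have h' := hp.nodup_iff.1 h
  simp only [List.nodup_cons, List.mem_cons, not_or] at h'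
  obtain ⟨⟨-, h1, h2, h3⟩, ⟨h4, h5, h6⟩, ⟨-, h7⟩, h8, h9⟩ := h'
  refine ⟨?_, ?_, ?_, h9⟩
  · rintro rfl
    cases b <;> cases c <;> simp_all
  · intro d
    cases b <;> cases d <;> first | exact h3 | exact h6
  · intro d
    cases c <;> cases d <;> first | exact h7 | exact h8

omit [DecidableEq X] in
lemma Quad.remove {A G : List (X × Bool)} {x : X} {b : Bool}
    (h : Quad (A ++ (x, b) :: (x, !b) :: G)) : Quad (A ++ G) := by
  obtain ⟨h1, h2⟩ := h
  obtain ⟨-, h3, h4, h5⟩ := nodup_two h1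
  refine ⟨h5, fun z d hz => ?_⟩
  have hm := h2 z d (by simp at hz ⊢; tauto)
  have hzx : z ≠ x := by
    rintro rfl
    have hd : d = b ∨ d = !b := by cases d <;> cases b <;> simp
    rcases hd with rfl | rfl
    · exact h3 hz
    · exact h4 hz
  simpa [hzx] using hm

omit [DecidableEq X] in
/-- A nonempty quadratic word has a cancelling adjacent pair or a handle. -/
lemma Quad.cases {w : List (X × Bool)} (hw : Quad w) (hne : w ≠ []) :
    (∃ A G x b, w = A ++ (x, b) :: (x, !b) :: G) ∨
    (∃ A B D E G x y b c, w = hword A B D E G x y b c) := by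
  have key : ∀ n, ∀ A B G x b, w = A ++ (x, b) :: (B ++ (x, !b) :: G) → B.length = n →
    (∃ A G x b, w = A ++ (x, b) :: (x, !b) :: G) ∨
    (∃ A B D E G x y b c, w = hword A B D E G x y b c) := by
    intro n
    induction n using Nat.strong_induction_on with
    | _ n ih =>
      intro A B G x b h hn
      cases B with
      | nil => left; exact ⟨A, G, x, b, by simpa using h⟩
      | cons l B =>
        obtain ⟨y, c⟩ := l
        have hy : (y, !c) ∈ w := hw.2 y c (by rw [h]; simp)
        have hnd := hw.1
        rw [h] at hy
        simp only [List.mem_append, List.mem_cons, List.cons_append] at hy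
        rcases hy with hy | hy | hy | hy | hy | hy
        · obtain ⟨A1, A2, rfl⟩ := List.append_of_mem hy
          right
          exact ⟨A1, A2, [], B, G, y, x, !c, b, by rw [h]; simp [hword]⟩
        · exfalso
          rw [h] at hnd
          have hbc : y = x ∧ (!c) = b := by simpa using hy
          obtain ⟨rfl, rfl⟩ := hbc
          simp [List.nodup_append] at hnd
        · exfalso; simp at hy
        · obtain ⟨B1, B2, rfl⟩ := List.append_of_mem hy
          refine ih B1.length ?_ (A ++ [(x, b)]) B1 (B2 ++ (x, !b) :: G) y c ?_ rfl
          · simp at hn; omega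
          · rw [h]; simp
        · exfalso
          have hbc : y = x ∧ c = b := by simpa using hy
          obtain ⟨rfl, rfl⟩ := hbc
          rw [h] at hnd
          simp [List.nodup_append] at hnd
        · obtain ⟨G1, G2, rfl⟩ := List.append_of_mem hy
          right
          exact ⟨A, [], B, G1, G2, x, y, b, c, by rw [h]; simp [hword]⟩
  cases w with
  | nil => exact absurd rfl hne
  | cons l w =>
    obtain ⟨x, b⟩ := l
    have := hw.2 x b (by simp)
    simp only [List.mem_cons] at this
    rcases this with h | h
    · simp at h
    · obtain ⟨B, G, rfl⟩ := List.append_of_mem h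
      exact key _ [] B G x b rfl rfl

lemma norm_mk_le (U : List (X × Bool)) : (FreeGroup.mk U).norm ≤ U.length :=
  FreeGroup.norm_mk_le

lemma handle_eq {G : Type*} [Group G] (A B D E K l m : G) :
    A * (l * (B * (m * (D * (l⁻¹ * (E * (m⁻¹ * K))))))) =
      (A * (E * (D * (B * K)))) *
      cmt (K⁻¹ * (B⁻¹ * (l⁻¹ * (E * (D * (B * K))))), K⁻¹ * (B⁻¹ * (D⁻¹ * (m⁻¹ * K)))) := by
  simp only [cmt]; group

omit [DecidableEq X] in
lemma mk_letter_inv (x : X) (b : Bool) :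
    FreeGroup.mk [(x, !b)] = (FreeGroup.mk [(x, b)])⁻¹ := by
  simp [FreeGroup.inv_mk, FreeGroup.invRev]

set_option maxHeartbeats 1000000 in
/-- Main reduction theorem for quadratic words. -/
theorem quad_main : ∀ (N : ℕ) (w : List (X × Bool)), w.length = N → Quad w →
    ∀ (n : ℕ) (V : Type) [AddCommGroup V] [Module ℚ V] [FiniteDimensional ℚ V]
      (Bf : V →ₗ[ℚ] V →ₗ[ℚ] ℚ), (∀ v, Bf v v = 0) → Module.finrank ℚ V ≤ 2 * n →
      ∀ h : X → V, (∀ p q : X, p ≠ q → p ∈ w.map Prod.fst → q ∈ w.map Prod.fst →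
        inum p q (FreeGroup.mk w) = Bf (h p) (h q)) →
      ∃ L : List (FreeGroup X × FreeGroup X), L.length ≤ n ∧
        FreeGroup.mk w = (L.map cmt).prod ∧
        ∀ t ∈ L, t.1.norm < 2 * w.length ∧ t.2.norm < 2 * w.length := by
  intro N
  induction N using Nat.strong_induction_on with
  | _ N ih =>
    intro w hN hw n V _ _ _ Bf hB hV h hh
    by_cases hne : w = []
    · subst hne
      exact ⟨[], by simp, by simp [← FreeGroup.one_eq_mk], by simp⟩
    rcases hw.cases hne with ⟨A, G, x, b, rfl⟩ | ⟨A, B, D, E, G, x, y, b, c, rfl⟩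
    · have hmk : FreeGroup.mk (A ++ (x, b) :: (x, !b) :: G) = FreeGroup.mk (A ++ G) := by
        rw [mk_append', mk_cons' _ (_ :: G), mk_cons' _ G, mk_letter_inv, mk_append']; group
      obtain ⟨L, h1, h2, h3⟩ := ih (A ++ G).length (by simp at hN ⊢; omega) (A ++ G) rfl
        hw.remove n V Bf hB hV h
        (by
          intro p q hpq hp hq
          rw [← hmk]
          apply hh p q hpq <;> simp at hp hq ⊢ <;> tauto)
      refine ⟨L, h1, hmk.trans h2, fun t ht => ?_⟩
      have := h3 t ht
      simp at this ⊢; omega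
    · have hnd := hw.1
      have hcl := hw.2
      obtain ⟨hxy, hx', hy', hnd'⟩ := nodup_hword hnd
      have hx : ∀ l ∈ A ++ B ++ D ++ E ++ G, l.1 ≠ x := by
        rintro ⟨z, d⟩ hl rfl
        exact hx' d (by simp at hl ⊢; tauto)
      have hy : ∀ l ∈ A ++ B ++ D ++ E ++ G, l.1 ≠ y := by
        rintro ⟨z, d⟩ hl rfl
        exact hy' d (by simp at hl ⊢; tauto)
      have hxm : x ∈ (hword A B D E G x y b c).map Prod.fst := by simp [hword]
      have hym : y ∈ (hword A B D E G x y b c).map Prod.fst := by simp [hword]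
      have hanti : ∀ u v, Bf u v = - Bf v u := by
        intro u v
        have := hB (u + v)
        simp [hB] at this
        linarith
      set s : ℚ := sgn b * sgn c with hs
      have hss : s * s = 1 := by
        rw [hs]; linear_combination (sgn c * sgn c) * sgn_sq b + sgn_sq c
      have hBxy : Bf (h x) (h y) = s := by
        rw [← hh x y hxy hxm hym, inum_xy A B D E G x y b c hxy hx hy]
      have hByx : Bf (h y) (h x) = -s := by rw [hanti, hBxy]
      let T : V →ₗ[ℚ] ℚ × ℚ := (Bf (h x)).prod (Bf (h y))
      have hTs : Function.Surjective T := by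
        rintro ⟨r, t⟩
        refine ⟨(s * r) • h y - (s * t) • h x, ?_⟩
        simp [T, hBxy, hByx, hB]
        constructor
        · linear_combination r * hss
        · linear_combination t * hss
      have hdim := T.finrank_range_add_finrank_ker
      rw [LinearMap.range_eq_top.2 hTs, finrank_top] at hdim
      simp at hdim
      let P : V → V := fun v => v - (s * Bf v (h y)) • h x + (s * Bf v (h x)) • h y
      have hP : ∀ v, P v ∈ LinearMap.ker T := by
        intro v
        simp [P, T, hB, hBxy, hByx]
        constructor
        · rw [hanti (h x) v]; linear_combination (Bf v (h x)) * hss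
        · rw [hanti (h y) v]; linear_combination (Bf v (h y)) * hss
      have hmem : ∀ p, p ∈ (A ++ (E ++ (D ++ (B ++ G)))).map Prod.fst →
          p ∈ (hword A B D E G x y b c).map Prod.fst ∧ p ≠ x ∧ p ≠ y := by
        intro p hp
        simp only [List.mem_map] at hp ⊢
        obtain ⟨l, hl, rfl⟩ := hp
        refine ⟨⟨l, ?_, rfl⟩, hx l ?_, hy l ?_⟩
        · simp [hword] at hl ⊢; tauto
        · simp at hl ⊢; tauto
        · simp at hl ⊢; tauto
      obtain ⟨L, h1, h2, h3⟩ := ih (A ++ (E ++ (D ++ (B ++ G)))).length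
        (by rw [← hN]; simp [hword]; omega)
        (A ++ (E ++ (D ++ (B ++ G)))) rfl
        (by
          constructor
          · exact hnd'
          · intro z d hz
            have hz1 : z ≠ x := hx (z, d) (by simp at hz ⊢; tauto)
            have hz2 : z ≠ y := hy (z, d) (by simp at hz ⊢; tauto)
            have := hcl z d (by simp [hword] at hz ⊢; tauto)
            simp [hword, hz1, hz2] at this ⊢
            tauto) (n - 1) (LinearMap.ker T)
        (Bf.compl₁₂ (LinearMap.ker T).subtype (LinearMap.ker T).subtype)
        (by intro v; simp [hB]) (by omega) (fun p => ⟨P (h p), hP _⟩)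
        (by
          intro p q hpq hp hq
          obtain ⟨hpm, hpx, hpy⟩ := hmem p hp
          obtain ⟨hqm, hqx, hqy⟩ := hmem q hq
          have e1 := inum_pq A B D E G x y b c p q hpq hpx hpy hqx hqy
          have e2 := inum_xq A B D E G x y b c hxy hx p hpx hpy
          have e3 := inum_xq A B D E G x y b c hxy hx q hqx hqy
          have e4 := inum_yq A B D E G x y b c hxy hy p hpx hpy
          have e5 := inum_yq A B D E G x y b c hxy hy q hqx hqy
          rw [hh _ _ hpq hpm hqm] at e1
          rw [hh _ _ hpx.symm hxm hpm] at e2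
          rw [hh _ _ hqx.symm hxm hqm] at e3
          rw [hh _ _ hpy.symm hym hpm] at e4
          rw [hh _ _ hqy.symm hym hqm] at e5
          have e6 : Bf (P (h p)) (P (h q)) = Bf (h p) (h q)
              - s * (Bf (h x) (h p) * Bf (h y) (h q) - Bf (h x) (h q) * Bf (h y) (h p)) := by
            simp [P, hB, hBxy, hByx]
            rw [hanti (h p) (h x), hanti (h p) (h y), hanti (h q) (h x), hanti (h q) (h y)]
            linear_combination (s * Bf (h x) (h p) * Bf (h y) (h q)
              - s * Bf (h x) (h q) * Bf (h y) (h p)) * hss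
          simp only [LinearMap.compl₁₂_apply, Submodule.subtype_apply]
          rw [e6, e2, e3, e4, e5]
          have e7 : s * (sgn b * sgn c) = 1 := hss
          linear_combination (-1) * e1 + ((ex p (FreeGroup.mk B) + ex p (FreeGroup.mk D)) *
            (ex q (FreeGroup.mk D) + ex q (FreeGroup.mk E)) -
            (ex q (FreeGroup.mk B) + ex q (FreeGroup.mk D)) *
            (ex p (FreeGroup.mk D) + ex p (FreeGroup.mk E))) * e7)
      have hn : 1 ≤ n := by omega
      refine ⟨L ++ [((FreeGroup.mk G)⁻¹ * ((FreeGroup.mk B)⁻¹ * ((FreeGroup.mk [(x, b)])⁻¹ *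
          (FreeGroup.mk E * (FreeGroup.mk D * (FreeGroup.mk B * FreeGroup.mk G))))),
          (FreeGroup.mk G)⁻¹ * ((FreeGroup.mk B)⁻¹ * ((FreeGroup.mk D)⁻¹ *
            ((FreeGroup.mk [(y, c)])⁻¹ * FreeGroup.mk G))))], ?_, ?_, ?_⟩
      · simp; omega
      · rw [mk_hword, mk_letter_inv, mk_letter_inv, handle_eq, List.map_append, List.prod_append,
          ← h2]
        simp only [mk_append', List.map_cons, List.map_nil, List.prod_cons, List.prod_nil, mul_one]
      · have hlen : (hword A B D E G x y b c).length =
          A.length + B.length + D.length + E.length + G.length + 4 := by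
          simp [hword]; omega
        intro t ht
        rw [hlen]
        rcases List.mem_append.1 ht with ht | ht
        · have := h3 t ht
          simp at this; omega
        · simp only [List.mem_singleton] at ht
          subst ht
          simp only [← mk_letter_inv, FreeGroup.inv_mk, FreeGroup.mul_mk]
          constructor
          · refine (norm_mk_le _).trans_lt ?_
            simp [FreeGroup.invRev_length]; omega
          · refine (norm_mk_le _).trans_lt ?_
            simp [FreeGroup.invRev_length]; omega

end Invariant

/-! ## From products of commutators to quadratic words -/

lemma map_cmt {G H : Type*} [Group G] [Group H] (f : G →* H) (t : G × G) :
    f (cmt t) = cmt (f t.1, f t.2) := by simp [cmt]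

lemma map_cmt_prod {G H : Type*} [Group G] [Group H] (f : G →* H) (L : List (G × G)) :
    f ((L.map cmt).prod) = ((L.map (fun t => (f t.1, f t.2))).map cmt).prod := by
  rw [map_list_prod, List.map_map, List.map_map]
  congr 1
  apply List.map_congr_left
  intro t _
  exact map_cmt f t

/-- The word `W` carries a quadratic labelling which is a product of `n` commutators. -/
def QL {α : Type*} (n : ℕ) (W : List (α × Bool)) : Prop :=
  ∃ (X : Type) (w : List (X × Bool)) (f : X → α), Quad w ∧ w.map (Prod.map f id) = W ∧
    ∃ L : List (FreeGroup X × FreeGroup X), L.length = n ∧ FreeGroup.mk w = (L.map cmt).prod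

lemma mk_map {X Y : Type*} (f : X → Y) (w : List (X × Bool)) :
    FreeGroup.mk (w.map (Prod.map f id)) = FreeGroup.map f (FreeGroup.mk w) := by
  rw [FreeGroup.map.mk]; rfl

lemma QL.step {α : Type*} {n : ℕ} {W W' : List (α × Bool)} (h : QL n W)
    (hs : FreeGroup.Red.Step W W') : QL n W' := by
  classical
  obtain ⟨X, w, f, ⟨hnd, hcl⟩, hW, L, hL, hp⟩ := h
  cases hs with
  | @not L₁ L₂ a b =>
    obtain ⟨A, w', rfl, hA, hw'⟩ := List.map_eq_append_iff.1 hW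
    obtain ⟨l, w'', rfl, hl, hw''⟩ := List.map_eq_cons_iff.1 hw'
    obtain ⟨m, G, rfl, hm, hG⟩ := List.map_eq_cons_iff.1 hw''
    obtain ⟨x, b1⟩ := l
    obtain ⟨y, b2⟩ := m
    simp only [Prod.map_apply, id, Prod.mk.injEq] at hl hm
    obtain ⟨hx, rfl⟩ := hl
    obtain ⟨hy, rfl⟩ := hm
    by_cases hxy : x = y
    · subst hxy
      refine ⟨X, A ++ G, f, Quad.remove ⟨hnd, hcl⟩, by simp [hA, hG], L, hL, ?_⟩
      · rw [← hp, mk_append', mk_append', mk_cons' _ (_ :: G), mk_cons' _ G, mk_letter_inv]; group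
    · let σ : X → X := fun z => if z = x then y else z
      have hfσ : f ∘ σ = f := by
        funext z; simp only [σ, Function.comp]; split_ifs with hz
        · rw [hz, hx, hy]
        · rfl
      refine ⟨X, (A ++ G).map (Prod.map σ id), f, ⟨?_, ?_⟩, ?_,
        L.map (fun t => (FreeGroup.map σ t.1, FreeGroup.map σ t.2)), by simpa using hL, ?_⟩
      · obtain ⟨-, hxn, hyn, hn⟩ := nodup_two hnd
        refine List.Nodup.map_on ?_ hn
        rintro ⟨z, d⟩ hz ⟨z', d'⟩ hz' heq
        simp only [Prod.map_apply, id, Prod.mk.injEq, σ] at heq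
        obtain ⟨h1, rfl⟩ := heq
        have hd : d = b1 ∨ d = !b1 := by cases d <;> cases b1 <;> simp
        split_ifs at h1 with h2 h3 h3
        · rw [h2, h3]
        · exfalso; subst h2; subst h1; rcases hd with rfl | rfl <;> tauto
        · exfalso; subst h3; subst h1; rcases hd with rfl | rfl <;> tauto
        · rw [h1]
      · intro z d hz
        obtain ⟨⟨z', d'⟩, hz', heq⟩ := List.mem_map.1 hz
        simp only [Prod.map_apply, id, Prod.mk.injEq] at heq
        obtain ⟨h1, rfl⟩ := heq
        have hm := hcl z' d' (by simp at hz' ⊢; tauto)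
        by_cases hin : (z', !d') ∈ A ++ G
        · exact List.mem_map.2 ⟨(z', !d'), hin, by simp [h1]⟩
        · have hcase : (z' = x ∧ (!d') = b1) ∨ (z' = y ∧ (!d') = !b1) := by
            simp at hm hin ⊢; tauto
          rcases hcase with ⟨rfl, h2⟩ | ⟨rfl, h2⟩
          · have hzy : z = y := by rw [← h1]; simp [σ]
            have := hcl y (!b1) (by simp)
            refine List.mem_map.2 ⟨(y, b1), ?_, ?_⟩
            · simp [Ne.symm hxy] at this ⊢; exact this
            · simp [σ, hzy, h2, Ne.symm hxy]
          · have hzy : z = z' := by rw [← h1]; simp [σ, Ne.symm hxy]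
            have := hcl x b1 (by simp)
            refine List.mem_map.2 ⟨(x, !b1), ?_, ?_⟩
            · simp [hxy] at this ⊢; exact this
            · simp [σ, hzy, h2]
      · rw [List.map_map, Prod.map_comp_map, hfσ]
        simp [hA, hG]
      · rw [← map_cmt_prod, ← hp, ← mk_map]
        simp only [List.map_append, List.map_cons, Prod.map_apply, id]
        have h1 : σ x = y := by simp [σ]
        have h2 : σ y = y := by simp [σ, Ne.symm hxy]
        rw [h1, h2, mk_append', mk_append', mk_cons' _ (_ :: _), mk_cons' (y, !b1),
          mk_letter_inv]
        group

lemma QL.red {α : Type*} {n : ℕ} {W W' : List (α × Bool)} (h : QL n W)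
    (hs : FreeGroup.Red W W') : QL n W' := by
  induction hs with
  | refl => exact h
  | tail _ h2 ih => exact ih.step h2

lemma QL.append {α : Type*} {n m : ℕ} {W W' : List (α × Bool)} (h : QL n W) (h' : QL m W') :
    QL (n + m) (W ++ W') := by
  obtain ⟨X, w, f, ⟨hnd, hcl⟩, hW, L, hL, hp⟩ := h
  obtain ⟨X', w', f', ⟨hnd', hcl'⟩, hW', L', hL', hp'⟩ := h'
  refine ⟨X ⊕ X', w.map (Prod.map Sum.inl id) ++ w'.map (Prod.map Sum.inr id), Sum.elim f f',
    ⟨?_, ?_⟩, ?_,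
    L.map (fun t => (FreeGroup.map Sum.inl t.1, FreeGroup.map Sum.inl t.2)) ++
    L'.map (fun t => (FreeGroup.map Sum.inr t.1, FreeGroup.map Sum.inr t.2)), by simp [hL, hL'], ?_⟩
  · rw [List.nodup_append]
    refine ⟨hnd.map (Sum.inl_injective.prodMap Function.injective_id),
      hnd'.map (Sum.inr_injective.prodMap Function.injective_id), ?_⟩
    rintro ⟨z, d⟩ hz ⟨z', d'⟩ hz' heq
    simp at hz hz' heq
    grind
  · intro z d hz
    simp at hz ⊢
    rcases hz with ⟨a, h1, h2⟩ | ⟨a, h1, h2⟩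
    · left; exact ⟨a, by cases d <;> simpa using hcl _ _ h1, h2⟩
    · right; exact ⟨a, by cases d <;> simpa using hcl' _ _ h1, h2⟩
  · simp only [List.map_append, List.map_map, Prod.map_comp_map, Sum.elim_comp_inl,
      Sum.elim_comp_inr, Function.comp_id, hW, hW']
  · rw [mk_append', mk_map, mk_map, hp, hp', map_cmt_prod, map_cmt_prod, List.map_append,
      List.prod_append]

lemma QL.single {α : Type*} (a b : List (α × Bool)) :
    QL 1 (FreeGroup.invRev a ++ FreeGroup.invRev b ++ a ++ b) := by
  let a' : List ((Fin a.length ⊕ Fin b.length) × Bool) :=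
    List.ofFn fun i : Fin a.length => (Sum.inl i, (a.get i).2)
  let b' : List ((Fin a.length ⊕ Fin b.length) × Bool) :=
    List.ofFn fun i : Fin b.length => (Sum.inr i, (b.get i).2)
  let f : Fin a.length ⊕ Fin b.length → α := Sum.elim (fun i => (a.get i).1) (fun i => (b.get i).1)
  have ha : a'.map (Prod.map f id) = a := by
    simp only [a', List.map_ofFn]
    conv_rhs => rw [← List.ofFn_get a]
    rfl
  have hb : b'.map (Prod.map f id) = b := by
    simp only [b', List.map_ofFn]
    conv_rhs => rw [← List.ofFn_get b]
    rfl
  have hinv : ∀ l : List ((Fin a.length ⊕ Fin b.length) × Bool),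
      (FreeGroup.invRev l).map (Prod.map f id) = FreeGroup.invRev (l.map (Prod.map f id)) := by
    intro l
    simp only [FreeGroup.invRev, List.map_reverse, List.map_map]
    rfl
  have hmi : ∀ (l : List ((Fin a.length ⊕ Fin b.length) × Bool)) z d,
      (z, d) ∈ FreeGroup.invRev l ↔ (z, !d) ∈ l := by
    intro l z d
    simp only [FreeGroup.invRev, List.mem_reverse, List.mem_map, Prod.mk.injEq, Prod.exists]
    constructor
    · rintro ⟨x, y, h, rfl, rfl⟩; simpa using h
    · intro h; exact ⟨z, !d, h, rfl, by simp⟩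
  have hna : a'.Nodup := by
    refine List.nodup_ofFn.2 fun i j h => ?_
    simp only [Prod.mk.injEq, Sum.inl.injEq] at h
    exact h.1
  have hnb : b'.Nodup := by
    refine List.nodup_ofFn.2 fun i j h => ?_
    simp only [Prod.mk.injEq, Sum.inr.injEq] at h
    exact h.1
  have hni : ∀ l : List ((Fin a.length ⊕ Fin b.length) × Bool), l.Nodup →
      (FreeGroup.invRev l).Nodup := by
    intro l hl
    simp only [FreeGroup.invRev]
    rw [List.nodup_reverse]
    refine hl.map ?_
    rintro ⟨x, c⟩ ⟨y, d⟩ h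
    simpa using h
  have hma : ∀ z d, (z, d) ∈ a' → ∃ i, z = Sum.inl i ∧ d = (a.get i).2 := by
    intro z d h
    obtain ⟨i, hi⟩ := List.mem_ofFn.1 h
    simp only [Prod.mk.injEq] at hi
    exact ⟨i, hi.1.symm, hi.2.symm⟩
  have hmb : ∀ z d, (z, d) ∈ b' → ∃ i, z = Sum.inr i ∧ d = (b.get i).2 := by
    intro z d h
    obtain ⟨i, hi⟩ := List.mem_ofFn.1 h
    simp only [Prod.mk.injEq] at hi
    exact ⟨i, hi.1.symm, hi.2.symm⟩
  have hab : ∀ z d e, (z, d) ∈ a' → (z, e) ∈ b' → False := by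
    intro z d e h1 h2
    obtain ⟨i, h, -⟩ := hma _ _ h1
    obtain ⟨j, h', -⟩ := hmb _ _ h2
    rw [h] at h'; exact absurd h' (by simp)
  have haa : ∀ z d, (z, d) ∈ a' → (z, !d) ∈ a' → False := by
    intro z d h1 h2
    obtain ⟨i, h, h3⟩ := hma _ _ h1
    obtain ⟨j, h', h4⟩ := hma _ _ h2
    rw [h] at h'
    obtain rfl := Sum.inl.inj h'
    rw [← h3] at h4
    simp at h4
  have hbb : ∀ z d, (z, d) ∈ b' → (z, !d) ∈ b' → False := by
    intro z d h1 h2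
    obtain ⟨i, h, h3⟩ := hmb _ _ h1
    obtain ⟨j, h', h4⟩ := hmb _ _ h2
    rw [h] at h'
    obtain rfl := Sum.inr.inj h'
    rw [← h3] at h4
    simp at h4
  refine ⟨_, FreeGroup.invRev a' ++ FreeGroup.invRev b' ++ a' ++ b', f, ⟨?_, ?_⟩, ?_,
    [(FreeGroup.mk a', FreeGroup.mk b')], rfl, ?_⟩
  · simp only [List.nodup_append, List.mem_append]
    refine ⟨⟨⟨hni _ hna, hni _ hnb, ?_⟩, hna, ?_⟩, hnb, ?_⟩
    · rintro ⟨z, d⟩ h1 _ h2 rfl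
      rw [hmi] at h1 h2
      exact hab _ _ _ h1 h2
    · rintro ⟨z, d⟩ h1 _ h2 rfl
      rw [hmi, hmi] at h1
      rcases h1 with h1 | h1
      · exact haa _ _ h2 h1
      · exact hab _ _ _ h2 h1
    · rintro ⟨z, d⟩ h1 _ h2 rfl
      rw [hmi, hmi] at h1
      rcases h1 with (h1 | h1) | h1
      · exact hab _ _ _ h1 h2
      · exact hbb _ _ h2 h1
      · exact hab _ _ _ h1 h2
  · intro z d h
    simp only [List.mem_append, hmi, Bool.not_not] at h ⊢
    tauto
  · simp only [List.map_append, hinv, ha, hb]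
  · simp [cmt, FreeGroup.inv_mk, FreeGroup.mul_mk]

lemma QL.nil {α : Type*} : QL 0 ([] : List (α × Bool)) :=
  ⟨Empty, [], Empty.elim, ⟨by simp, by simp⟩, rfl, [], rfl, by simp [← FreeGroup.one_eq_mk]⟩

lemma QL.exists_word {α : Type*} (L : List (FreeGroup α × FreeGroup α)) :
    ∃ W : List (α × Bool), QL L.length W ∧ FreeGroup.mk W = (L.map cmt).prod := by
  induction L with
  | nil => exact ⟨[], QL.nil, by simp [← FreeGroup.one_eq_mk]⟩
  | cons t L ih =>
    obtain ⟨W, h1, h2⟩ := ih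
    obtain ⟨u, v⟩ := t
    obtain ⟨a, rfl⟩ : ∃ a, FreeGroup.mk a = u := Quot.exists_rep u
    obtain ⟨b, rfl⟩ : ∃ b, FreeGroup.mk b = v := Quot.exists_rep v
    refine ⟨_, (QL.single a b).append h1 |> (by rw [List.length_cons, add_comm]; exact ·), ?_⟩
    rw [← FreeGroup.mul_mk, h2, List.map_cons, List.prod_cons]
    congr 1
/-! ## The symplectic representation and the conclusion -/

section
variable {X : Type} [DecidableEq X]

lemma ex_cmt (p : X) (t : FreeGroup X × FreeGroup X) : ex p (cmt t) = 0 := by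
  simp only [cmt, ex_mul, ex_inv]; ring

lemma inum_cmt (p q : X) (t : FreeGroup X × FreeGroup X) :
    inum p q (cmt t) = ex p t.1 * ex q t.2 - ex p t.2 * ex q t.1 := by
  simp [inum, cmt, hs_a, hs_b]; ring

lemma inum_prod (p q : X) (L : List (FreeGroup X × FreeGroup X)) :
    inum p q (L.map cmt).prod =
      (L.map fun t => ex p t.1 * ex q t.2 - ex p t.2 * ex q t.1).sum := by
  induction L with
  | nil => simp [inum_one]
  | cons t L ih => simp [inum_mul, ih, inum_cmt, ex_cmt]

/-- The standard symplectic form. -/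
def sympl (n : ℕ) : ((Fin n → ℚ) × (Fin n → ℚ)) →ₗ[ℚ] ((Fin n → ℚ) × (Fin n → ℚ)) →ₗ[ℚ] ℚ :=
  LinearMap.mk₂ ℚ (fun u v => ∑ i, (u.1 i * v.2 i - u.2 i * v.1 i))
    (by intro u v w; rw [← Finset.sum_add_distrib]; apply Finset.sum_congr rfl; intros; simp; ring)
    (by intro c u v; rw [smul_eq_mul, Finset.mul_sum]; apply Finset.sum_congr rfl; intros; simp; ring)
    (by intro u v w; rw [← Finset.sum_add_distrib]; apply Finset.sum_congr rfl; intros; simp; ring)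
    (by intro c u v; rw [smul_eq_mul, Finset.mul_sum]; apply Finset.sum_congr rfl; intros; simp; ring)

lemma quad_comm {w : List (X × Bool)} (hw : Quad w) (L : List (FreeGroup X × FreeGroup X))
    (hp : FreeGroup.mk w = (L.map cmt).prod) :
    ∃ L' : List (FreeGroup X × FreeGroup X), L'.length ≤ L.length ∧
        FreeGroup.mk w = (L'.map cmt).prod ∧
        ∀ t ∈ L', t.1.norm < 2 * w.length ∧ t.2.norm < 2 * w.length := by
  refine quad_main w.length w rfl hw L.length ((Fin L.length → ℚ) × (Fin L.length → ℚ))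
    (sympl L.length) ?_ ?_ (fun p => (fun i => ex p (L.get i).1, fun i => ex p (L.get i).2)) ?_
  · intro v
    simp [sympl, mul_comm]
  · simp; omega
  · intro p q _ _ _
    rw [hp, inum_prod]
    simp only [sympl, LinearMap.mk₂_apply]
    conv_lhs => rw [← List.ofFn_get L, List.map_ofFn, List.sum_ofFn]
    rfl
end

lemma norm_map_le {X α : Type*} [DecidableEq X] [DecidableEq α] (f : X → α) (u : FreeGroup X) :
    (FreeGroup.map f u).norm ≤ u.norm := by
  conv_lhs => rw [← FreeGroup.mk_toWord (x := u), ← mk_map]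
  refine FreeGroup.norm_mk_le.trans ?_
  simp [FreeGroup.norm]

lemma prod_ofFn_cmt {G : Type*} [Group G] (n : ℕ) (a b : Fin n → G) :
    (List.ofFn fun i => (a i)⁻¹ * (b i)⁻¹ * a i * b i).prod =
      ((List.ofFn fun i => (a i, b i)).map cmt).prod := by
  rw [List.map_ofFn]; rfl



/-- **Theorem 1 (orientable case).** Let `C` be a nontrivial element of a free group `F`
whose orientable genus is `g`, i.e. `g` is the least positive integer such that `C` is a
product of `g` commutators (`[x,y] = x⁻¹ y⁻¹ x y`).  Then `C` can be written as a product
of `g` commutators `[a₁,b₁] ⋯ [a_g,b_g]` with `|aᵢ| < 2|C|` and `|bᵢ| < 2|C|` for all `i`,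
where `|·|` denotes the length of the reduced word. -/
theorem stmt_0 {α : Type*} [DecidableEq α] (C : FreeGroup α) (hC : C ≠ 1) (g : ℕ)
    (hg : IsLeast {n : ℕ | 0 < n ∧ ∃ a b : Fin n → FreeGroup α,
        C = (List.ofFn fun i => (a i)⁻¹ * (b i)⁻¹ * a i * b i).prod} g) :
    ∃ a b : Fin g → FreeGroup α,
      C = (List.ofFn fun i => (a i)⁻¹ * (b i)⁻¹ * a i * b i).prod ∧
      ∀ i, (a i).norm < 2 * C.norm ∧ (b i).norm < 2 * C.norm := by
  classical
  obtain ⟨⟨hg0, a, b, hab⟩, hmin⟩ := hg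
  rw [prod_ofFn_cmt] at hab
  obtain ⟨W, hW, hWC⟩ := QL.exists_word (List.ofFn fun i => (a i, b i))
  rw [← hab] at hWC
  have hred : FreeGroup.Red W C.toWord := by
    rw [← hWC, FreeGroup.toWord_mk]; exact FreeGroup.reduce.red
  obtain ⟨X, w, f, hq, hw, L, hL, hp⟩ := hW.red hred
  obtain ⟨L', hl, hp', hn⟩ := quad_comm hq L hp
  have hlen : w.length = C.norm := by rw [FreeGroup.norm, ← hw, List.length_map]
  have hC' : C = ((L'.map fun t => (FreeGroup.map f t.1, FreeGroup.map f t.2)).map cmt).prod := by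
    rw [← map_cmt_prod, ← hp', ← mk_map, hw, FreeGroup.mk_toWord]
  rw [hL, List.length_ofFn] at hl
  have hC2 : C = (List.ofFn fun i : Fin L'.length => (FreeGroup.map f (L'.get i).1)⁻¹ *
      (FreeGroup.map f (L'.get i).2)⁻¹ * FreeGroup.map f (L'.get i).1 *
      FreeGroup.map f (L'.get i).2).prod := by
    rw [hC']
    conv_lhs => rw [← List.ofFn_get L', List.map_ofFn, List.map_ofFn]
    rfl
  have hpos : 0 < L'.length := by
    rcases Nat.eq_zero_or_pos L'.length with h0 | h0
    · rw [List.length_eq_zero_iff] at h0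
      subst h0
      exact absurd (by simpa using hC') hC
    · exact h0
  have hge : g ≤ L'.length := hmin ⟨hpos, _, _, hC2⟩
  obtain rfl : L'.length = g := le_antisymm hl hge
  refine ⟨_, _, hC2, fun i => ?_⟩
  have := hn (L'.get i) (List.get_mem _ _)
  rw [hlen] at this
  exact ⟨(norm_map_le f _).trans_lt this.1, (norm_map_le f _).trans_lt this.2⟩
end

section
/- Let F be a free group, and for w ∈ F let |w| denote the length of the reduced word representing w. Let C be a nontrivial element of F whose non-orientable genus equals g (i.e., g is the least positive integer such that C is a product of g squares in F). Then there exist nonnegative integers k, m with k + 2m = g and elements d_1,…,d_k, a_1, b_1, …, a_m, b_m ∈ F such that C = d_1²·…·d_k²·[a_1,b_1]·…·[a_m,b_m] and |d_i| < 2|C| for every i = 1,…,k, and |a_j| < 2|C| and |b_j| < 2|C| for every j = 1,…,m. -/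
namespace Quad

variable {ι : Type} {α : Type*}

def T (L : List (ι × Bool)) (v : ι → ZMod 2) : ZMod 2 := (L.map fun p => v p.1).sum

def sg (b : Bool) : ZMod 2 := if b then 1 else 0

def bil : List (ι × Bool) → (ι → ZMod 2) → (ι → ZMod 2) → ZMod 2
  | [], _, _ => 0
  | x :: L, u, v => u x.1 * T L v + sg x.2 * (u x.1 * v x.1) + bil L u v

lemma T_nil (v : ι → ZMod 2) : T [] v = 0 := rfl

lemma T_cons (x : ι × Bool) (L : List (ι × Bool)) (v : ι → ZMod 2) :
    T (x :: L) v = v x.1 + T L v := by simp [T]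

lemma T_append (L M : List (ι × Bool)) (v : ι → ZMod 2) : T (L ++ M) v = T L v + T M v := by
  simp [T]

lemma T_invRev (L : List (ι × Bool)) (v : ι → ZMod 2) : T (FreeGroup.invRev L) v = T L v := by
  induction L with
  | nil => rfl
  | cons x L ih =>
    have : FreeGroup.invRev (x :: L) = FreeGroup.invRev L ++ [(x.1, !x.2)] := by
      simp [FreeGroup.invRev]
    rw [this, T_append, ih, T_cons, T_cons, T_nil]; ring

lemma bil_nil (u v : ι → ZMod 2) : bil [] u v = 0 := rfl

lemma bil_cons (x : ι × Bool) (L : List (ι × Bool)) (u v : ι → ZMod 2) :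
    bil (x :: L) u v = u x.1 * T L v + sg x.2 * (u x.1 * v x.1) + bil L u v := rfl

lemma bil_append (L M : List (ι × Bool)) (u v : ι → ZMod 2) :
    bil (L ++ M) u v = bil L u v + bil M u v + T L u * T M v := by
  induction L with
  | nil => simp [bil_nil, T_nil]
  | cons x L ih =>
    rw [List.cons_append, bil_cons, bil_cons, ih, T_append, T_cons]; ring

lemma h2 : (2 : ZMod 2) = 0 := rfl

lemma sg_not (b : Bool) : sg (!b) = sg b + 1 := by cases b <;> decide

lemma sg_eq (s t : Bool) (h : 1 + sg s + sg t = 0) : t = !s := by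
  revert s t; decide

lemma bil_invRev (L : List (ι × Bool)) (u v : ι → ZMod 2) :
    bil (FreeGroup.invRev L) u v = bil L u v + T L u * T L v := by
  induction L with
  | nil => simp [bil_nil, T_nil, FreeGroup.invRev]
  | cons x L ih =>
    have : FreeGroup.invRev (x :: L) = FreeGroup.invRev L ++ [(x.1, !x.2)] := by
      simp [FreeGroup.invRev]
    rw [this, bil_append, ih, T_invRev]
    simp only [bil_cons, T_cons, T_nil, bil_nil, sg_not]
    grind [h2]

lemma bil_square (A B D : List (ι × Bool)) (x : ι × Bool) (u v : ι → ZMod 2) :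
    bil (A ++ x :: (B ++ x :: D)) u v = bil (A ++ (FreeGroup.invRev B ++ D)) u v +
      (u x.1 + T B u) * (v x.1 + T B v) := by
  simp only [bil_append, bil_cons, T_cons, T_append, T_invRev, bil_invRev]
  generalize bil A u v = a
  generalize bil B u v = b
  generalize bil D u v = d
  generalize T A u = Au, T B u = Bu, T D u = Du, T B v = Bv, T D v = Dv
  grind [h2]

lemma bil_comm (A B D E G : List (ι × Bool)) (x y : ι × Bool) (u v : ι → ZMod 2) :
    bil (A ++ x :: (B ++ y :: (D ++ (x.1, !x.2) :: (E ++ (y.1, !y.2) :: G)))) u v =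
      bil (A ++ (E ++ (D ++ (B ++ G)))) u v +
      (T B u + T D u + u y.1) * (T D v + T E v + v x.1) +
      (T D u + T E u + u x.1) * (T B v + T D v + v y.1) := by
  simp only [bil_append, bil_cons, T_cons, T_append, sg_not]
  generalize bil A u v = a
  generalize bil B u v = b
  generalize bil D u v = d
  generalize bil E u v = e
  generalize bil G u v = g
  generalize T A u = Au, T B u = Bu, T D u = Du, T B v = Bv, T D v = Dv
  generalize T E u = Eu, T E v = Ev, T G u = Gu, T G v = Gv
  grind [h2]

lemma T_map (σ : ι → ι) (L : List (ι × Bool)) (v : ι → ZMod 2) :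
    T (L.map (Prod.map σ id)) v = T L (v ∘ σ) := by
  simp [T, Function.comp_def]

lemma bil_map (σ : ι → ι) (L : List (ι × Bool)) (u v : ι → ZMod 2) :
    bil (L.map (Prod.map σ id)) u v = bil L (u ∘ σ) (v ∘ σ) := by
  induction L with
  | nil => rfl
  | cons x L ih => rw [List.map_cons, bil_cons, bil_cons, ih, T_map]; rfl

lemma bil_cancel (A D : List (ι × Bool)) (x : ι × Bool) (u v : ι → ZMod 2) :
    bil (A ++ x :: (x.1, !x.2) :: D) u v = bil (A ++ D) u v := by
  simp only [bil_append, bil_cons, T_cons, sg_not]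
  grind [h2]

lemma T_congr (L : List (ι × Bool)) (u u' : ι → ZMod 2) (h : ∀ p ∈ L, u p.1 = u' p.1) :
    T L u = T L u' := by
  unfold T
  congr 1
  exact List.map_congr_left h

lemma bil_congr (L : List (ι × Bool)) (u u' v v' : ι → ZMod 2) (h : ∀ p ∈ L, u p.1 = u' p.1)
    (h' : ∀ p ∈ L, v p.1 = v' p.1) : bil L u v = bil L u' v' := by
  induction L with
  | nil => rfl
  | cons x L ih =>
    simp only [List.mem_cons, forall_eq_or_imp] at h h'
    rw [bil_cons, bil_cons, ih h.2 h'.2, T_congr L _ _ h'.2, h.1, h'.1]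

lemma T_zero (L : List (ι × Bool)) : T L 0 = 0 := by
  simp [T]

lemma bil_zero_left (L : List (ι × Bool)) (v : ι → ZMod 2) : bil L 0 v = 0 := by
  induction L with
  | nil => rfl
  | cons x L ih => simp [bil_cons, ih]

/-- evaluation -/
def ev (l : ι → α) (L : List (ι × Bool)) : FreeGroup α := FreeGroup.mk (L.map (Prod.map l id))

lemma ev_append (l : ι → α) (L M : List (ι × Bool)) : ev l (L ++ M) = ev l L * ev l M := by
  simp [ev]
lemma ev_cons (l : ι → α) (x : ι × Bool) (M : List (ι × Bool)) :
    ev l (x :: M) = ev l [x] * ev l M := ev_append l [x] M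
lemma ev_nil (l : ι → α) : ev l ([] : List (ι × Bool)) = 1 := rfl
lemma ev_invRev (l : ι → α) (L : List (ι × Bool)) :
    ev l (FreeGroup.invRev L) = (ev l L)⁻¹ := by
  simp [ev, FreeGroup.invRev, FreeGroup.inv_mk, Function.comp_def]
lemma ev_not (l : ι → α) (x : ι × Bool) : ev l [(x.1, !x.2)] = (ev l [x])⁻¹ := by
  simp [ev, FreeGroup.inv_mk, FreeGroup.invRev]


set_option linter.unusedSectionVars false
set_option linter.unusedSimpArgs false

variable [DecidableEq ι]

/-- number of occurrences of an index -/
def cnt (i : ι) (L : List (ι × Bool)) : ℕ := (L.map Prod.fst).count i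

lemma cnt_nil (i : ι) : cnt i [] = 0 := rfl
lemma cnt_cons (i : ι) (x : ι × Bool) (L : List (ι × Bool)) :
    cnt i (x :: L) = cnt i L + if x.1 = i then 1 else 0 := by
  simp [cnt, List.count_cons]
lemma cnt_append (i : ι) (L M : List (ι × Bool)) : cnt i (L ++ M) = cnt i L + cnt i M := by
  simp [cnt]
lemma cnt_invRev (i : ι) (L : List (ι × Bool)) : cnt i (FreeGroup.invRev L) = cnt i L := by
  simp [cnt, FreeGroup.invRev, List.count_reverse, Function.comp_def]

lemma T_single (i : ι) (L : List (ι × Bool)) : T L (Pi.single i 1) = (cnt i L : ZMod 2) := by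
  induction L with
  | nil => rfl
  | cons x L ih =>
    rw [T_cons, cnt_cons, ih]
    by_cases h : x.1 = i
    · subst h; simp [add_comm]
    · simp [h]

lemma cnt_zero_iff (i : ι) (L : List (ι × Bool)) : cnt i L = 0 ↔ ∀ p ∈ L, p.1 ≠ i := by
  simp only [cnt, List.count_eq_zero, List.mem_map]
  grind

/-- every index occurs zero times or twice -/
def Good (L : List (ι × Bool)) : Prop := ∀ i, cnt i L = 0 ∨ cnt i L = 2

lemma exists_split (i : ι) (L : List (ι × Bool)) (h : 0 < cnt i L) :
    ∃ A s B, L = A ++ (i, s) :: B ∧ cnt i A = 0 := by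
  induction L with
  | nil => simp [cnt] at h
  | cons x L ih =>
    by_cases hx : x.1 = i
    · exact ⟨[], x.2, L, by simp [← hx], rfl⟩
    · obtain ⟨A, s, B, rfl, hA⟩ := ih (by simpa [cnt_cons, hx] using h)
      exact ⟨x :: A, s, B, rfl, by simp [cnt_cons, hx, hA]⟩

lemma exists_split2 (i : ι) (L : List (ι × Bool)) (h : cnt i L = 2) :
    ∃ A s B t D, L = A ++ (i, s) :: (B ++ (i, t) :: D) ∧ cnt i A = 0 ∧ cnt i B = 0 ∧
      cnt i D = 0 := by
  obtain ⟨A, s, M, rfl, hA⟩ := exists_split i L (by omega)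
  simp [cnt_append, cnt_cons, hA] at h
  obtain ⟨B, t, D, rfl, hB⟩ := exists_split i M (by omega)
  simp [cnt_append, cnt_cons, hB] at h
  exact ⟨A, s, B, t, D, rfl, hA, hB, h⟩

/-- the row of a doubly-occurring index -/
lemma bil_single (A B D : List (ι × Bool)) (i : ι) (s t : Bool) (hA : cnt i A = 0)
    (hB : cnt i B = 0) (hD : cnt i D = 0) (v : ι → ZMod 2) :
    bil (A ++ (i, s) :: (B ++ (i, t) :: D)) (Pi.single i 1) v =
      T B v + (1 + sg s + sg t) * v i := by
  have key : ∀ L : List (ι × Bool), cnt i L = 0 → bil L (Pi.single i 1) v = 0 := by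
    intro L hL
    rw [cnt_zero_iff] at hL
    rw [bil_congr L _ 0 v v (fun p hp => by simp [hL p hp]) (fun _ _ => rfl), bil_zero_left]
  simp only [bil_append, bil_cons, T_cons, T_append, key A hA, key B hB, key D hD, T_single, hA,
    hB, hD, Pi.single_eq_same]
  grind [h2]

/-! ### the space of rows -/

def S (L : List (ι × Bool)) : Submodule (ZMod 2) ((ι → ZMod 2) → ZMod 2) :=
  Submodule.span (ZMod 2) (Set.range (bil L))

lemma bil_mem (L : List (ι × Bool)) (u : ι → ZMod 2) : bil L u ∈ S L :=
  Submodule.subset_span ⟨u, rfl⟩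

lemma S_le (L : List (ι × Bool)) (P : Submodule (ZMod 2) ((ι → ZMod 2) → ZMod 2))
    (h : ∀ u, bil L u ∈ P) : S L ≤ P :=
  Submodule.span_le.2 (by rintro _ ⟨u, rfl⟩; exact h u)

variable [Fintype ι]

lemma drop_one (P Q : Submodule (ZMod 2) ((ι → ZMod 2) → ZMod 2)) (hPQ : P ≤ Q)
    (x : ι → ZMod 2) (hP : ∀ p ∈ P, p x = 0) (f : (ι → ZMod 2) → ZMod 2) (hf : f ∈ Q)
    (hfx : f x ≠ 0) : Module.finrank (ZMod 2) P + 1 ≤ Module.finrank (ZMod 2) Q :=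
  Submodule.finrank_lt_finrank_of_lt (lt_of_le_of_ne hPQ (by rintro rfl; exact hfx (hP f hf)))


/-! ### the trivial form -/

lemma ev_eq_one (l : ι → α) : ∀ (n : ℕ) (W : List (ι × Bool)), W.length ≤ n → Good W →
    (∀ u v, bil W u v = 0) → ev l W = 1 := by
  intro n
  induction n with
  | zero =>
    intro W hW _ _
    obtain rfl : W = [] := List.length_eq_zero_iff.1 (by omega)
    rfl
  | succ n ih =>
    intro W hn hW hb
    cases W with
    | nil => rfl
    | cons x M =>
      have h2c : cnt x.1 (x :: M) = 2 := by
        have := hW x.1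
        simp only [cnt_cons, if_true] at this ⊢
        omega
      have hM : 0 < cnt x.1 M := by
        simp only [cnt_cons, if_true] at h2c; omega
      obtain ⟨B, t, D, rfl, hB⟩ := exists_split x.1 M hM
      have hD : cnt x.1 D = 0 := by
        simp [cnt_cons, cnt_append, hB] at h2c; exact h2c
      have row : ∀ v, T B v + (1 + sg x.2 + sg t) * v x.1 = 0 := by
        intro v
        rw [← bil_single [] B D x.1 x.2 t rfl hB hD v]
        exact hb _ _
      have hst : 1 + sg x.2 + sg t = 0 := by
        have := row (Pi.single x.1 1)
        simpa [T_single, hB] using this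
      have hTB : ∀ v, T B v = 0 := by
        intro v
        simpa [hst] using row v
      have ht : t = !x.2 := sg_eq _ _ hst
      have hBcnt : ∀ i, (cnt i B = 0 ∨ cnt i B = 2) ∧ (cnt i D = 0 ∨ cnt i D = 2) ∧
          (cnt i B = 0 ∨ cnt i D = 0) := by
        intro i
        have h1 := hTB (Pi.single i 1)
        rw [T_single, ZMod.natCast_eq_zero_iff] at h1
        have h3 := hW i
        by_cases hxi : x.1 = i
        · subst hxi; simp [hB, hD]
        · simp only [cnt_cons, cnt_append, hxi, if_false] at h3
          omega
      have hbb : ∀ u v : ι → ZMod 2, u x.1 = 0 → v x.1 = 0 →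
          bil B u v + bil D u v = 0 := by
        intro u v hu hv
        have := hb u v
        simp only [bil_cons, bil_append, T_cons, T_append, hTB, hu, hv] at this
        simpa using this
      have hBz : ∀ u v, bil B u v = 0 := by
        intro u v
        let u' : ι → ZMod 2 := fun i => if cnt i B = 0 then 0 else u i
        let v' : ι → ZMod 2 := fun i => if cnt i B = 0 then 0 else v i
        have h1 := hbb u' v' (by simp [u', hB]) (by simp [v', hB])
        have h3 : bil D u' v' = 0 := by
          rw [bil_congr D u' 0 v' v' _ (fun _ _ => rfl), bil_zero_left]
          intro p hp
          have hne : cnt p.1 D ≠ 0 := fun h => (cnt_zero_iff _ _).1 h p hp rfl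
          have := (hBcnt p.1).2.2
          simp only [u']
          rw [if_pos (by omega)]; rfl
        rw [h3, add_zero] at h1
        rw [← h1]
        refine bil_congr _ _ _ _ _ ?_ ?_ <;>
        · intro p hp
          have hne : cnt p.1 B ≠ 0 := fun h => (cnt_zero_iff _ _).1 h p hp rfl
          simp [u', v', hne]
      have hDz : ∀ u v, bil D u v = 0 := by
        intro u v
        let u' : ι → ZMod 2 := fun i => if i = x.1 then 0 else u i
        let v' : ι → ZMod 2 := fun i => if i = x.1 then 0 else v i
        have h1 := hbb u' v' (by simp [u']) (by simp [v'])
        rw [hBz, zero_add] at h1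
        rw [← h1]
        refine bil_congr _ _ _ _ _ ?_ ?_ <;>
        · intro p hp
          have := (cnt_zero_iff _ _).1 hD p hp
          simp [u', v', this]
      simp only [List.length_cons, List.length_append] at hn
      have e1 := ih B (by omega) (fun i => (hBcnt i).1) hBz
      have e2 := ih D (by omega) (fun i => (hBcnt i).2.1) hDz
      change ev l ([x] ++ (B ++ ([(x.1, t)] ++ D))) = 1
      rw [ev_append, ev_append, ev_append, e1, e2, ht, ev_not]
      simp

/-- bilinearity consequence: vanishing on basis vectors -/
lemma T_add (L : List (ι × Bool)) (u v : ι → ZMod 2) : T L (u + v) = T L u + T L v := by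
  induction L with
  | nil => simp [T_nil]
  | cons x L ih => simp only [T_cons, ih, Pi.add_apply]; ring

lemma exists_ne_of_T (L : List (ι × Bool)) (v : ι → ZMod 2) (h : T L v ≠ 0) :
    ∃ j, T L (Pi.single j 1) ≠ 0 := by
  by_contra hc
  push Not at hc
  apply h
  let φ : (ι → ZMod 2) →+ ZMod 2 := ⟨⟨T L, T_zero L⟩, T_add L⟩
  have hs : ∀ (j : ι) (c : ZMod 2), φ (Pi.single j c) = 0 := by
    intro j c
    have : c = 0 ∨ c = 1 := by revert c; decide
    rcases this with rfl | rfl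
    · simp
    · exact hc j
  have : φ = 0 := by
    ext j
    simp [hs]
  exact DFunLike.congr_fun this v

lemma exists_index_of_bil (L : List (ι × Bool)) (u v : ι → ZMod 2) (h : bil L u v ≠ 0) :
    ∃ i, bil L (Pi.single i 1) v ≠ 0 := by
  by_contra hc
  push Not at hc
  apply h
  have hz : bil L 0 v = 0 := bil_zero_left L v
  have hadd : ∀ u u', bil L (u + u') v = bil L u v + bil L u' v := by
    intro u u'
    clear hc h hz
    induction L with
    | nil => simp [bil_nil]
    | cons x L ih => simp only [bil_cons, ih, Pi.add_apply]; ring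
  let φ : (ι → ZMod 2) →+ ZMod 2 := ⟨⟨fun u => bil L u v, hz⟩, hadd⟩
  have hs : ∀ (j : ι) (c : ZMod 2), φ (Pi.single j c) = 0 := by
    intro j c
    have : c = 0 ∨ c = 1 := by revert c; decide
    rcases this with rfl | rfl
    · simp
    · exact hc j
  have : φ = 0 := by
    ext j
    simp [hs]
  exact DFunLike.congr_fun this u

lemma norm_ev_le [DecidableEq α] (l : ι → α) (L : List (ι × Bool)) :
    (ev l L).norm ≤ L.length := by
  unfold ev
  exact FreeGroup.norm_mk_le.trans (by simp)

/-- orientable step -/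
lemma exists_crossing (W : List (ι × Bool)) (hW : Good W)
    (hdiag : ∀ i, bil W (Pi.single i 1) (Pi.single i 1) = 0) (u v : ι → ZMod 2)
    (h : bil W u v ≠ 0) : ∃ A B D E G : List (ι × Bool), ∃ x y : ι × Bool,
      W = A ++ x :: (B ++ y :: (D ++ (x.1, !x.2) :: (E ++ (y.1, !y.2) :: G))) ∧ x.1 ≠ y.1 := by
  have dec : ∀ i, cnt i W = 2 → ∃ A s B D, W = A ++ (i, s) :: (B ++ (i, !s) :: D) ∧
      cnt i A = 0 ∧ cnt i B = 0 ∧ cnt i D = 0 := by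
    intro i hi
    obtain ⟨A, s, B, t, D, hWd, hA, hB, hD⟩ := exists_split2 i W hi
    have h1 := hdiag i
    rw [hWd, bil_single A B D i s t hA hB hD] at h1
    have ht : t = !s := by
      simp [T_single, hB] at h1
      exact sg_eq _ _ h1
    subst ht
    exact ⟨A, s, B, D, hWd, hA, hB, hD⟩
  obtain ⟨i, hi⟩ := exists_index_of_bil W u v h
  have hci : cnt i W = 2 := by
    rcases hW i with h0 | h0
    · exfalso; apply hi
      rw [cnt_zero_iff] at h0
      rw [bil_congr W _ 0 v v (fun p hp => by simp [h0 p hp]) (fun _ _ => rfl), bil_zero_left]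
    · exact h0
  obtain ⟨A, s, B, D, hWd, hA, hB, hD⟩ := dec i hci
  have hTB : T B v ≠ 0 := by
    rw [hWd, bil_single A B D i s (!s) hA hB hD, sg_not] at hi
    have : 1 + sg s + (sg s + 1) = 0 := by grind [h2]
    simpa [this] using hi
  obtain ⟨j, hj⟩ := exists_ne_of_T B v hTB
  rw [T_single, Ne, ZMod.natCast_eq_zero_iff] at hj
  have hji : i ≠ j := by rintro rfl; exact hj (by simp [hB])
  have hcj := hW j
  have hcj' := hcj
  rw [hWd] at hcj
  simp only [cnt_append, cnt_cons, hji, if_false] at hcj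
  have hcj2 : cnt j W = 2 := by
    rcases hcj' with h0 | h0
    · rw [hWd] at h0; simp only [cnt_append, cnt_cons, hji, if_false] at h0; omega
    · exact h0
  obtain ⟨A', s', B', D', hWd', hA', hB', hD'⟩ := dec j hcj2
  obtain ⟨B1, r, B2, hBd, hB1⟩ := exists_split j B (by omega)
  have hB2 : cnt j B2 = 0 := by
    rw [hBd] at hcj hj; simp only [cnt_append, cnt_cons, hji, if_true] at hcj hj; omega
  -- determine signs by uniqueness of the diagonal form
  have sgn : ∀ (A B D : List (ι × Bool)) (s t : Bool), W = A ++ (j, s) :: (B ++ (j, t) :: D) →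
      cnt j A = 0 → cnt j B = 0 → cnt j D = 0 → t = !s := by
    intro A B D s t hWd hA hB hD
    have h1 := hdiag j
    rw [hWd, bil_single A B D j s t hA hB hD] at h1
    simp [T_single, hB] at h1
    exact sg_eq _ _ h1
  by_cases hAj : cnt j A = 0
  · have hDj : 0 < cnt j D := by
      rw [hBd] at hcj; simp only [cnt_append, cnt_cons, hji, if_true] at hcj; omega
    obtain ⟨D1, q, D2, hDd, hD1⟩ := exists_split j D hDj
    have hD2 : cnt j D2 = 0 := by
      rw [hBd, hDd] at hcj; simp only [cnt_append, cnt_cons, hji, if_true] at hcj; omega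
    have hq := sgn (A ++ (i, s) :: B1) (B2 ++ (i, !s) :: D1) D2 r q
      (by rw [hWd, hBd, hDd]; simp) (by simp [cnt_append, cnt_cons, hAj, hB1, hji])
      (by simp [cnt_append, cnt_cons, hB2, hD1, hji]) hD2
    exact ⟨A, B1, B2, D1, D2, (i, s), (j, r), by rw [hWd, hBd, hDd, hq]; simp, hji⟩
  · obtain ⟨A1, q, A2, hAd, hA1⟩ := exists_split j A (by omega)
    have h3 : cnt j A2 = 0 ∧ cnt j D = 0 := by
      rw [hBd, hAd] at hcj; simp only [cnt_append, cnt_cons, hji, if_true] at hcj; omega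
    have hq := sgn A1 (A2 ++ (i, s) :: B1) (B2 ++ (i, !s) :: D) q r
      (by rw [hWd, hBd, hAd]; simp) hA1
      (by simp [cnt_append, cnt_cons, hB1, h3.1, hji])
      (by simp [cnt_append, cnt_cons, hB2, h3.2, hji])
    exact ⟨A1, A2, B1, B2, D, (j, q), (i, s), by rw [hWd, hBd, hAd, hq]; simp, hji.symm⟩

def comm {G : Type*} [Group G] (p : G × G) : G := p.1⁻¹ * p.2⁻¹ * p.1 * p.2

lemma norm_mul3 [DecidableEq α] (a b c : FreeGroup α) :
    (a * b * c).norm ≤ a.norm + b.norm + c.norm :=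
  (FreeGroup.norm_mul_le _ _).trans (Nat.add_le_add_right (FreeGroup.norm_mul_le _ _) _)

lemma orientable [DecidableEq α] (l : ι → α) (N : ℕ) :
    ∀ (n : ℕ) (W : List (ι × Bool)), W.length ≤ n → W.length ≤ N → Good W →
    (∀ i, bil W (Pi.single i 1) (Pi.single i 1) = 0) →
    ∃ cs : List (FreeGroup α × FreeGroup α), 2 * cs.length ≤ Module.finrank (ZMod 2) (S W) ∧
      ev l W = (cs.map comm).prod ∧ ∀ c ∈ cs, c.1.norm < 2 * N ∧ c.2.norm < 2 * N := by
  intro n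
  induction n with
  | zero =>
    intro W hW _ _ _
    obtain rfl : W = [] := List.length_eq_zero_iff.1 (by omega)
    exact ⟨[], by simp, by simp [ev_nil], by simp⟩
  | succ n ih =>
    intro W hn hN hW hdiag
    by_cases hz : ∀ u v, bil W u v = 0
    · exact ⟨[], by simp, by simp [ev_eq_one l _ W le_rfl hW hz], by simp⟩
    push Not at hz
    obtain ⟨u, v, huv⟩ := hz
    obtain ⟨A, B, D, E, G, x, y, hWd, hxy⟩ := exists_crossing W hW hdiag u v huv
    have hxy' := hxy.symm
    have hx : cnt x.1 A = 0 ∧ cnt x.1 B = 0 ∧ cnt x.1 D = 0 ∧ cnt x.1 E = 0 ∧ cnt x.1 G = 0 := by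
      have := hW x.1
      simp only [hWd, cnt_append, cnt_cons, hxy', if_true, if_false] at this
      omega
    have hy : cnt y.1 A = 0 ∧ cnt y.1 B = 0 ∧ cnt y.1 D = 0 ∧ cnt y.1 E = 0 ∧ cnt y.1 G = 0 := by
      have := hW y.1
      simp only [hWd, cnt_append, cnt_cons, hxy, if_true, if_false] at this
      omega
    have hlen : W.length = A.length + B.length + D.length + E.length + G.length + 4 := by
      rw [hWd]; simp; omega
    set W' := A ++ (E ++ (D ++ (B ++ G))) with hW'
    have hGood : Good W' := by
      intro i
      have := hW i
      by_cases hxi : x.1 = i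
      · subst hxi; left; simp [hW', cnt_append, hx]
      by_cases hyi : y.1 = i
      · subst hyi; left; simp [hW', cnt_append, hy]
      simp only [hWd, hW', cnt_append, cnt_cons, hxi, hyi, if_false] at this ⊢
      omega
    let f : (ι → ZMod 2) → ZMod 2 := fun v => T B v + T D v + v y.1
    let g : (ι → ZMod 2) → ZMod 2 := fun v => T D v + T E v + v x.1
    have hbil : ∀ u v, bil W u v = bil W' u v + f u * g v + g u * f v := by
      intro u v
      rw [hWd, bil_comm]
    have hvx : ∀ u, bil W' u (Pi.single x.1 1) = 0 ∧ bil W' (Pi.single x.1 1) u = 0 ∧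
        bil W' u (Pi.single y.1 1) = 0 ∧ bil W' (Pi.single y.1 1) u = 0 := by
      have zr : ∀ (L : List (ι × Bool)) (u : ι → ZMod 2), bil L u 0 = 0 := by
        intro L u
        induction L with
        | nil => rfl
        | cons x L ih => simp [bil_cons, ih, T_zero]
      have cx : cnt x.1 W' = 0 := by simp [hW', cnt_append, hx]
      have cy : cnt y.1 W' = 0 := by simp [hW', cnt_append, hy]
      have kx : ∀ i, cnt i W' = 0 → ∀ p ∈ W', (Pi.single i 1 : ι → ZMod 2) p.1 =
          (0 : ι → ZMod 2) p.1 := by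
        intro i hi p hp
        simp [(cnt_zero_iff _ _).1 hi p hp]
      intro u
      refine ⟨?_, ?_, ?_, ?_⟩
      · rw [bil_congr W' u u _ 0 (fun _ _ => rfl) (kx _ cx), zr]
      · rw [bil_congr W' _ 0 u u (kx _ cx) (fun _ _ => rfl), bil_zero_left]
      · rw [bil_congr W' u u _ 0 (fun _ _ => rfl) (kx _ cy), zr]
      · rw [bil_congr W' _ 0 u u (kx _ cy) (fun _ _ => rfl), bil_zero_left]
    have fx : f (Pi.single x.1 1) = 0 := by simp [f, T_single, hx, hxy']
    have fy : f (Pi.single y.1 1) = 1 := by simp [f, T_single, hy]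
    have gx : g (Pi.single x.1 1) = 1 := by simp [g, T_single, hx]
    have gy : g (Pi.single y.1 1) = 0 := by simp [g, T_single, hy, hxy]
    have hf : bil W (Pi.single x.1 1) = f := by
      funext v; rw [hbil, (hvx v).2.1, fx, gx]; simp
    have hg : bil W (Pi.single y.1 1) = g := by
      funext v; rw [hbil, (hvx v).2.2.2, fy, gy]; simp
    have fS : f ∈ S W := hf ▸ bil_mem W _
    have gS : g ∈ S W := hg ▸ bil_mem W _
    have hle : S W' ≤ S W := by
      apply S_le
      intro u
      have : bil W' u = bil W u - f u • g - g u • f := by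
        funext v
        simp [hbil]
        ring
      rw [this]
      exact Submodule.sub_mem _ (Submodule.sub_mem _ (bil_mem W u) (Submodule.smul_mem _ _ gS))
        (Submodule.smul_mem _ _ fS)
    let K : (ι → ZMod 2) → Submodule (ZMod 2) ((ι → ZMod 2) → ZMod 2) := fun z =>
      LinearMap.ker (LinearMap.proj z)
    have hKx : S W' ≤ K (Pi.single x.1 1) := S_le _ _ fun u => (hvx u).1
    have hKy : S W' ≤ K (Pi.single y.1 1) := S_le _ _ fun u => (hvx u).2.2.1
    have r1 := drop_one (S W') (S W ⊓ K (Pi.single x.1 1)) (le_inf hle hKx) (Pi.single y.1 1)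
      (fun p hp => hKy hp) f ⟨fS, fx⟩ (by simp [fy])
    have r2 := drop_one (S W ⊓ K (Pi.single x.1 1)) (S W) inf_le_left (Pi.single x.1 1)
      (fun p hp => hp.2) g gS (by simp [gx])
    have hlen' : W'.length + 4 = W.length := by
      rw [hlen, hW']; simp; omega
    obtain ⟨cs, hcs, hev, hbd⟩ := ih W' (by omega) (by omega) hGood (by
      intro i
      have h1 := hbil (Pi.single i 1) (Pi.single i 1)
      rw [hdiag i] at h1
      grind [h2])
    let P := ev l (A ++ [x])
    let Q := ev l (FreeGroup.invRev (A ++ (E ++ D)))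
    let R := ev l (A ++ (E ++ (D ++ B)) ++ [y])
    let U := ev l (FreeGroup.invRev (A ++ E))
    refine ⟨((P * Q)⁻¹, (R * U)⁻¹) :: cs, ?_, ?_, ?_⟩
    · simp only [List.length_cons]; omega
    · rw [List.map_cons, List.prod_cons, ← hev, hWd, hW']
      have e1 := ev_not l x
      have e2 := ev_not l y
      change ev l (A ++ ([x] ++ (B ++ ([y] ++ (D ++ ([(x.1, !x.2)] ++ (E ++ ([(y.1, !y.2)] ++ G)))))))) = _
      simp only [P, Q, R, U, comm, ev_append, ev_invRev, e1, e2]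
      group
    · have nP : P.norm ≤ A.length + 1 := (norm_ev_le l _).trans (by simp)
      have nQ : Q.norm ≤ A.length + E.length + D.length :=
        (norm_ev_le l _).trans (by simp; omega)
      have nR : R.norm ≤ A.length + E.length + D.length + B.length + 1 :=
        (norm_ev_le l _).trans (by simp; omega)
      have nU : U.norm ≤ A.length + E.length := (norm_ev_le l _).trans (by simp; omega)
      intro c hc
      rcases List.mem_cons.1 hc with rfl | hc
      · simp only [FreeGroup.norm_inv_eq]
        have := FreeGroup.norm_mul_le P Q
        have := FreeGroup.norm_mul_le R U
        omega
      · exact hbd c hc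

/-! ### extraction of squares -/

lemma mixed [DecidableEq α] (l : ι → α) (N : ℕ) :
    ∀ (n : ℕ) (W : List (ι × Bool)), W.length ≤ n → W.length ≤ N → Good W →
    ∃ (ds : List (FreeGroup α)) (cs : List (FreeGroup α × FreeGroup α)),
      ds.length + 2 * cs.length ≤ Module.finrank (ZMod 2) (S W) ∧
      ev l W = (ds.map (· ^ 2)).prod * (cs.map comm).prod ∧
      (∀ d ∈ ds, d.norm < 2 * N) ∧ ∀ c ∈ cs, c.1.norm < 2 * N ∧ c.2.norm < 2 * N := by
  intro n
  induction n with
  | zero =>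
    intro W hW _ _
    obtain rfl : W = [] := List.length_eq_zero_iff.1 (by omega)
    exact ⟨[], [], by simp, by simp [ev_nil], by simp, by simp⟩
  | succ n ih =>
    intro W hn hN hW
    by_cases hdiag : ∀ i, bil W (Pi.single i 1) (Pi.single i 1) = 0
    · obtain ⟨cs, h1, hev, hb⟩ := orientable l N _ W le_rfl hN hW hdiag
      exact ⟨[], cs, by simpa using h1, by simpa using hev, by simp, hb⟩
    push Not at hdiag
    obtain ⟨i, hi⟩ := hdiag
    have hci : cnt i W = 2 := by
      rcases hW i with h0 | h0
      · exfalso; apply hi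
        rw [cnt_zero_iff] at h0
        rw [bil_congr W _ 0 _ _ (fun p hp => by simp [h0 p hp]) (fun _ _ => rfl), bil_zero_left]
      · exact h0
    obtain ⟨A, s, B, t, D, hWd, hA, hB, hD⟩ := exists_split2 i W hci
    have hst : t = s := by
      rw [hWd, bil_single A B D i s t hA hB hD] at hi
      simp [T_single, hB] at hi
      revert hi; clear hWd; revert s t; decide
    subst hst
    have hlen : W.length = A.length + B.length + D.length + 2 := by
      rw [hWd]; simp; omega
    set W' := A ++ (FreeGroup.invRev B ++ D) with hW'
    have hlen' : W'.length + 2 = W.length := by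
      rw [hlen, hW']; simp; omega
    have hcW' : cnt i W' = 0 := by simp [hW', cnt_append, cnt_invRev, hA, hB, hD]
    have hGood : Good W' := by
      intro j
      have := hW j
      by_cases hij : i = j
      · subst hij; left; exact hcW'
      simp only [hWd, hW', cnt_append, cnt_cons, cnt_invRev, hij, if_false] at this ⊢
      omega
    let f : (ι → ZMod 2) → ZMod 2 := fun v => v i + T B v
    have hbil : ∀ u v, bil W u v = bil W' u v + f u * f v := by
      intro u v
      rw [hWd, bil_square A B D (i, t)]
    have k0 : ∀ p ∈ W', (Pi.single i 1 : ι → ZMod 2) p.1 = (0 : ι → ZMod 2) p.1 := by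
      intro p hp
      simp [(cnt_zero_iff _ _).1 hcW' p hp]
    have hv1 : ∀ u, bil W' u (Pi.single i 1) = 0 := by
      have zr : ∀ (L : List (ι × Bool)) (u : ι → ZMod 2), bil L u 0 = 0 := by
        intro L u
        induction L with
        | nil => rfl
        | cons x L ih => simp [bil_cons, ih, T_zero]
      intro u
      rw [bil_congr W' u u _ 0 (fun _ _ => rfl) k0, zr]
    have hv2 : ∀ u, bil W' (Pi.single i 1) u = 0 := by
      intro u
      rw [bil_congr W' _ 0 u u k0 (fun _ _ => rfl), bil_zero_left]
    have fi : f (Pi.single i 1) = 1 := by simp [f, T_single, hB]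
    have hf : bil W (Pi.single i 1) = f := by
      funext v; rw [hbil, hv2, fi]; simp
    have fS : f ∈ S W := hf ▸ bil_mem W _
    have hle : S W' ≤ S W := by
      apply S_le
      intro u
      have : bil W' u = bil W u - f u • f := by
        funext v
        simp [hbil]
      rw [this]
      exact Submodule.sub_mem _ (bil_mem W u) (Submodule.smul_mem _ _ fS)
    have hK : S W' ≤ LinearMap.ker (LinearMap.proj (Pi.single i 1)) := S_le _ _ fun u => hv1 u
    have r1 := drop_one (S W') (S W) hle (Pi.single i 1) (fun p hp => hK hp) f fS (by simp [fi])
    obtain ⟨ds, cs, hcs, hev, hd, hc⟩ := ih W' (by omega) (by omega) hGood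
    let P := ev l (A ++ ([(i, t)] ++ (B ++ FreeGroup.invRev A)))
    refine ⟨P :: ds, cs, ?_, ?_, ?_, hc⟩
    · simp only [List.length_cons]; omega
    · rw [List.map_cons, List.prod_cons, mul_assoc, ← hev, hWd, hW']
      change ev l (A ++ ([(i, t)] ++ (B ++ ([(i, t)] ++ D)))) = _
      simp only [P, ev_append, ev_invRev, sq]
      group
    · have nP : P.norm ≤ 2 * A.length + B.length + 1 :=
        (norm_ev_le l _).trans (by simp; omega)
      intro c hc
      rcases List.mem_cons.1 hc with rfl | hc
      · omega
      · exact hd c hc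

/-! ### reduction of the labelled word -/

lemma cnt_map_self {i j : ι} (hij : i ≠ j) (L : List (ι × Bool)) :
    cnt i (L.map (Prod.map (Function.update id j i) id)) = cnt i L + cnt j L := by
  induction L with
  | nil => rfl
  | cons x L ih =>
    simp only [List.map_cons, cnt_cons, ih, Prod.map_fst, Function.update_apply, id]
    grind

lemma cnt_map_old {i j : ι} (hij : i ≠ j) (L : List (ι × Bool)) :
    cnt j (L.map (Prod.map (Function.update id j i) id)) = 0 := by
  induction L with
  | nil => rfl
  | cons x L ih =>
    simp only [List.map_cons, cnt_cons, ih, Prod.map_fst, Function.update_apply, id]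
    grind

lemma cnt_map_other {i j k : ι} (hi : k ≠ i) (hj : k ≠ j) (L : List (ι × Bool)) :
    cnt k (L.map (Prod.map (Function.update id j i) id)) = cnt k L := by
  induction L with
  | nil => rfl
  | cons x L ih =>
    simp only [List.map_cons, cnt_cons, ih, Prod.map_fst, Function.update_apply, id]
    grind

lemma finrank_map (σ : ι → ι) (L : List (ι × Bool)) :
    Module.finrank (ZMod 2) (S (L.map (Prod.map σ id))) ≤ Module.finrank (ZMod 2) (S L) := by
  let φ : ((ι → ZMod 2) → ZMod 2) →ₗ[ZMod 2] ((ι → ZMod 2) → ZMod 2) :=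
    LinearMap.funLeft (ZMod 2) (ZMod 2) (fun v => v ∘ σ)
  have h : S (L.map (Prod.map σ id)) ≤ (S L).map φ := by
    apply S_le
    intro u
    refine ⟨bil L (u ∘ σ), bil_mem _ _, ?_⟩
    funext v
    rw [bil_map]; rfl
  exact (Submodule.finrank_mono h).trans (Submodule.finrank_map_le _ _)

lemma reduce_word [DecidableEq α] (l : ι → α) : ∀ (n : ℕ) (W : List (ι × Bool)),
    W.length ≤ n → Good W → ∃ W' : List (ι × Bool), Good W' ∧
      Module.finrank (ZMod 2) (S W') ≤ Module.finrank (ZMod 2) (S W) ∧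
      ev l W' = ev l W ∧ W'.length = (ev l W).norm := by
  intro n
  induction n with
  | zero =>
    intro W hW hG
    obtain rfl : W = [] := List.length_eq_zero_iff.1 (by omega)
    exact ⟨[], hG, le_rfl, rfl, by simp [ev_nil]⟩
  | succ n ih =>
    intro W hn hG
    have hred : FreeGroup.Red (W.map (Prod.map l id)) (FreeGroup.reduce (W.map (Prod.map l id))) :=
      FreeGroup.reduce.red
    rcases Relation.ReflTransGen.cases_head hred with h | ⟨M, hstep, _⟩
    · refine ⟨W, hG, le_rfl, rfl, ?_⟩
      unfold ev FreeGroup.norm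
      rw [FreeGroup.toWord_mk, ← h]; simp
    · generalize hV : W.map (Prod.map l id) = V at hstep
      obtain ⟨L1, L2, a, b⟩ := hstep
      obtain ⟨A, R, hWd, hA, hR⟩ := List.map_eq_append_iff.1 hV
      obtain ⟨x, R', hRd, hx, hR'⟩ := List.map_eq_cons_iff.1 hR
      obtain ⟨y, D, hRd', hy, hD⟩ := List.map_eq_cons_iff.1 hR'
      obtain ⟨i, s⟩ := x
      obtain ⟨j, t⟩ := y
      simp only [Prod.map_apply, id, Prod.mk.injEq] at hx hy
      obtain ⟨hxa, rfl⟩ := hx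
      obtain ⟨hya, rfl⟩ := hy
      subst hRd' hRd
      let σ : ι → ι := Function.update id j i
      have hσj : σ j = i := by simp [σ]
      have hσi : σ i = i := by simp [σ, Function.update_apply]
      have hl : l ∘ σ = l := by
        funext k
        simp only [Function.comp, σ, Function.update_apply, id]
        split_ifs with h
        · rw [h, hxa, hya]
        · rfl
      let m : List (ι × Bool) → List (ι × Bool) := List.map (Prod.map σ id)
      have hm : m W = m A ++ (i, s) :: (i, !s) :: m D := by
        simp [m, hWd, hσi, hσj]
      have hS : S (m A ++ m D) = S (m W) := by
        unfold S
        congr 2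
        funext u v
        rw [hm]
        exact (bil_cancel (m A) (m D) (i, s) u v).symm
      have hev : ev l (m A ++ m D) = ev l W := by
        have h1 : ev l (m W) = ev l W := by
          simp only [ev, m, List.map_map]
          congr 2
          funext p
          exact Prod.ext (congr_fun hl p.1) rfl
        rw [← h1, hm]
        change _ = ev l (m A ++ ([(i, s)] ++ ([(i, !s)] ++ m D)))
        simp only [ev_append]
        rw [ev_not l (i, s)]
        group
      have hGood : Good (m A ++ m D) := by
        intro k
        have hk := hG k
        have hii := hG i
        have hjj := hG j
        have hcm : cnt k (m W) = cnt k (m A ++ m D) + if i = k then 2 else 0 := by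
          rw [hm]; simp only [cnt_append, cnt_cons]; split_ifs <;> omega
        have hiW : 0 < cnt i W := by rw [hWd]; simp [cnt_append, cnt_cons]
        have hjW : 0 < cnt j W := by rw [hWd]; simp [cnt_append, cnt_cons]
        by_cases hij : i = j
        · subst hij
          have : m W = W := by
            have hid : σ = id := Function.update_eq_self i id
            simp only [m, hid, Prod.map_id, List.map_id]
          rw [this] at hcm
          by_cases hik : i = k
          · subst hik; simp at hcm; omega
          · simp [hik] at hcm; omega
        · by_cases hik : i = k
          · subst hik
            have := cnt_map_self hij W
            change cnt i (m W) = _ at this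
            simp at hcm
            omega
          · simp only [hik, if_false] at hcm
            by_cases hjk : j = k
            · subst hjk
              have := cnt_map_old hij W
              change cnt j (m W) = _ at this
              omega
            · have := cnt_map_other (Ne.symm hik) (Ne.symm hjk) W
              change cnt k (m W) = _ at this
              omega
      obtain ⟨W', h1, h3, h4, h5⟩ := ih (m A ++ m D)
        (by rw [hWd] at hn; simp [m] at hn ⊢; omega) hGood
      exact ⟨W', h1, h3.trans (hS ▸ finrank_map σ W), h4.trans hev, hev ▸ h5⟩

/-! ### the initial word -/

def dbl (Ds : List (List (ι × Bool))) : List (ι × Bool) := Ds.flatMap fun D => D ++ D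

lemma cnt_dbl (i : ι) (Ds : List (List (ι × Bool))) : cnt i (dbl Ds) = 2 * cnt i Ds.flatten := by
  induction Ds with
  | nil => rfl
  | cons D Ds ih =>
    have : dbl (D :: Ds) = D ++ D ++ dbl Ds := by simp [dbl]
    rw [this, List.flatten_cons, cnt_append, cnt_append, cnt_append, ih]; omega

lemma T_dbl (v : ι → ZMod 2) (Ds : List (List (ι × Bool))) : T (dbl Ds) v = 0 := by
  induction Ds with
  | nil => rfl
  | cons D Ds ih =>
    have : dbl (D :: Ds) = D ++ D ++ dbl Ds := by simp [dbl]
    rw [this, T_append, T_append, ih]; grind [h2]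

lemma finrank_dbl (Ds : List (List (ι × Bool))) :
    Module.finrank (ZMod 2) (S (dbl Ds)) ≤ Ds.length := by
  induction Ds with
  | nil =>
    have : S (dbl ([] : List (List (ι × Bool)))) = ⊥ := by
      rw [eq_bot_iff]; apply S_le; intro u; rw [Submodule.mem_bot]; rfl
    rw [this]; simp
  | cons D Ds ih =>
    have e : dbl (D :: Ds) = D ++ D ++ dbl Ds := by simp [dbl]
    have h : S (dbl (D :: Ds)) ≤ Submodule.span (ZMod 2) {T D} ⊔ S (dbl Ds) := by
      apply S_le
      intro u
      have : bil (dbl (D :: Ds)) u = T D u • T D + bil (dbl Ds) u := by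
        funext v
        rw [e, bil_append, bil_append, T_dbl]
        simp only [Pi.add_apply, Pi.smul_apply, smul_eq_mul]
        grind [h2]
      rw [this]
      exact Submodule.add_mem_sup (Submodule.smul_mem _ _ (Submodule.mem_span_singleton_self _))
        (bil_mem _ _)
    have h1 := Submodule.finrank_mono h
    have h3 := Submodule.finrank_add_le_finrank_add_finrank
      (Submodule.span (ZMod 2) {T D}) (S (dbl Ds))
    have h4 : Module.finrank (ZMod 2) (Submodule.span (ZMod 2) {T D}) ≤ 1 := by
      simpa using finrank_span_le_card (R := ZMod 2) ({T D} : Set ((ι → ZMod 2) → ZMod 2))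
    simp only [List.length_cons]
    omega

lemma ev_dbl (l : ι → α) (Ds : List (List (ι × Bool))) :
    ev l (dbl Ds) = (Ds.map fun D => ev l D ^ 2).prod := by
  induction Ds with
  | nil => rfl
  | cons D Ds ih =>
    have : dbl (D :: Ds) = D ++ D ++ dbl Ds := by simp [dbl]
    rw [this, ev_append, ev_append, ih, List.map_cons, List.prod_cons, sq]

end Quad

open Quad in
lemma Quad.initial {α : Type*} [DecidableEq α] (g : ℕ) (d : Fin g → FreeGroup α) :
    ∃ (l : (Σ i : Fin g, Fin (d i).toWord.length) → α)
      (W : List ((Σ i : Fin g, Fin (d i).toWord.length) × Bool)), Good W ∧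
      Module.finrank (ZMod 2) (S W) ≤ g ∧ ev l W = (List.ofFn fun i => d i ^ 2).prod := by
  let l : (Σ i : Fin g, Fin (d i).toWord.length) → α := fun p => ((d p.1).toWord.get p.2).1
  let D : Fin g → List ((Σ i : Fin g, Fin (d i).toWord.length) × Bool) := fun i =>
    (List.finRange _).map fun j => (⟨i, j⟩, ((d i).toWord.get j).2)
  let Ds := (List.finRange g).map D
  refine ⟨l, dbl Ds, ?_, ?_, ?_⟩
  · intro p
    have hn : (Ds.flatten.map Prod.fst).Nodup := by
      have : Ds.flatten.map Prod.fst = (List.finRange g).sigma fun i => List.finRange _ := by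
        simp only [Ds, D, List.sigma, List.map_flatten, List.map_map, List.flatMap]
        congr 1
        apply List.map_congr_left
        intro i _
        simp [Function.comp_def]
      rw [this]
      exact (List.nodup_finRange g).sigma fun i => List.nodup_finRange _
    have := List.nodup_iff_count_le_one.1 hn p
    rw [cnt_dbl]
    unfold cnt
    omega
  · simpa [Ds] using finrank_dbl Ds
  · rw [ev_dbl, List.ofFn_eq_map]
    simp only [Ds, List.map_map]
    congr 1
    apply List.map_congr_left
    intro i _
    have : ev l (D i) = d i := by
      unfold ev
      have h : (D i).map (Prod.map l id) = (d i).toWord := by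
        simp only [D, l, List.map_map]
        conv_rhs => rw [← List.map_get_finRange (d i).toWord]
        apply List.map_congr_left
        intro j _
        rfl
      rw [h, FreeGroup.mk_toWord]
    simp [this]


/-- **Theorem 1 (non-orientable case, mixed form).** Let `C` be a nontrivial element of a
free group `F` whose non-orientable genus is `g`, i.e. `g` is the least positive integer
such that `C` is a product of `g` squares.  Then there are `k, m` with `k + 2m = g` and
elements `d₁,…,d_k, a₁,b₁,…,a_m,b_m` such that
`C = d₁² ⋯ d_k² [a₁,b₁] ⋯ [a_m,b_m]` (commutator `[x,y] = x⁻¹ y⁻¹ x y`) with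
`|dᵢ| < 2|C|`, `|aⱼ| < 2|C|`, `|bⱼ| < 2|C|`. -/
theorem stmt_1 {α : Type*} [DecidableEq α] (C : FreeGroup α) (hC : C ≠ 1) (g : ℕ)
    (hg : IsLeast {n : ℕ | 0 < n ∧ ∃ d : Fin n → FreeGroup α,
        C = (List.ofFn fun i => d i ^ 2).prod} g) :
    ∃ k m : ℕ, k + 2 * m = g ∧
      ∃ d : Fin k → FreeGroup α, ∃ a b : Fin m → FreeGroup α,
        C = (List.ofFn fun i => d i ^ 2).prod *
            (List.ofFn fun j => (a j)⁻¹ * (b j)⁻¹ * a j * b j).prod ∧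
        (∀ i, (d i).norm < 2 * C.norm) ∧
        (∀ j, (a j).norm < 2 * C.norm ∧ (b j).norm < 2 * C.norm) := by
  
  obtain ⟨⟨_, d₀, hd₀⟩, _⟩ := hg
  obtain ⟨l, W₀, hG₀, hr₀, he₀⟩ := Quad.initial g d₀
  rw [← hd₀] at he₀
  obtain ⟨W, hG, hr, he, hlen⟩ := Quad.reduce_word l _ W₀ le_rfl hG₀
  rw [he₀] at he hlen
  obtain ⟨ds, cs, hle, hev, hd, hc⟩ := Quad.mixed l C.norm _ W le_rfl hlen.le hG
  have hpos : 0 < C.norm := Nat.pos_of_ne_zero fun h => hC (FreeGroup.norm_eq_zero.1 h)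
  let ds' := List.replicate (g - (ds.length + 2 * cs.length)) 1 ++ ds
  refine ⟨ds'.length, cs.length, ?_, ds'.get, fun j => (cs.get j).1, fun j => (cs.get j).2,
    ?_, ?_, ?_⟩
  · simp only [ds', List.length_append, List.length_replicate]
    omega
  · have h1 : (List.ofFn fun i => ds'.get i ^ 2) = ds'.map (· ^ 2) := by
      conv_rhs => rw [← List.ofFn_get ds', List.map_ofFn]
      rfl
    have h3 : (List.ofFn fun j => ((cs.get j).1)⁻¹ * ((cs.get j).2)⁻¹ * (cs.get j).1 *
        (cs.get j).2) = cs.map Quad.comm := by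
      conv_rhs => rw [← List.ofFn_get cs, List.map_ofFn]
      rfl
    rw [h1, h3, ← he, hev]
    simp [ds']
  · intro i
    have hm : ds'.get i ∈ ds' := List.get_mem _ _
    rcases List.mem_append.1 hm with h | h
    · rw [List.eq_of_mem_replicate h]; simpa using hpos
    · exact hd _ h
  · intro j
    exact hc _ (List.get_mem _ _)
end

section
/- Let F be a free group, and for w ∈ F let |w| denote the length of the reduced word representing w. Let C be a nontrivial element of F whose non-orientable genus equals g (i.e., g is the least positive integer such that C is a product of g squares in F). Then there exist elements a_1, …, a_g ∈ F such that C = a_1²·a_2²·…·a_g² and |a_i| ≤ 3|C|² for every i = 1,…,g. -/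
namespace SqGenus

set_option linter.unusedSectionVars false
set_option linter.unusedSimpArgs false

/-- Words. -/
abbrev Wd (X : Type*) := List (X × Bool)

/-- Number of occurrences of the letter `x` (with either sign). -/
def occ {X : Type*} [DecidableEq X] (L : Wd X) (x : X) : ℕ :=
  L.count (x, true) + L.count (x, false)

section occ
variable {X : Type*} [DecidableEq X]

lemma occ_nil (x : X) : occ ([] : Wd X) x = 0 := by simp [occ]

lemma occ_append (A B : Wd X) (x : X) : occ (A ++ B) x = occ A x + occ B x := by
  simp [occ, List.count_append]; omega

lemma occ_cons (e : X × Bool) (B : Wd X) (x : X) :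
    occ (e :: B) x = (if e.1 = x then 1 else 0) + occ B x := by
  obtain ⟨y, b⟩ := e
  by_cases h : y = x <;> cases b <;> simp [occ, List.count_cons, h] <;> omega

lemma count_invRev (B : Wd X) (x : X) (b : Bool) :
    (FreeGroup.invRev B).count (x, b) = B.count (x, !b) := by
  induction B with
  | nil => simp [FreeGroup.invRev]
  | cons e B ih =>
    obtain ⟨y, c⟩ := e
    have : FreeGroup.invRev ((y, c) :: B) = FreeGroup.invRev B ++ [(y, !c)] := by
      simp [FreeGroup.invRev]
    rw [this, List.count_append, ih, List.count_cons]
    by_cases h : y = x <;> cases b <;> cases c <;> simp [h]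

lemma occ_invRev (B : Wd X) (x : X) : occ (FreeGroup.invRev B) x = occ B x := by
  simp [occ, count_invRev]; omega

lemma occ_pos_of_mem {L : Wd X} {x : X} {b : Bool} (h : (x, b) ∈ L) : 0 < occ L x := by
  have := List.count_pos_iff.mpr h
  cases b <;> simp only [occ] <;> omega

end occ

/-- Mod 2 Magnus expansion truncated at degree 2. -/
@[ext] structure Hs (X : Type*) where
  v : X → ZMod 2
  m : X → X → ZMod 2

namespace Hs
variable {X : Type*}

instance : Mul (Hs X) := ⟨fun a b => ⟨a.v + b.v, fun x y => a.m x y + b.m x y + a.v x * b.v y⟩⟩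
instance : One (Hs X) := ⟨⟨0, 0⟩⟩
instance : Inv (Hs X) := ⟨fun a => ⟨-a.v, fun x y => -a.m x y + a.v x * a.v y⟩⟩

@[simp] lemma mul_v (a b : Hs X) (x : X) : (a * b).v x = a.v x + b.v x := rfl
@[simp] lemma mul_m (a b : Hs X) (x y : X) :
    (a * b).m x y = a.m x y + b.m x y + a.v x * b.v y := rfl
@[simp] lemma one_v (x : X) : (1 : Hs X).v x = 0 := rfl
@[simp] lemma one_m (x y : X) : (1 : Hs X).m x y = 0 := rfl
@[simp] lemma inv_v (a : Hs X) (x : X) : (a⁻¹).v x = -a.v x := rfl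
@[simp] lemma inv_m (a : Hs X) (x y : X) : (a⁻¹).m x y = -a.m x y + a.v x * a.v y := rfl

lemma z2 (a : ZMod 2) : a + a = 0 := CharTwo.add_self_eq_zero a

instance : Group (Hs X) := Group.ofLeftAxioms
  (by intro a b c; ext x y <;> simp <;> ring)
  (by intro a; ext x y <;> simp)
  (by
    intro a
    ext x y
    · simp [z2]
    · have h := z2 (a.m x y + a.v x * a.v y)
      simp
      rw [← h]; ring)

lemma sq_v (a : Hs X) (x : X) : (a ^ 2).v x = 0 := by simp [pow_two, z2]
lemma sq_m (a : Hs X) (x y : X) : (a ^ 2).m x y = a.v x * a.v y := by simp [pow_two, z2]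

end Hs

section hom
variable {X : Type*} [DecidableEq X]

/-- The Magnus homomorphism. -/
def mag : FreeGroup X →* Hs X := FreeGroup.lift fun x => ⟨Pi.single x 1, 0⟩

/-- A letter as a group element. -/
def gen (e : X × Bool) : FreeGroup X := FreeGroup.mk [e]

lemma mag_letter_v (e : X × Bool) (x : X) :
    (mag (gen e)).v x = if e.1 = x then 1 else 0 := by
  obtain ⟨y, b⟩ := e
  by_cases h : y = x
  · subst h
    cases b <;> simp [gen, mag, FreeGroup.lift_mk]
  · have h' : x ≠ y := fun h' => h h'.symm
    cases b <;> simp [gen, mag, FreeGroup.lift_mk, h, h']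

lemma mag_letter_m (e : X × Bool) (x y : X) (h : e.1 ≠ x ∨ e.1 ≠ y) :
    (mag (gen e)).m x y = 0 := by
  obtain ⟨z, b⟩ := e
  cases b
  · rcases h with h | h
    · have h' : x ≠ z := fun h' => h h'.symm
      simp [gen, mag, FreeGroup.lift_mk, h']
    · have h' : y ≠ z := fun h' => h h'.symm
      simp [gen, mag, FreeGroup.lift_mk, h']
  · simp [gen, mag, FreeGroup.lift_mk]

lemma mk_cons (e : X × Bool) (L : Wd X) :
    FreeGroup.mk (e :: L) = gen e * FreeGroup.mk L := by
  rw [gen, FreeGroup.mul_mk]; rfl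

lemma mk_app (A B : Wd X) :
    FreeGroup.mk (A ++ B) = FreeGroup.mk A * FreeGroup.mk B := by
  rw [FreeGroup.mul_mk]

lemma mk_flip (e : X × Bool) : gen (e.1, !e.2) = (gen e)⁻¹ := by
  simp [gen, FreeGroup.inv_mk, FreeGroup.invRev]

lemma mag_zero (L : Wd X) (x : X) (h : occ L x = 0) :
    (mag (FreeGroup.mk L)).v x = 0 ∧ ∀ y, (mag (FreeGroup.mk L)).m x y = 0 ∧
      (mag (FreeGroup.mk L)).m y x = 0 := by
  induction L with
  | nil => 
    rw [← FreeGroup.one_eq_mk, map_one]; simp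
  | cons e L ih =>
    rw [occ_cons] at h
    have h1 : e.1 ≠ x := by
      intro h1; simp [h1] at h
    have h2 : occ L x = 0 := by omega
    obtain ⟨i1, i2⟩ := ih h2
    rw [mk_cons, map_mul]
    have h3 := mag_letter_v e x
    rw [if_neg h1] at h3
    refine ⟨by simp [i1, h3], fun y => ⟨?_, ?_⟩⟩
    · simp [i2, h3, mag_letter_m e x y (Or.inl h1)]
    · simp [i2, i1, mag_letter_m e y x (Or.inr h1)]

/-- Column span. -/
def colspan (M : X → X → ZMod 2) : Submodule (ZMod 2) (X → ZMod 2) :=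
  Submodule.span (ZMod 2) (Set.range fun y => fun x => M x y)

/-- Lower bound for the rank. -/
def LB (M : X → X → ZMod 2) (r : ℕ) : Prop :=
  ∃ t : Fin r → (X → ZMod 2), LinearIndependent (ZMod 2) t ∧ ∀ i, t i ∈ colspan M

lemma colspan_coord (M : X → X → ZMod 2) (a : X) (h : ∀ y, M a y = 0) :
    ∀ t ∈ colspan M, t a = 0 := by
  intro t ht
  unfold colspan at ht
  induction ht using Submodule.span_induction with
  | mem x hx => obtain ⟨y, rfl⟩ := hx; exact h y
  | zero => rfl
  | add x y _ _ h1 h2 => simp [h1, h2]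
  | smul c x _ h1 => simp [h1]

lemma LB_zero (M : X → X → ZMod 2) : LB M 0 :=
  ⟨Fin.elim0, linearIndependent_empty_type, fun i => i.elim0⟩

lemma LB_one (M M' : X → X → ZMod 2) (v : X → ZMod 2) (x : X) (hv : v x = 1)
    (h0 : ∀ y, M' x y = 0 ∧ M' y x = 0) (hM : ∀ y z, M y z = v y * v z + M' y z)
    (r : ℕ) (h : LB M' r) : LB M (r + 1) := by
  obtain ⟨t, ht, hm⟩ := h
  have hvm : v ∈ colspan M := by
    apply Submodule.subset_span
    refine ⟨x, ?_⟩
    funext y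
    simp [hM, hv, (h0 y).2]
  have hle : colspan M' ≤ colspan M := by
    apply Submodule.span_le.mpr
    rintro _ ⟨z, rfl⟩
    have : (fun y => M' y z) = (fun y => M y z) - v z • v := by
      funext y
      simp [hM]; ring
    simp only [SetLike.mem_coe]
    rw [this]
    exact Submodule.sub_mem _ (Submodule.subset_span ⟨z, rfl⟩) (Submodule.smul_mem _ _ hvm)
  refine ⟨Fin.cons v t, ht.finCons ?_, ?_⟩
  · intro hs
    have : Submodule.span (ZMod 2) (Set.range t) ≤ colspan M' :=
      Submodule.span_le.mpr (by rintro _ ⟨i, rfl⟩; exact hm i)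
    have := colspan_coord M' x (fun y => (h0 y).1) v (this hs)
    rw [hv] at this
    exact one_ne_zero this
  · intro i
    refine Fin.cases ?_ ?_ i
    · simpa using hvm
    · intro j; simpa using hle (hm j)

lemma LB_two (M M' : X → X → ZMod 2) (u w : X → ZMod 2) (a b : X)
    (hua : u a = 0) (hub : u b = 1) (hwa : w a = 1) (hwb : w b = 0)
    (ha : ∀ y, M' a y = 0 ∧ M' y a = 0) (hb : ∀ y, M' b y = 0 ∧ M' y b = 0)
    (hM : ∀ y z, M y z = u y * w z + w y * u z + M' y z)
    (r : ℕ) (h : LB M' r) : LB M (r + 2) := by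
  obtain ⟨t, ht, hm⟩ := h
  have hum : u ∈ colspan M := by
    apply Submodule.subset_span
    refine ⟨a, ?_⟩
    funext y
    simp [hM, hua, hwa, (ha y).2]
  have hwm : w ∈ colspan M := by
    apply Submodule.subset_span
    refine ⟨b, ?_⟩
    funext y
    simp [hM, hub, hwb, (hb y).2]
  have hle : colspan M' ≤ colspan M := by
    apply Submodule.span_le.mpr
    rintro _ ⟨z, rfl⟩
    have : (fun y => M' y z) = (fun y => M y z) - w z • u - u z • w := by
      funext y
      simp [hM]; ring
    simp only [SetLike.mem_coe]
    rw [this]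
    exact Submodule.sub_mem _ (Submodule.sub_mem _ (Submodule.subset_span ⟨z, rfl⟩)
      (Submodule.smul_mem _ _ hum)) (Submodule.smul_mem _ _ hwm)
  have hsp : Submodule.span (ZMod 2) (Set.range t) ≤ colspan M' :=
      Submodule.span_le.mpr (by rintro _ ⟨i, rfl⟩; exact hm i)
  have h1 : LinearIndependent (ZMod 2) (Fin.cons w t : Fin (r + 1) → X → ZMod 2) := by
    refine ht.finCons ?_
    intro hs
    have := colspan_coord M' a (fun y => (ha y).1) w (hsp hs)
    rw [hwa] at this
    exact one_ne_zero this
  refine ⟨Fin.cons u (Fin.cons w t : Fin (r + 1) → X → ZMod 2), h1.finCons ?_, ?_⟩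
  · intro hs
    have hk : Submodule.span (ZMod 2) (Set.range (Fin.cons w t : Fin (r + 1) → X → ZMod 2)) ≤
        LinearMap.ker (LinearMap.proj b : (X → ZMod 2) →ₗ[ZMod 2] ZMod 2) := by
      apply Submodule.span_le.mpr
      rintro _ ⟨i, rfl⟩
      refine Fin.cases ?_ ?_ i
      · simpa using hwb
      · intro j
        simpa using colspan_coord M' b (fun y => (hb y).1) _ (hm j)
    have := hk hs
    simp [hub] at this
  · intro i
    refine Fin.cases ?_ ?_ i
    · simpa using hum
    · intro j
      refine Fin.cases ?_ ?_ j
      · simpa using hwm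
      · intro j; simpa using hle (hm j)

lemma mag_prod_v (s : List (FreeGroup X)) (y : X) :
    (mag (s.map (· ^ 2)).prod).v y = 0 := by
  induction s with
  | nil => simp
  | cons a s ih => simp only [List.map_cons, List.prod_cons, map_mul, map_pow, Hs.mul_v,
      Hs.sq_v, ih, add_zero]

lemma mag_prod_ofFn_v {n : ℕ} (d : Fin n → FreeGroup X) (y : X) :
    (mag (List.ofFn fun i => d i ^ 2).prod).v y = 0 := by
  induction n with
  | zero => simp
  | succ n ih =>
    rw [List.ofFn_succ, List.prod_cons, map_mul, Hs.mul_v, ih (fun i => d i.succ), map_pow, Hs.sq_v,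
      add_zero]

lemma mag_prod_ofFn_m {n : ℕ} (d : Fin n → FreeGroup X) (y z : X) :
    (mag (List.ofFn fun i => d i ^ 2).prod).m y z = ∑ i, (mag (d i)).v y * (mag (d i)).v z := by
  induction n with
  | zero => simp
  | succ n ih =>
    rw [List.ofFn_succ, List.prod_cons, map_mul, Hs.mul_m, ih (fun i => d i.succ), map_pow, Hs.sq_m,
      Hs.sq_v, zero_mul, add_zero, Fin.sum_univ_succ]

lemma rank_upper {n : ℕ} (v : Fin n → X → ZMod 2) (M : X → X → ZMod 2)
    (hM : ∀ y z, M y z = ∑ i, v i y * v i z) (r : ℕ) (h : LB M r) :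
    r ≤ n ∧ (0 < n → (∀ x, M x x = 0) → r < n) := by
  obtain ⟨t, ht, hm⟩ := h
  have hle : colspan M ≤ Submodule.span (ZMod 2) (Set.range v) := by
    apply Submodule.span_le.mpr
    rintro _ ⟨z, rfl⟩
    have : (fun y => M y z) = ∑ i, v i z • v i := by
      funext y
      simp [hM, mul_comm]
    simp only [SetLike.mem_coe]
    rw [this]
    exact Submodule.sum_mem _ fun i _ => Submodule.smul_mem _ _ (Submodule.subset_span ⟨i, rfl⟩)
  have hfd : FiniteDimensional (ZMod 2) (Submodule.span (ZMod 2) (Set.range v)) :=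
    FiniteDimensional.span_of_finite _ (Set.finite_range v)
  have hcard : r ≤ Module.finrank (ZMod 2) (Submodule.span (ZMod 2) (Set.range v)) := by
    let t' : Fin r → Submodule.span (ZMod 2) (Set.range v) := fun i => ⟨t i, hle (hm i)⟩
    have ht' : LinearIndependent (ZMod 2) t' := by
      apply LinearIndependent.of_comp (Submodule.subtype _)
      exact ht
    simpa using ht'.fintype_card_le_finrank
  have hup : Module.finrank (ZMod 2) (Submodule.span (ZMod 2) (Set.range v)) ≤ n := by
    simpa [Set.finrank] using finrank_range_le_card (R := ZMod 2) v
  refine ⟨hcard.trans hup, fun hn hd => ?_⟩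
  by_contra hlt
  have heq : Fintype.card (Fin n) = Set.finrank (ZMod 2) (Set.range v) := by
    simp only [Fintype.card_fin, Set.finrank]; omega
  have hli := linearIndependent_iff_card_eq_finrank_span.mpr heq
  have hsum : ∑ i, (1 : ZMod 2) • v i = 0 := by
    funext x
    have h1 := hd x
    rw [hM] at h1
    have h2 : ∀ c : ZMod 2, c * c = c := by decide
    simp only [h2] at h1
    simpa using h1
  have := Fintype.linearIndependent_iff.mp hli (fun _ => 1) hsum ⟨0, hn⟩
  exact one_ne_zero this

end hom

section elim
variable {X : Type*} [DecidableEq X]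

/-- Quadratic words. -/
def Qd (L : Wd X) : Prop := ∀ x, occ L x = 0 ∨ occ L x = 2

/-- Orientable quadratic words. -/
def Ori (L : Wd X) : Prop := ∀ x, L.count (x, true) = L.count (x, false) ∧ L.count (x, false) ≤ 1

/-- The inverse letter. -/
def fl (e : X × Bool) : X × Bool := (e.1, !e.2)

lemma fl_fl (e : X × Bool) : fl (fl e) = e := by simp [fl]
lemma fl_fst (e : X × Bool) : (fl e).1 = e.1 := rfl
lemma mk_fl (e : X × Bool) : gen (fl e) = (gen e)⁻¹ := mk_flip e

lemma Ori.occ_le {L : Wd X} (h : Ori L) (x : X) : occ L x ≤ 2 := by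
  have := h x
  simp only [occ]; omega

lemma Ori.mem_fl {L : Wd X} (h : Ori L) {e : X × Bool} (he : e ∈ L) : fl e ∈ L := by
  obtain ⟨x, b⟩ := e
  have h1 := List.count_pos_iff.mpr he
  have h2 := h x
  apply List.count_pos_iff.mp
  cases b <;> simp only [fl, Bool.not_true, Bool.not_false] <;> omega

lemma norm_letter (e : X × Bool) : (gen e).norm ≤ 1 :=
  FreeGroup.norm_mk_le (L₁ := [e])

lemma elimA (n : ℕ) : ∀ L : Wd X, L.length ≤ n → Qd L → ∃ (s : List (FreeGroup X)) (U : Wd X),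
    FreeGroup.mk L = (s.map (· ^ 2)).prod * FreeGroup.mk U ∧
    U.length + 2 * s.length ≤ L.length ∧ (∀ a ∈ s, a.norm ≤ 2 * L.length) ∧ Ori U ∧
    (∀ r, LB (mag (FreeGroup.mk U)).m r → LB (mag (FreeGroup.mk L)).m (r + s.length)) := by
  induction n with
  | zero =>
    intro L hL _
    have : L = [] := List.length_eq_zero_iff.mp (by omega)
    subst this
    refine ⟨[], [], by simp, by simp, by simp, by intro x; simp, by simp⟩
  | succ n ih =>
    intro L hL hq
    by_cases hex : ∃ e : X × Bool, 2 ≤ L.count e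
    · obtain ⟨e, he⟩ := hex
      obtain ⟨A, R, hLR, heA⟩ := List.eq_append_cons_of_mem (List.count_pos_iff.mp (by omega : 0 < L.count e))
      have heR : e ∈ R := by
        rw [hLR, List.count_append, List.count_eq_zero_of_not_mem heA, List.count_cons_self] at he
        exact List.count_pos_iff.mp (by omega)
      obtain ⟨B, C, rfl⟩ := List.append_of_mem heR
      subst hLR
      set L' := A ++ (FreeGroup.invRev B ++ C) with hL'
      have hocc : ∀ x, occ L' x + 2 * (if e.1 = x then 1 else 0) =
          occ (A ++ e :: (B ++ e :: C)) x := by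
        intro x
        simp only [hL', occ_append, occ_cons, occ_invRev]; omega
      have hx : occ L' e.1 = 0 := by
        have h1 := hocc e.1
        have h2 := hq e.1
        simp at h1; omega
      have hq' : Qd L' := by
        intro x
        by_cases hxe : e.1 = x
        · left; rw [← hxe]; exact hx
        · have h1 := hocc x
          simp only [if_neg hxe] at h1
          have := hq x
          omega
      have hlen : L'.length + 2 = (A ++ e :: (B ++ e :: C)).length := by
        simp [hL', FreeGroup.invRev_length]; omega
      obtain ⟨s, U, h1, h2, h3, h4, h5⟩ := ih L' (by omega) hq'
      set a : FreeGroup X := FreeGroup.mk A * gen e * FreeGroup.mk B *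
        (FreeGroup.mk A)⁻¹ with ha
      have hmk : FreeGroup.mk (A ++ e :: (B ++ e :: C)) = a ^ 2 * FreeGroup.mk L' := by
        rw [hL', ha, mk_app, mk_cons, mk_app, mk_cons, mk_app, mk_app, ← FreeGroup.inv_mk]
        simp only [pow_two, mul_assoc, inv_mul_cancel_left, mul_inv_cancel_left]
      refine ⟨a :: s, U, ?_, ?_, ?_, h4, ?_⟩
      · rw [hmk, h1]; simp [mul_assoc]
      · simp only [List.length_cons]; omega
      · intro c hc
        rcases List.mem_cons.mp hc with rfl | hc
        · have n1 : a.norm ≤ _ := FreeGroup.norm_mul_le _ _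
          have n2 := FreeGroup.norm_mul_le (FreeGroup.mk A * gen e) (FreeGroup.mk B)
          have n3 := FreeGroup.norm_mul_le (FreeGroup.mk A) (gen e)
          have n4 := FreeGroup.norm_mk_le (L₁ := A)
          have n5 := FreeGroup.norm_mk_le (L₁ := B)
          have n6 := norm_letter e
          rw [FreeGroup.norm_inv_eq] at n1
          simp only [List.length_append, List.length_cons]
          omega
        · have := h3 c hc
          omega
      · intro r hr
        have h6 := h5 r hr
        rw [List.length_cons, ← add_assoc]
        obtain ⟨hz1, hz2⟩ := mag_zero L' e.1 hx
        refine LB_one _ _ (mag a).v e.1 ?_ hz2 ?_ _ h6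
        · have hoA : occ A e.1 = 0 := by
            have := hx; simp only [hL', occ_append, occ_invRev] at this; omega
          have hoB : occ B e.1 = 0 := by
            have := hx; simp only [hL', occ_append, occ_invRev] at this; omega
          simp only [ha, map_mul, map_inv, Hs.mul_v, Hs.inv_v, (mag_zero A e.1 hoA).1,
            (mag_zero B e.1 hoB).1, mag_letter_v]
          simp
        · intro y z
          rw [hmk, map_mul, Hs.mul_m, map_pow, Hs.sq_m, Hs.sq_v]; simp
    · push Not at hex
      refine ⟨[], L, by simp, by simp, by simp, ?_, by simp⟩
      intro x
      have h1 := hex (x, true)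
      have h2 := hex (x, false)
      have h3 := hq x
      simp only [occ] at h3
      omega

lemma interlock (U : Wd X) (hU : Ori U) (n : ℕ) : ∀ (A B C : Wd X) (e : X × Bool), B.length ≤ n →
    U = A ++ e :: (B ++ fl e :: C) →
    (∃ A C e, U = A ++ e :: fl e :: C) ∨
    ∃ (P Q R S T : Wd X) (a b : X × Bool), a.1 ≠ b.1 ∧
      U = P ++ a :: (Q ++ b :: (R ++ fl a :: (S ++ fl b :: T))) := by
  induction n with
  | zero =>
    intro A B C e hB h
    have : B = [] := List.length_eq_zero_iff.mp (by omega)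
    subst this
    exact Or.inl ⟨A, C, e, by simpa using h⟩
  | succ n ih =>
    intro A B C e hB h
    cases B with
    | nil => exact Or.inl ⟨A, C, e, by simpa using h⟩
    | cons z B =>
      have hne : z.1 ≠ e.1 := by
        intro hz
        have := hU.occ_le e.1
        rw [h] at this
        simp only [occ_append, occ_cons, fl_fst, hz] at this
        simp only [if_true, List.cons_append, occ_cons, occ_append, hz, fl_fst] at this
        omega
      have hz : fl z ∈ U := hU.mem_fl (by rw [h]; simp)
      have hz' : fl z ∈ A ∨ fl z = e ∨ fl z = z ∨ fl z ∈ B ∨ fl z = fl e ∨ fl z ∈ C := by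
        rw [h] at hz
        simpa [or_assoc] using hz
      rcases hz' with hz | hz | hz | hz | hz | hz
      · obtain ⟨A1, A2, rfl⟩ := List.append_of_mem hz
        refine Or.inr ⟨A1, A2, [], B, C, fl z, e, by simpa [fl_fst] using hne, ?_⟩
        rw [h, fl_fl]; simp
      · exact absurd (congrArg Prod.fst hz) hne
      · have := congrArg Prod.snd hz
        simp [fl] at this
      · obtain ⟨B1, B2, rfl⟩ := List.append_of_mem hz
        refine ih (A ++ [e]) B1 (B2 ++ fl e :: C) z ?_ ?_
        · simp at hB; omega
        · rw [h]; simp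
      · exact absurd (congrArg Prod.fst hz) hne
      · obtain ⟨C1, C2, rfl⟩ := List.append_of_mem hz
        refine Or.inr ⟨A, [], B, C1, C2, e, z, hne.symm, ?_⟩
        rw [h]; simp

lemma elimB (n : ℕ) : ∀ U : Wd X, U.length ≤ n → Ori U → ∃ h : ℕ,
    LB (mag (FreeGroup.mk U)).m (2 * h) ∧ (∀ x, (mag (FreeGroup.mk U)).m x x = 0) ∧
    ∀ p : FreeGroup X, ∃ (s : List (FreeGroup X)) (p' : FreeGroup X), s.length = 2 * h ∧
      p ^ 2 * FreeGroup.mk U = (s.map (· ^ 2)).prod * p' ^ 2 ∧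
      (∀ a ∈ s, a.norm ≤ 3 * p.norm + 2 * U.length ^ 2) ∧
      p'.norm ≤ p.norm + 2 * U.length ^ 2 := by
  induction n with
  | zero =>
    intro L hL _
    have : L = [] := List.length_eq_zero_iff.mp (by omega)
    subst this
    refine ⟨0, LB_zero _, ?_, fun p => ⟨[], p, by simp, ?_, by simp, by simp⟩⟩
    · rw [← FreeGroup.one_eq_mk, map_one]; simp
    · rw [← FreeGroup.one_eq_mk]; simp
  | succ n ih =>
    intro U hL hO
    cases hUc : U with
    | nil => rw [← hUc]; exact ih U (by simp [hUc]) hO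
    | cons e U0 =>
    have hfe : fl e ∈ U0 := by
      have h1 := hO.mem_fl (e := e) (by simp [hUc])
      rw [hUc] at h1
      rcases List.mem_cons.mp h1 with h1 | h1
      · have := congrArg Prod.snd h1
        simp [fl] at this
      · exact h1
    obtain ⟨B0, C0, hBC⟩ := List.append_of_mem hfe
    rw [← hUc]
    rcases interlock U hO B0.length [] B0 C0 e le_rfl (by simp [hUc, hBC]) with
      ⟨A, C, e, h⟩ | ⟨P, Q, R, S, T, a, b, hab, h⟩
    · have hlen : (A ++ C).length + 2 = U.length := by rw [h]; simp; omega
      have hmk : FreeGroup.mk U = FreeGroup.mk (A ++ C) := by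
        rw [h, mk_app, mk_cons, mk_cons, mk_fl, mk_app]; group
      have hO' : Ori (A ++ C) := by
        intro x
        have := hO x
        obtain ⟨y, c⟩ := e
        rw [h] at this
        simp only [fl, List.count_append, List.count_cons] at this ⊢
        by_cases hxy : y = x <;> cases c <;> simp [hxy] at this ⊢ <;> omega
      obtain ⟨k, h1, h2, h3⟩ := ih (A ++ C) (by omega) hO'
      rw [hmk]
      refine ⟨k, h1, h2, fun p => ?_⟩
      obtain ⟨s, p', i1, i2, i3, i4⟩ := h3 p
      have hsq : (A ++ C).length ^ 2 ≤ U.length ^ 2 := Nat.pow_le_pow_left (by omega) 2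
      refine ⟨s, p', i1, i2, fun a ha => (i3 a ha).trans (by omega), i4.trans (by omega)⟩
    · set U' := P ++ (S ++ (R ++ (Q ++ T))) with hU'
      have hlen : U'.length + 4 = U.length := by rw [h, hU']; simp; omega
      have hocc : ∀ x, occ U' x + 2 * (if a.1 = x then 1 else 0) + 2 * (if b.1 = x then 1 else 0) =
          occ U x := by
        intro x
        rw [h]
        simp only [hU', occ_append, occ_cons, fl_fst]
        by_cases ha : a.1 = x <;> by_cases hb : b.1 = x <;> simp [ha, hb] <;> omega
      have hca : occ U' a.1 = 0 := by
        have h1 := hocc a.1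
        have h2 := hO.occ_le a.1
        simp at h1; omega
      have hcb : occ U' b.1 = 0 := by
        have h1 := hocc b.1
        have h2 := hO.occ_le b.1
        simp at h1; omega
      have hO' : Ori U' := by
        intro x
        by_cases hxa : x = a.1
        · subst hxa
          simp only [occ] at hca; omega
        by_cases hxb : x = b.1
        · subst hxb
          simp only [occ] at hcb; omega
        have := hO x
        obtain ⟨y, c⟩ := a
        obtain ⟨z, d⟩ := b
        rw [h] at this
        have hya : ¬ y = x := fun h => hxa h.symm
        have hzb : ¬ z = x := fun h => hxb h.symm
        simp [fl, List.count_append, List.count_cons, hya, hzb] at this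
        simp only [hU', List.count_append]
        omega
      have key : ∀ p : FreeGroup X, p ^ 2 * FreeGroup.mk U =
          (p * p * FreeGroup.mk P * gen a * FreeGroup.mk Q * gen b *
            FreeGroup.mk R * (gen a)⁻¹ * (FreeGroup.mk P)⁻¹ * p⁻¹) ^ 2 *
          (p * FreeGroup.mk P * gen a * (FreeGroup.mk R)⁻¹ * (gen b)⁻¹ *
            (FreeGroup.mk Q)⁻¹ * (gen a)⁻¹ * (FreeGroup.mk P)⁻¹ * p⁻¹ *
            FreeGroup.mk P * FreeGroup.mk S * FreeGroup.mk R * (gen a)⁻¹ *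
            (FreeGroup.mk P)⁻¹ * p⁻¹) ^ 2 *
          ((p * FreeGroup.mk P * gen a * (FreeGroup.mk R)⁻¹ * (FreeGroup.mk S)⁻¹ *
            (FreeGroup.mk P)⁻¹) ^ 2 * FreeGroup.mk U') := by
        intro p
        rw [h, hU']
        simp only [mk_app, mk_fl, mk_cons a, mk_cons b, mk_cons (fl a), mk_cons (fl b)]
        generalize FreeGroup.mk P = P'
        generalize FreeGroup.mk Q = Q'
        generalize FreeGroup.mk R = R'
        generalize FreeGroup.mk S = S'
        generalize FreeGroup.mk T = T'
        generalize gen a = a'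
        generalize gen b = b'
        simp only [pow_two, mul_assoc, inv_mul_cancel_left, mul_inv_cancel_left]
      obtain ⟨k, h1, h2, h3⟩ := ih U' (by omega) hO'
      have hmm : ∀ y z, (mag (FreeGroup.mk U)).m y z =
          (mag (FreeGroup.mk Q * gen b * FreeGroup.mk R)).v y *
            (mag (gen a * FreeGroup.mk R * FreeGroup.mk S)).v z +
          (mag (gen a * FreeGroup.mk R * FreeGroup.mk S)).v y *
          (mag (FreeGroup.mk Q * gen b * FreeGroup.mk R)).v z +
          (mag (FreeGroup.mk U')).m y z := by
        intro y z
        have h4 := key 1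
        rw [one_pow, one_mul] at h4
        rw [h4]
        simp only [map_mul, map_pow, Hs.mul_m, Hs.sq_m, Hs.sq_v, Hs.mul_v, map_inv, Hs.inv_v,
          ZMod.neg_eq_self_mod_two, map_one, Hs.one_v]
        generalize (mag (FreeGroup.mk U')).m y z = w
        generalize (mag (FreeGroup.mk P)).v y = Py
        generalize (mag (FreeGroup.mk Q)).v y = Qy
        generalize (mag (FreeGroup.mk R)).v y = Ry
        generalize (mag (FreeGroup.mk S)).v y = Sy
        generalize (mag (gen a)).v y = ay
        generalize (mag (gen b)).v y = bby
        generalize (mag (FreeGroup.mk P)).v z = Pz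
        generalize (mag (FreeGroup.mk Q)).v z = Qz
        generalize (mag (FreeGroup.mk R)).v z = Rz
        generalize (mag (FreeGroup.mk S)).v z = Sz
        generalize (mag (gen a)).v z = az
        generalize (mag (gen b)).v z = bz
        have h20 : (2 : ZMod 2) = 0 := rfl
        have e1 : ∀ P Q R a b : ZMod 2,
            0 + 0 + P + a + Q + b + R + a + P + 0 = Q + b + R := by decide
        have e2 : ∀ P Q R S a b : ZMod 2, 0 + P + a + R + b + Q + a + P + 0 + P + S + R + a + P + 0
            = (Q + b + R) + (a + R + S) := by decide
        have e3 : ∀ P R S a : ZMod 2, 0 + P + a + R + S + P = a + R + S := by decide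
        simp only [e1, e2, e3]
        generalize Qy + bby + Ry = u
        generalize ay + Ry + Sy = v
        generalize Qz + bz + Rz = u'
        generalize az + Rz + Sz = v'
        linear_combination (u * u' + v * v') * h20
      have hz : ∀ W : Wd X, (∀ x, occ W x ≤ occ U' x) →
          (mag (FreeGroup.mk W)).v a.1 = 0 ∧ (mag (FreeGroup.mk W)).v b.1 = 0 := by
        intro W hW
        exact ⟨(mag_zero W _ (by have := hW a.1; omega)).1,
          (mag_zero W _ (by have := hW b.1; omega)).1⟩
      have hzQ := hz Q (by intro x; simp only [hU', occ_append]; omega)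
      have hzR := hz R (by intro x; simp only [hU', occ_append]; omega)
      have hzS := hz S (by intro x; simp only [hU', occ_append]; omega)
      refine ⟨k + 1, ?_, ?_, fun p => ?_⟩
      · refine LB_two _ _ _ _ a.1 b.1 ?_ ?_ ?_ ?_ (mag_zero U' _ hca).2 (mag_zero U' _ hcb).2 hmm
          (2 * k) h1
        · simp [mag_letter_v, hzQ, hzR, hab.symm]
        · simp [mag_letter_v, hzQ, hzR]
        · simp [mag_letter_v, hzS, hzR]
        · simp [mag_letter_v, hzS, hzR, hab]
      · intro x
        rw [hmm, h2, add_zero, mul_comm, Hs.z2]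
      · obtain ⟨s, p', i1, i2, i3, i4⟩ := h3 (p * FreeGroup.mk P * gen a *
          (FreeGroup.mk R)⁻¹ * (FreeGroup.mk S)⁻¹ * (FreeGroup.mk P)⁻¹)
        have hPn := FreeGroup.norm_mk_le (L₁ := P)
        have hQn := FreeGroup.norm_mk_le (L₁ := Q)
        have hRn := FreeGroup.norm_mk_le (L₁ := R)
        have hSn := FreeGroup.norm_mk_le (L₁ := S)
        have han := norm_letter a
        have hbn := norm_letter b
        have hl : P.length + Q.length + R.length + S.length + 4 ≤ U.length := by
          rw [← hlen, hU']; simp; omega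
        have hm : ∀ (x y : FreeGroup X) (i j : ℕ), x.norm ≤ i → y.norm ≤ j →
            (x * y).norm ≤ i + j := fun x y i j hi hj =>
          (FreeGroup.norm_mul_le x y).trans (Nat.add_le_add hi hj)
        have hi : ∀ (x : FreeGroup X) (i : ℕ), x.norm ≤ i → x⁻¹.norm ≤ i := by
          intro x i hx; rwa [FreeGroup.norm_inv_eq]
        have hp1 : (p * FreeGroup.mk P * gen a *
          (FreeGroup.mk R)⁻¹ * (FreeGroup.mk S)⁻¹ * (FreeGroup.mk P)⁻¹).norm ≤
            p.norm + 2 * U.length := by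
          refine (hm _ _ _ _ (hm _ _ _ _ (hm _ _ _ _ (hm _ _ _ _ (hm _ _ _ _ le_rfl hPn) han)
            (hi _ _ hRn)) (hi _ _ hSn)) (hi _ _ hPn)).trans ?_
          omega
        have hsq : 2 * U'.length ^ 2 + 6 * U.length ≤ 2 * U.length ^ 2 := by
          rw [← hlen]; nlinarith
        have hsq4 : 4 * U.length ≤ 2 * U.length ^ 2 := by
          rw [← hlen]; nlinarith
        refine ⟨(p * p * FreeGroup.mk P * gen a * FreeGroup.mk Q * gen b *
            FreeGroup.mk R * (gen a)⁻¹ * (FreeGroup.mk P)⁻¹ * p⁻¹) ::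
          (p * FreeGroup.mk P * gen a * (FreeGroup.mk R)⁻¹ * (gen b)⁻¹ *
            (FreeGroup.mk Q)⁻¹ * (gen a)⁻¹ * (FreeGroup.mk P)⁻¹ * p⁻¹ *
            FreeGroup.mk P * FreeGroup.mk S * FreeGroup.mk R * (gen a)⁻¹ *
            (FreeGroup.mk P)⁻¹ * p⁻¹) :: s, p', ?_, ?_, ?_, ?_⟩
        · simp [i1]; omega
        · rw [key p, i2]
          simp only [List.map_cons, List.prod_cons]
          simp only [mul_assoc]
        · intro c hc
          rcases List.mem_cons.mp hc with rfl | hc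
          · refine (hm _ _ _ _ (hm _ _ _ _ (hm _ _ _ _ (hm _ _ _ _ (hm _ _ _ _ (hm _ _ _ _
              (hm _ _ _ _ (hm _ _ _ _ (hm _ _ _ _ le_rfl le_rfl) hPn) han) hQn) hbn) hRn)
              (hi _ _ han)) (hi _ _ hPn)) (hi _ _ le_rfl)).trans ?_
            omega
          rcases List.mem_cons.mp hc with rfl | hc
          · refine (hm _ _ _ _ (hm _ _ _ _ (hm _ _ _ _ (hm _ _ _ _ (hm _ _ _ _ (hm _ _ _ _
              (hm _ _ _ _ (hm _ _ _ _ (hm _ _ _ _ (hm _ _ _ _ (hm _ _ _ _ (hm _ _ _ _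
              (hm _ _ _ _ (hm _ _ _ _ le_rfl hPn) han) (hi _ _ hRn)) (hi _ _ hbn))
              (hi _ _ hQn)) (hi _ _ han)) (hi _ _ hPn)) (hi _ _ le_rfl)) hPn) hSn) hRn)
              (hi _ _ han)) (hi _ _ hPn)) (hi _ _ le_rfl)).trans ?_
            omega
          · have := i3 c hc
            omega
        · omega

end elim

section pairing
variable {α : Type*} [DecidableEq α]

/-- Labelled letters with fresh indices. -/
def lab : Wd α → ℕ → Wd (α × ℕ)
  | [], _ => []
  | e :: w, N => ((e.1, N), e.2) :: lab w (N + 1)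

/-- Forget the indices. -/
def forget (L : Wd (α × ℕ)) : Wd α := L.map fun e => (e.1.1, e.2)

lemma forget_lab (w : Wd α) (N : ℕ) : forget (lab w N) = w := by
  induction w generalizing N with
  | nil => rfl
  | cons e w ih =>
    have := ih (N + 1)
    simp only [forget, lab, List.map_cons] at this ⊢
    rw [this]

lemma occ_lab_lt (w : Wd α) (N : ℕ) (a : α) (k : ℕ) (h : k < N) : occ (lab w N) (a, k) = 0 := by
  induction w generalizing N with
  | nil => simp [lab, occ_nil]
  | cons e w ih =>
    rw [lab, occ_cons, ih (N + 1) (by omega), if_neg]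
    simp; omega

lemma occ_lab_ge (w : Wd α) (N : ℕ) (a : α) (k : ℕ) (h : N + w.length ≤ k) :
    occ (lab w N) (a, k) = 0 := by
  induction w generalizing N with
  | nil => simp [lab, occ_nil]
  | cons e w ih =>
    simp only [List.length_cons] at h
    rw [lab, occ_cons, ih (N + 1) (by omega), if_neg]
    simp; omega

lemma occ_lab_le (w : Wd α) (N : ℕ) (a : α) (k : ℕ) : occ (lab w N) (a, k) ≤ 1 := by
  induction w generalizing N with
  | nil => simp [lab, occ_nil]
  | cons e w ih =>
    rw [lab, occ_cons]
    by_cases h : k = N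
    · rw [occ_lab_lt w (N + 1) a k (by omega)]
      split_ifs <;> omega
    · have := ih (N + 1)
      rw [if_neg (by simp; omega)]
      omega

lemma start (l : List (FreeGroup α)) : ∀ N : ℕ, ∃ (L : Wd (α × ℕ)) (s : List (FreeGroup (α × ℕ))),
    s.length = l.length ∧ FreeGroup.mk L = (s.map (· ^ 2)).prod ∧ Qd L ∧
    (∀ a k, k < N → occ L (a, k) = 0) ∧ FreeGroup.mk (forget L) = (l.map (· ^ 2)).prod := by
  induction l with
  | nil =>
    intro N
    refine ⟨[], [], rfl, rfl, fun x => Or.inl (occ_nil x), fun a k _ => occ_nil _, rfl⟩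
  | cons d l ih =>
    intro N
    obtain ⟨L, s, h1, h2, h3, h4, h5⟩ := ih (N + d.toWord.length)
    refine ⟨lab d.toWord N ++ (lab d.toWord N ++ L), FreeGroup.mk (lab d.toWord N) :: s, ?_, ?_,
      ?_, ?_, ?_⟩
    · simp [h1]
    · rw [mk_app, mk_app, h2]; simp only [List.map_cons, List.prod_cons, pow_two, mul_assoc]
    · rintro ⟨a, k⟩
      simp only [occ_append]
      by_cases hk : k < N + d.toWord.length
      · rw [h4 a k hk]
        have := occ_lab_le d.toWord N a k
        omega
      · rw [occ_lab_ge d.toWord N a k (by omega)]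
        simpa using h3 (a, k)
    · intro a k hk
      simp only [occ_append]
      rw [h4 a k (by omega), occ_lab_lt _ _ _ _ hk]
    · have : forget (lab d.toWord N ++ (lab d.toWord N ++ L)) =
          d.toWord ++ (d.toWord ++ forget L) := by
        have := forget_lab d.toWord N
        simp only [forget, List.map_append] at this ⊢
        rw [this]
      rw [this, mk_app, mk_app, h5, FreeGroup.mk_toWord]
      simp [pow_two, mul_assoc]

/-- Identify two letters. -/
def idf {X : Type*} [DecidableEq X] (y z : X) : X → X := fun t => if t = z then y else t

lemma occ_idf {X : Type*} [DecidableEq X] (y z : X) (hyz : y ≠ z) (L : Wd X) (x : X) :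
    occ (L.map fun e => (idf y z e.1, e.2)) x =
      if x = y then occ L y + occ L z else if x = z then 0 else occ L x := by
  induction L with
  | nil => simp [occ_nil]
  | cons e L ih =>
    rw [List.map_cons, occ_cons, ih]
    simp only [occ_cons, idf]
    by_cases h1 : e.1 = z
    · by_cases h2 : x = y
      · subst h2; simp [h1, hyz, hyz.symm]; omega
      · by_cases h3 : x = z
        · subst h3; simp [h1, hyz, hyz.symm]
        · have h2' : ¬ y = x := fun h => h2 h.symm
          have h3' : ¬ z = x := fun h => h3 h.symm
          simp [h1, h2, h3, h2', h3']
    · by_cases h2 : x = y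
      · subst h2; simp [h1]; omega
      · by_cases h3 : x = z
        · subst h3; simp [h1, h2]
        · simp [h1, h2, h3]

lemma redStep (g : ℕ) (K K' : Wd α) (hs : FreeGroup.Red.Step K K')
    (h : ∃ (L : Wd (α × ℕ)) (s : List (FreeGroup (α × ℕ))), s.length = g ∧
      FreeGroup.mk L = (s.map (· ^ 2)).prod ∧ Qd L ∧ forget L = K) :
    ∃ (L : Wd (α × ℕ)) (s : List (FreeGroup (α × ℕ))), s.length = g ∧
      FreeGroup.mk L = (s.map (· ^ 2)).prod ∧ Qd L ∧ forget L = K' := by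
  obtain ⟨L, s, h1, h2, h3, h4⟩ := h
  cases hs with
  | @not K1 K2 x b =>
    obtain ⟨A, R, rfl, hA, hR⟩ := List.map_eq_append_iff.mp h4
    obtain ⟨e1, R, rfl, he1, hR⟩ := List.map_eq_cons_iff.mp hR
    obtain ⟨e2, B, rfl, he2, hB⟩ := List.map_eq_cons_iff.mp hR
    obtain ⟨y, b1⟩ := e1
    obtain ⟨z, b2⟩ := e2
    simp only [Prod.mk.injEq] at he1 he2
    obtain ⟨hy, rfl⟩ := he1
    obtain ⟨hz, rfl⟩ := he2
    set f := idf y z with hf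
    have fy : f y = y := by simp [hf, idf]
    have fz : f z = y := by simp [hf, idf]
    refine ⟨(A ++ B).map fun e => (f e.1, e.2), s.map (FreeGroup.map f), by simp [h1], ?_, ?_, ?_⟩
    · have h5 := congrArg (FreeGroup.map f) h2
      rw [FreeGroup.map.mk, map_list_prod, List.map_map] at h5
      rw [List.map_map]
      have h6 : ((fun x : FreeGroup (α × ℕ) => x ^ 2) ∘ ⇑(FreeGroup.map f)) =
          (⇑(FreeGroup.map f) ∘ fun x => x ^ 2) := by
        funext t; simp
      rw [h6, ← h5]
      simp only [List.map_append, List.map_cons, fy, fz]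
      exact (Quot.sound FreeGroup.Red.Step.not).symm
    · intro x
      have h5 := h3 x
      simp only [occ_append, occ_cons] at h5
      by_cases hyz : y = z
      · subst hyz
        have hid : f = id := by
          funext t
          simp only [hf, idf, id]
          split_ifs with h
          · exact h.symm
          · rfl
        simp only [hid, id, Prod.mk.eta, List.map_id', occ_append]
        split_ifs at h5 <;> omega
      · rw [hf, occ_idf y z hyz]
        have h6 := h3 y
        have h7 := h3 z
        have hzy : ¬ z = y := fun h => hyz h.symm
        simp only [occ_append, occ_cons, hyz, hzy, if_true, if_false] at h6 h7
        simp only [occ_append]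
        split_ifs with c1 c2
        · omega
        · left; rfl
        · rw [if_neg (fun h => c1 h.symm), if_neg (fun h => c2 h.symm)] at h5
          omega
    · have hff : ∀ t, (f t).1 = t.1 := by
        intro t
        simp only [hf, idf]
        split_ifs with h
        · rw [h, hy, hz]
        · rfl
      simp only [forget, List.map_map, List.map_append]
      rw [← hA, ← hB]
      congr 1 <;> (apply List.map_congr_left; intro e _; simp [hff])

lemma redMany (g : ℕ) (K K' : Wd α) (hs : FreeGroup.Red K K')
    (h : ∃ (L : Wd (α × ℕ)) (s : List (FreeGroup (α × ℕ))), s.length = g ∧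
      FreeGroup.mk L = (s.map (· ^ 2)).prod ∧ Qd L ∧ forget L = K) :
    ∃ (L : Wd (α × ℕ)) (s : List (FreeGroup (α × ℕ))), s.length = g ∧
      FreeGroup.mk L = (s.map (· ^ 2)).prod ∧ Qd L ∧ forget L = K' := by
  induction hs with
  | refl => exact h
  | tail _ hstep ih => exact redStep g _ _ hstep ih

lemma list_to_fin {G : Type*} [Group G] (s : List G) :
    (List.ofFn fun i : Fin s.length => s.get i ^ 2) = s.map (· ^ 2) := by
  conv_rhs => rw [← List.ofFn_get s]
  rw [List.map_ofFn]; rfl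

lemma main (C : FreeGroup α) (hC : C ≠ 1) (g : ℕ) (hg0 : 0 < g) (d : Fin g → FreeGroup α)
    (hd : C = (List.ofFn fun i => d i ^ 2).prod) :
    ∃ s : List (FreeGroup α), 0 < s.length ∧ s.length ≤ g ∧ C = (s.map (· ^ 2)).prod ∧
      ∀ a ∈ s, a.norm ≤ 3 * C.norm ^ 2 := by
  obtain ⟨L0, s0, h1, h2, h3, -, h5⟩ := start (List.ofFn d) 0
  have hmap : (List.ofFn d).map (· ^ 2) = List.ofFn fun i => d i ^ 2 := by
    rw [List.map_ofFn]; rfl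
  rw [hmap, ← hd] at h5
  rw [List.length_ofFn] at h1
  have hred : FreeGroup.Red (forget L0) C.toWord := by
    rw [← h5, FreeGroup.toWord_mk]; exact FreeGroup.reduce.red
  obtain ⟨L, q, q1, q2, q3, q4⟩ := redMany g _ _ hred ⟨L0, s0, h1, h2, h3, rfl⟩
  have hlen : L.length = C.norm := by
    rw [FreeGroup.norm, ← q4]; simp [forget]
  have hCL : C = FreeGroup.map Prod.fst (FreeGroup.mk L) := by
    rw [FreeGroup.map.mk, ← FreeGroup.mk_toWord (x := C), ← q4]; rfl
  have hnpos : 0 < C.norm := by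
    rw [Nat.pos_iff_ne_zero, Ne, FreeGroup.norm_eq_zero]; exact hC
  obtain ⟨s, U, a1, a2, a3, a4, a5⟩ := elimA L.length L le_rfl q3
  obtain ⟨h, b1, b2, b3⟩ := elimB U.length U le_rfl a4
  -- the rank bound
  have hLB := a5 _ b1
  have hup := rank_upper (fun i : Fin q.length => (mag (q.get i)).v) (mag (FreeGroup.mk L)).m
    (by
      intro y z
      rw [q2, ← list_to_fin, mag_prod_ofFn_m]) _ hLB
  rw [q1] at hup
  -- a solution over the big alphabet
  have hbig : ∃ t : List (FreeGroup (α × ℕ)), 0 < t.length ∧ t.length ≤ g ∧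
      FreeGroup.mk L = (t.map (· ^ 2)).prod ∧ ∀ a ∈ t, a.norm ≤ 3 * L.length ^ 2 := by
    rcases List.eq_nil_or_concat s with hs | ⟨s', p, hs⟩
    · subst hs
      simp only [List.map_nil, List.prod_nil, one_mul, List.length_nil, add_zero, mul_zero] at a1 a2 hup
      obtain ⟨t, p', c1, c2, c3, c4⟩ := b3 1
      have hlt := hup.2 hg0 (by rw [a1]; exact b2)
      have hsq : U.length ^ 2 ≤ L.length ^ 2 := Nat.pow_le_pow_left a2 2
      simp only [FreeGroup.norm_one] at c3 c4
      refine ⟨t ++ [p'], by simp, by simp; omega, ?_, ?_⟩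
      · rw [a1]; simpa using c2
      · intro a ha
        rcases List.mem_append.mp ha with ha | ha
        · have := c3 a ha; omega
        · rw [List.mem_singleton.mp ha]; omega
    · rw [List.concat_eq_append] at hs
      subst hs
      obtain ⟨t, p', c1, c2, c3, c4⟩ := b3 p
      have hp := a3 p (by simp)
      have hle := hup.1
      simp only [List.length_append, List.length_singleton] at a2 hle
      have hsq : 6 * L.length + 2 * U.length ^ 2 ≤ 3 * L.length ^ 2 := by
        obtain ⟨m, hm⟩ : ∃ m, L.length = U.length + 2 + m := ⟨L.length - U.length - 2, by omega⟩
        rw [hm]; nlinarith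
      refine ⟨s' ++ (t ++ [p']), by simp, by simp; omega, ?_, ?_⟩
      · rw [a1]
        simp only [List.map_append, List.prod_append, List.map_cons, List.map_nil, List.prod_cons,
          List.prod_nil, mul_one]
        rw [mul_assoc, c2]
      · intro a ha
        rcases List.mem_append.mp ha with ha | ha
        · have := a3 a (by simp [ha]); omega
        rcases List.mem_append.mp ha with ha | ha
        · have := c3 a ha; omega
        · rw [List.mem_singleton.mp ha]; omega
  obtain ⟨t, t1, t2, t3, t4⟩ := hbig
  refine ⟨t.map (FreeGroup.map Prod.fst), by simpa using t1, by simpa using t2, ?_, ?_⟩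
  · rw [hCL, t3, map_list_prod, List.map_map, List.map_map]
    congr 1
    apply List.map_congr_left
    intro a _
    simp
  · intro a ha
    obtain ⟨c, hc, rfl⟩ := List.mem_map.mp ha
    have h6 : (FreeGroup.map Prod.fst c).norm ≤ c.norm := by
      conv_lhs => rw [← FreeGroup.mk_toWord (x := c), FreeGroup.map.mk]
      refine FreeGroup.norm_mk_le.trans ?_
      simp [FreeGroup.norm]
    have := t4 c hc
    rw [hlen] at this
    omega

end pairing

end SqGenus

/-- **Theorem 1 (non-orientable case, product of squares).** Let `C` be a nontrivial
element of a free group `F` whose non-orientable genus is `g`, i.e. `g` is the least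
positive integer such that `C` is a product of `g` squares.  Then `C` can be written as a
product of `g` squares `a₁² ⋯ a_g²` with `|aᵢ| ≤ 3|C|²` for all `i`. -/
theorem stmt_2 {α : Type*} [DecidableEq α] (C : FreeGroup α) (hC : C ≠ 1) (g : ℕ)
    (hg : IsLeast {n : ℕ | 0 < n ∧ ∃ d : Fin n → FreeGroup α,
        C = (List.ofFn fun i => d i ^ 2).prod} g) :
    ∃ a : Fin g → FreeGroup α,
      C = (List.ofFn fun i => a i ^ 2).prod ∧
      ∀ i, (a i).norm ≤ 3 * C.norm ^ 2 := by
  obtain ⟨⟨hg0, d, hd⟩, hmin⟩ := hg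
  obtain ⟨s, h1, h2, h3, h4⟩ := SqGenus.main C hC g hg0 d hd
  have h5 : C = (List.ofFn fun i : Fin s.length => s.get i ^ 2).prod := by
    rw [SqGenus.list_to_fin]; exact h3
  have h6 : g ≤ s.length := hmin ⟨h1, s.get, h5⟩
  obtain rfl : s.length = g := le_antisymm h2 h6
  exact ⟨s.get, h5, fun i => h4 _ (List.get_mem s i)⟩
end

section
/- Let F be a free group, and for w ∈ F let |w| denote the length of the reduced word representing w. Let g ≥ 0 and m ≥ 1, let C_1, …, C_{m-1}, C be nontrivial cyclically reduced elements of F, and set s = |C_1| + … + |C_{m-1}| + |C|. Suppose the standard orientable quadratic equation ( ∏_{i=1}^{g} [x_i,y_i] ) · ( ∏_{j=1}^{m-1} z_j⁻¹ C_j z_j ) · C = 1 has a solution in F, i.e., there exist elements x_1,y_1,…,x_g,y_g, z_1,…,z_{m-1} of F satisfying the equation. Then there exists a solution x_1',y_1',…,x_g',y_g', z_1',…,z_{m-1}' of the same equation in F all of whose values have length at most 2s, i.e., |x_i'| ≤ 2s, |y_i'| ≤ 2s for all i and |z_j'| ≤ 2s for all j. -/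
/-- An element of a free group is cyclically reduced if, in its reduced word,
the first letter is not the inverse of the last letter. -/
def CyclicallyReduced {α : Type*} [DecidableEq α] (w : FreeGroup α) : Prop :=
  ∀ x ∈ w.toWord.head?, ∀ y ∈ w.toWord.getLast?, x.1 = y.1 → x.2 = y.2

namespace QE

section basics
variable {G H : Type*} [Group G] [Group H]

def cm (p : G × G) : G := p.1⁻¹ * p.2⁻¹ * p.1 * p.2

def cprod (l : List (G × G)) : G := (l.map cm).prod

def Com (g : ℕ) (w : G) : Prop := ∃ l : List (G × G), l.length = g ∧ cprod l = w

theorem map_cprod (f : G →* H) (l : List (G × G)) :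
    f (cprod l) = cprod (l.map fun p => (f p.1, f p.2)) := by
  induction l with
  | nil => simp [cprod]
  | cons p l ih =>
    simp only [cprod, List.map_cons, List.prod_cons, map_mul] at ih ⊢
    rw [ih]; simp [cm]

theorem Com.map {g : ℕ} {w : G} (h : Com g w) (f : G →* H) : Com g (f w) := by
  obtain ⟨l, hl, rfl⟩ := h
  exact ⟨_, by simpa using hl, (map_cprod f l).symm⟩

theorem Com.conj {g : ℕ} {a b : G} (h : Com g (a * b)) : Com g (b * a) := by
  have := h.map (MulAut.conj b).toMonoidHom
  simpa [MulAut.conj_apply, mul_assoc] using this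

theorem Com.inv {g : ℕ} {w : G} (h : Com g w) : Com g w⁻¹ := by
  obtain ⟨l, hl, rfl⟩ := h
  refine ⟨(l.map Prod.swap).reverse, by simpa using hl, ?_⟩
  unfold cprod
  rw [List.prod_inv_reverse, List.map_reverse, List.map_map, List.map_map]
  congr 2
  apply List.map_congr_left
  intro p _
  simp [cm, mul_assoc]

end basics

section lift

def linv {β : Type*} (x : β × Bool) : β × Bool := (x.1, !x.2)

@[simp] theorem linv_linv {β : Type*} (x : β × Bool) : linv (linv x) = x := by simp [linv]
@[simp] theorem linv_fst {β : Type*} (x : β × Bool) : (linv x).1 = x.1 := rfl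

theorem linv_inj {β : Type*} : Function.Injective (linv (β := β)) := fun x y h => by
  rw [← linv_linv x, h, linv_linv]

def Quad {β : Type*} (W : List (β × Bool)) : Prop := W.Nodup ∧ ∀ x ∈ W, linv x ∈ W

def lab {α : Type*} (x : (α × ℕ) × Bool) : α × Bool := (x.1.1, x.2)

variable {α : Type*}

def Lifts (g : ℕ) (W : List (α × Bool)) : Prop :=
  ∃ V : List ((α × ℕ) × Bool), V.map lab = W ∧ Quad V ∧ Com g (FreeGroup.mk V)

theorem exists_fresh (V : List ((α × ℕ) × Bool)) : ∃ N, ∀ x ∈ V, x.1.2 < N := by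
  induction V with
  | nil => exact ⟨0, by simp⟩
  | cons a V ih =>
    obtain ⟨N, hN⟩ := ih
    refine ⟨max N (a.1.2 + 1), fun x hx => ?_⟩
    rcases List.mem_cons.1 hx with rfl | hx
    · omega
    · have := hN x hx; omega

theorem lifts_comm {g : ℕ} {W : List (α × Bool)} (h : Lifts g W) (A B : List (α × Bool)) :
    Lifts (g + 1) (FreeGroup.invRev A ++ FreeGroup.invRev B ++ A ++ B ++ W) := by
  obtain ⟨V, rfl, hq, hc⟩ := h
  obtain ⟨N, hN⟩ := exists_fresh V
  have key : ∃ A1 B1 : List ((α × ℕ) × Bool), A1.map lab = A ∧ B1.map lab = B ∧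
      ((A1 ++ B1).map fun x => x.1.2).Nodup ∧ ∀ x ∈ A1 ++ B1, N ≤ x.1.2 := by
    let f : (α × Bool) × ℕ → (α × ℕ) × Bool := fun p => ((p.1.1, p.2), p.1.2)
    refine ⟨(A.zipIdx N).map f, (B.zipIdx (N + A.length)).map f, ?_, ?_, ?_, ?_⟩
    · rw [List.map_map]; exact List.zipIdx_map_fst N A
    · rw [List.map_map]; exact List.zipIdx_map_fst _ B
    · rw [← List.map_append, ← List.zipIdx_append, List.map_map]
      have : ((fun x : (α × ℕ) × Bool => x.1.2) ∘ f) = Prod.snd := rfl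
      rw [this, List.zipIdx_map_snd]
      exact List.nodup_range'
    · intro x hx
      rw [← List.map_append, ← List.zipIdx_append] at hx
      obtain ⟨p, hp, rfl⟩ := List.mem_map.1 hx
      exact List.le_snd_of_mem_zipIdx (x := p) hp
  obtain ⟨A1, B1, rfl, rfl, hnd, hge⟩ := key
  refine ⟨FreeGroup.invRev A1 ++ FreeGroup.invRev B1 ++ A1 ++ B1 ++ V, ?_, ⟨?_, ?_⟩, ?_⟩
  · simp [FreeGroup.invRev, List.map_reverse, Function.comp_def, lab]
  · have hp : List.Perm (FreeGroup.invRev A1 ++ FreeGroup.invRev B1 ++ A1 ++ B1 ++ V)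
        (((A1 ++ B1).map linv ++ (A1 ++ B1)) ++ V) := by
      rw [List.map_append]
      simp only [List.append_assoc]
      refine List.Perm.append (List.reverse_perm _) (List.Perm.append (List.reverse_perm _) ?_)
      rfl
    rw [hp.nodup_iff]
    have hnd1 : (A1 ++ B1).Nodup := hnd.of_map
    have hinj := List.inj_on_of_nodup_map hnd
    rw [List.nodup_append, List.nodup_append]
    refine ⟨⟨hnd1.map linv_inj, hnd1, ?_⟩, hq.1, ?_⟩
    · rintro a ha b hb rfl
      obtain ⟨c, hc1, rfl⟩ := List.mem_map.1 ha
      have := hinj hb hc1 rfl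
      simp [linv, Prod.ext_iff] at this
    · rintro a ha b hb rfl
      have h1 := hN a hb
      rcases List.mem_append.1 ha with ha | ha
      · obtain ⟨c, hc1, rfl⟩ := List.mem_map.1 ha
        have := hge c hc1
        simp at h1; omega
      · have := hge a ha; omega
  · have hi : ∀ (L : List ((α × ℕ) × Bool)) x, x ∈ FreeGroup.invRev L ↔ linv x ∈ L := by
      intro L x
      simp only [FreeGroup.invRev, List.mem_reverse, List.mem_map]
      constructor
      · rintro ⟨a, ha, rfl⟩; simpa [linv] using ha
      · intro h; exact ⟨_, h, by simp [linv]⟩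
    intro x hx
    simp only [List.mem_append, hi, linv_linv] at hx ⊢
    have := hq.2 x
    tauto
  · obtain ⟨l, hl, hl2⟩ := hc
    refine ⟨(FreeGroup.mk A1, FreeGroup.mk B1) :: l, by simpa using hl, ?_⟩
    simp only [cprod, List.map_cons, List.prod_cons] at hl2 ⊢
    rw [hl2]
    simp [cm, FreeGroup.inv_mk, FreeGroup.mul_mk]

theorem lifts_nil : Lifts 0 ([] : List (α × Bool)) :=
  ⟨[], rfl, ⟨by simp, by simp⟩, [], rfl, rfl⟩

theorem lifts_add {g : ℕ} {L M : List (α × Bool)} (x : α) (b : Bool) (h : Lifts g (L ++ M)) :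
    Lifts g (L ++ (x, b) :: (x, !b) :: M) := by
  obtain ⟨V, hV, hq, hc⟩ := h
  obtain ⟨N, hN⟩ := exists_fresh V
  obtain ⟨A, B, rfl, rfl, rfl⟩ := List.map_eq_append_iff.1 hV
  refine ⟨A ++ ((x, N), b) :: ((x, N), !b) :: B, by simp [lab], ⟨?_, ?_⟩, ?_⟩
  · have hp : List.Perm (A ++ ((x, N), b) :: ((x, N), !b) :: B)
      (((x, N), b) :: ((x, N), !b) :: (A ++ B)) :=
      List.perm_middle.trans (List.Perm.cons _ List.perm_middle)
    rw [hp.nodup_iff]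
    have h1 : ∀ c, ((x, N), c) ∉ A ++ B := fun c hc => by simpa using hN _ hc
    simp only [List.nodup_cons, List.mem_cons]
    refine ⟨?_, h1 _, hq.1⟩
    rintro (h | h)
    · simp at h
    · exact h1 _ h
  · intro y hy
    have := hq.2 y
    simp only [List.mem_append, List.mem_cons] at hy this ⊢
    rcases hy with hy | rfl | rfl | hy
    · tauto
    · simp [linv]
    · simp [linv]
    · tauto
  · have : FreeGroup.mk (A ++ ((x, N), b) :: ((x, N), !b) :: B) = FreeGroup.mk (A ++ B) :=
      Quot.sound FreeGroup.Red.Step.not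
    rwa [this]

theorem lifts_step {g : ℕ} {L M : List (α × Bool)} (x : α) (b : Bool)
    (h : Lifts g (L ++ (x, b) :: (x, !b) :: M)) : Lifts g (L ++ M) := by
  classical
  obtain ⟨V, hV, hq, hc⟩ := h
  obtain ⟨A, B', rfl, rfl, hB⟩ := List.map_eq_append_iff.1 hV
  obtain ⟨a, B'', rfl, ha, hB⟩ := List.map_eq_cons_iff.1 hB
  obtain ⟨c, B, rfl, hc', rfl⟩ := List.map_eq_cons_iff.1 hB
  obtain ⟨⟨x3, n⟩, s⟩ := a
  obtain ⟨⟨x2, k⟩, t⟩ := c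
  simp only [lab, Prod.mk.injEq] at ha hc'
  obtain ⟨rfl, rfl⟩ := ha
  obtain ⟨rfl, rfl⟩ := hc'
  obtain ⟨hnd, hcl⟩ := hq
  have hp : List.Perm (A ++ ((x2, n), s) :: ((x2, k), !s) :: B)
      (((x2, n), s) :: ((x2, k), !s) :: (A ++ B)) :=
      List.perm_middle.trans (List.Perm.cons _ List.perm_middle)
  rw [hp.nodup_iff] at hnd
  simp only [hp.mem_iff] at hcl
  simp only [List.nodup_cons, List.mem_cons, not_or] at hnd
  obtain ⟨⟨hnd1, hnd2⟩, hnd3, hnd4⟩ := hnd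
  let σ : α × ℕ → α × ℕ := fun y => if y = (x2, k) then (x2, n) else y
  let τ : (α × ℕ) × Bool → (α × ℕ) × Bool := fun y => (σ y.1, y.2)
  have hlin : ∀ y, τ (linv y) = linv (τ y) := fun y => rfl
  refine ⟨(A ++ B).map τ, ?_, ⟨?_, ?_⟩, ?_⟩
  · rw [List.map_map, ← List.map_append]
    apply List.map_congr_left
    rintro ⟨y, i⟩ _
    simp only [lab, τ, σ, Function.comp]
    split_ifs with h <;> simp [h]
  · refine List.Nodup.map_on ?_ hnd4
    rintro ⟨y, i⟩ hy ⟨z, j⟩ hz h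
    simp only [τ, σ, Prod.mk.injEq] at h
    obtain ⟨h, rfl⟩ := h
    by_cases hi : i = s
    · subst hi
      split_ifs at h with h1 h2 h2
      · rw [h1, h2]
      · subst h; exact absurd hz hnd2
      · subst h; exact absurd hy hnd2
      · rw [h]
    · have hi : i = !s := by cases i <;> cases s <;> simp_all
      subst hi
      split_ifs at h with h1 h2 h2
      · rw [h1, h2]
      · subst h1; exact absurd hy hnd3
      · subst h2; exact absurd hz hnd3
      · rw [h]
  · intro y hy
    obtain ⟨z, hz, rfl⟩ := List.mem_map.1 hy
    rw [← hlin]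
    have := hcl z (by simp only [List.mem_cons]; tauto)
    simp only [List.mem_cons] at this
    rcases this with h | h | h
    · -- linv z = a
      have hz' : z = ((x2, n), !s) := by rw [← linv_linv z, h]; rfl
      have h3 : ((x2, k), s) ∈ A ++ B ∨ n = k := by
        have := hcl ((x2, k), !s) (by simp)
        simp only [linv, List.mem_cons, Bool.not_not] at this
        rcases this with h | h | h
        · right; simpa using h.symm
        · simp at h
        · exact Or.inl h
      rcases h3 with h3 | h3
      · have h4 : τ (linv z) = τ ((x2, k), s) := by
          rw [hz']; simp only [τ, σ, linv]; split_ifs <;> simp_all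
        rw [h4]; exact List.mem_map_of_mem h3
      · subst h3; subst hz'; exact absurd hz hnd3
    · have hz' : z = ((x2, k), s) := by rw [← linv_linv z, h]; simp [linv]
      have h3 : ((x2, n), !s) ∈ A ++ B ∨ n = k := by
        have := hcl ((x2, n), s) (by simp)
        simp only [linv, List.mem_cons] at this
        rcases this with h | h | h
        · simp at h
        · right; simpa using h
        · exact Or.inl h
      rcases h3 with h3 | h3
      · have h4 : τ (linv z) = τ ((x2, n), !s) := by
          rw [hz']; simp only [τ, σ, linv]; split_ifs <;> simp_all
        rw [h4]; exact List.mem_map_of_mem h3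
      · subst h3; subst hz'; exact absurd hz hnd2
    · exact List.mem_map_of_mem h
  · have := hc.map (FreeGroup.map σ)
    rw [FreeGroup.map.mk] at this
    have h2 : FreeGroup.mk ((A ++ ((x2, n), s) :: ((x2, k), !s) :: B).map fun y => (σ y.1, y.2)) =
        FreeGroup.mk ((A ++ B).map τ) := by
      have e1 : σ (x2, n) = (x2, n) := by simp only [σ]; split_ifs <;> rfl
      have e2 : σ (x2, k) = (x2, n) := by simp [σ]
      rw [List.map_append, List.map_cons, List.map_cons, List.map_append]
      simp only [e1, e2]
      exact Quot.sound FreeGroup.Red.Step.not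
    rwa [h2] at this

theorem lifts_of_com {g : ℕ} {W : List (α × Bool)} (h : Com g (FreeGroup.mk W)) : Lifts g W := by
  obtain ⟨l, rfl, hl⟩ := h
  have h0 : ∃ W0, Lifts l.length W0 ∧ FreeGroup.mk W0 = cprod l := by
    clear hl
    induction l with
    | nil => exact ⟨[], lifts_nil, rfl⟩
    | cons p l ih =>
      obtain ⟨W0, h1, h2⟩ := ih
      obtain ⟨p, q⟩ := p
      obtain ⟨P, rfl⟩ := Quot.exists_rep p
      obtain ⟨Q, rfl⟩ := Quot.exists_rep q
      refine ⟨_, lifts_comm h1 P Q, ?_⟩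
      simp only [cprod, List.map_cons, List.prod_cons] at h2 ⊢
      rw [← h2]
      change _ = cm (FreeGroup.mk P, FreeGroup.mk Q) * _
      simp [cm, FreeGroup.inv_mk, FreeGroup.mul_mk]
  obtain ⟨W0, h1, h2⟩ := h0
  rw [hl] at h2
  obtain ⟨c, hc1, hc2⟩ := FreeGroup.Red.exact.1 h2
  clear hl
  have h3 : Lifts l.length c := by
    clear hc2
    induction hc1 with
    | refl => exact h1
    | tail _ hs ih =>
      cases hs with
      | not => exact lifts_step _ _ ih
  clear hc1 h1 h2
  induction hc2 using Relation.ReflTransGen.head_induction_on with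
  | refl => exact h3
  | head hs _ ih =>
    cases hs with
    | not => exact lifts_add _ _ ih

end lift

section evaluation
variable {β : Type*} {G : Type*} [Group G]

def lv (f : β → G) (x : β × Bool) : G := cond x.2 (f x.1) (f x.1)⁻¹

def ev (f : β → G) (L : List (β × Bool)) : G := (L.map (lv f)).prod

theorem ev_eq (f : β → G) (L : List (β × Bool)) : FreeGroup.lift f (FreeGroup.mk L) = ev f L := by
  rw [FreeGroup.lift_mk]; rfl

@[simp] theorem ev_nil (f : β → G) : ev f [] = 1 := rfl
@[simp] theorem ev_cons (f : β → G) (x : β × Bool) (L : List (β × Bool)) :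
    ev f (x :: L) = lv f x * ev f L := by simp [ev]
@[simp] theorem ev_append (f : β → G) (L M : List (β × Bool)) :
    ev f (L ++ M) = ev f L * ev f M := by simp [ev]
@[simp] theorem lv_linv (f : β → G) (x : β × Bool) : lv f (linv x) = (lv f x)⁻¹ := by
  obtain ⟨x, b⟩ := x
  cases b <;> simp [lv, linv]

theorem lv_congr {f g : β → G} {x : β × Bool} (h : f x.1 = g x.1) : lv f x = lv g x := by
  simp [lv, h]

theorem ev_congr {f g : β → G} {L : List (β × Bool)} (h : ∀ x ∈ L, f x.1 = g x.1) :
    ev f L = ev g L := by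
  unfold ev
  congr 1
  exact List.map_congr_left fun x hx => lv_congr (h x hx)

theorem exists_set (f : β → G) (a : β × Bool) (t : G) :
    ∃ f' : β → G, lv f' a = t ∧ ∀ y, y ≠ a.1 → f' y = f y := by
  classical
  obtain ⟨a, b⟩ := a
  refine ⟨Function.update f a (cond b t t⁻¹), ?_, fun y hy => Function.update_of_ne hy _ _⟩
  cases b <;> simp [lv]

theorem ev_of (L : List (β × Bool)) : ev FreeGroup.of L = FreeGroup.mk L := by
  rw [← ev_eq]
  have : FreeGroup.lift (FreeGroup.of (α := β)) = MonoidHom.id _ := by ext; simp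
  rw [this]; rfl

theorem quad_remove {W W' : List (β × Bool)} {x : β × Bool} (hq : Quad W)
    (hp : W.Perm (x :: linv x :: W')) : Quad W' ∧ ∀ y ∈ W', y.1 ≠ x.1 := by
  obtain ⟨hn, hc⟩ := hq
  rw [hp.nodup_iff] at hn
  simp only [hp.mem_iff] at hc
  simp only [List.nodup_cons, List.mem_cons, not_or] at hn hc
  obtain ⟨⟨h1, h2⟩, h3, h4⟩ := hn
  refine ⟨⟨h4, fun y hy => ?_⟩, fun y hy h => ?_⟩
  · rcases hc y (by tauto) with h | h | h
    · rw [← h, linv_linv] at h3; exact absurd hy h3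
    · rw [linv_inj h] at hy; exact absurd hy h2
    · exact h
  · obtain ⟨y, b⟩ := y
    obtain ⟨x, c⟩ := x
    simp only at h
    subst h
    cases b <;> cases c <;> simp_all [linv]

theorem quad_perm {W W' : List (β × Bool)} (hq : Quad W) (hp : W.Perm W') : Quad W' := by
  refine ⟨hp.nodup_iff.1 hq.1, fun x hx => ?_⟩
  rw [← hp.mem_iff] at hx ⊢
  exact hq.2 x hx

theorem linv_ne (x : β × Bool) : linv x ≠ x := by
  obtain ⟨x, b⟩ := x
  cases b <;> simp [linv]

theorem quad_find {W : List (β × Bool)} (hq : Quad W) (hne : W ≠ []) :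
    (∃ A x B, W = A ++ x :: linv x :: B) ∨
    (∃ A e B f C D E, W = A ++ e :: (B ++ f :: (C ++ linv e :: (D ++ linv f :: E)))) := by
  have main : ∀ n, ∀ A x B E, B.length = n → W = A ++ x :: (B ++ linv x :: E) →
    (∃ A x B, W = A ++ x :: linv x :: B) ∨
    (∃ A e B f C D E, W = A ++ e :: (B ++ f :: (C ++ linv e :: (D ++ linv f :: E)))) := by
    intro n
    induction n using Nat.strong_induction_on with
    | _ n ih =>
    intro A x B E hn hW
    cases B with
    | nil => left; exact ⟨A, x, E, by simpa using hW⟩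
    | cons f B =>
      have hf : linv f ∈ W := hq.2 f (by rw [hW]; simp)
      have hnd := hq.1
      rw [hW] at hf
      simp only [List.mem_append, List.mem_cons, List.cons_append] at hf
      have n1 : linv f ≠ x := by
        rintro rfl
        rw [hW] at hnd
        simp [List.nodup_append] at hnd
      have n2 : linv f ≠ linv x := by
        intro h
        have := linv_inj h
        subst this
        rw [hW] at hnd
        simp [List.nodup_append] at hnd
      rcases hf with h | h | h | h | h | h
      · obtain ⟨A1, A2, rfl⟩ := List.append_of_mem h
        right
        exact ⟨A1, linv f, A2, x, [], B, E, by simp [hW]⟩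
      · exact absurd h n1
      · exact absurd h (linv_ne f)
      · obtain ⟨B1, B2, rfl⟩ := List.append_of_mem h
        refine ih B1.length ?_ (A ++ [x]) f B1 (B2 ++ linv x :: E) rfl (by simp [hW])
        rw [← hn]; simp
      · exact absurd h n2
      · obtain ⟨E1, E2, rfl⟩ := List.append_of_mem h
        right
        exact ⟨A, x, [], f, B, E1, E2, by simp [hW]⟩
  cases W with
  | nil => exact absurd rfl hne
  | cons x W =>
    have hx := hq.2 x (by simp)
    rcases List.mem_cons.1 hx with h | h
    · exact absurd h (linv_ne x)
    · obtain ⟨B, E, rfl⟩ := List.append_of_mem h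
      exact main _ [] x B E rfl rfl

def SL (N : ℕ) (w : FreeGroup β) : Prop := ∃ L, FreeGroup.mk L = w ∧ L.length ≤ N

theorem SL.mono {N M : ℕ} {w : FreeGroup β} (h : SL N w) (hNM : N ≤ M) : SL M w := by
  obtain ⟨L, h1, h2⟩ := h
  exact ⟨L, h1, h2.trans hNM⟩

theorem quad_red (n : ℕ) : ∀ W : List (β × Bool), W.length ≤ n → Quad W →
    ∃ l : List (FreeGroup β × FreeGroup β), cprod l = FreeGroup.mk W ∧
      (∀ p ∈ l, SL (2 * W.length) p.1 ∧ SL (2 * W.length) p.2) ∧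
      ∀ (G : Type) [Group G] (l' : List (G × G)), l'.length = l.length → ∃ f : β → G, ev f W = cprod l' := by
  induction n with
  | zero =>
    intro W hW _
    have : W = [] := by simpa using hW
    subst this
    refine ⟨[], rfl, by simp, fun G _ l' hl' => ⟨fun _ => 1, ?_⟩⟩
    have : l' = [] := by simpa using hl'
    subst this; rfl
  | succ n ih =>
    intro W hW hq
    by_cases hne : W = []
    · subst hne
      exact ih [] (by simp) hq
    rcases quad_find hq hne with ⟨A, x, B, rfl⟩ | ⟨A, e, B, f, C, D, E, rfl⟩
    · have hp : (A ++ x :: linv x :: B).Perm (x :: linv x :: (A ++ B)) :=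
        List.perm_middle.trans (List.Perm.cons _ List.perm_middle)
      obtain ⟨hq', -⟩ := quad_remove hq hp
      obtain ⟨l, h1, h2, h3⟩ := ih (A ++ B) (by simp at hW ⊢; omega) hq'
      refine ⟨l, ?_, ?_, ?_⟩
      · rw [h1, ← ev_of, ← ev_of]; simp
      · intro p hp
        have := h2 p hp
        exact ⟨this.1.mono (by simp; omega), this.2.mono (by simp; omega)⟩
      · intro G _ l' hl'
        obtain ⟨φ, hφ⟩ := h3 G l' hl'
        exact ⟨φ, by rw [← hφ]; simp⟩
    · have hp : (A ++ e :: (B ++ f :: (C ++ linv e :: (D ++ linv f :: E)))).Perm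
          (e :: linv e :: f :: linv f :: (A ++ D ++ C ++ B ++ E)) := by
        classical
        rw [List.perm_iff_count]
        intro a
        simp only [List.count_append, List.count_cons]
        omega
      obtain ⟨hq1, hq2⟩ := quad_remove hq hp
      obtain ⟨hq3, hq4⟩ := quad_remove hq1 (List.Perm.refl _)
      have hfe : f.1 ≠ e.1 := hq2 f (by simp)
      have hgen : ∀ y ∈ A ++ D ++ C ++ B ++ E, y.1 ≠ e.1 ∧ y.1 ≠ f.1 := fun y hy =>
        ⟨hq2 y (List.mem_cons_of_mem _ (List.mem_cons_of_mem _ hy)), hq4 y hy⟩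
      obtain ⟨l, h1, h2, h3⟩ := ih (A ++ D ++ C ++ B ++ E) (by simp at hW ⊢; omega) hq3
      have inv_len : ∀ L : List (β × Bool), (FreeGroup.invRev L).length = L.length := by
        intro L; simp
      refine ⟨(FreeGroup.mk (A ++ e :: (FreeGroup.invRev C ++ linv f :: (FreeGroup.invRev B ++
          linv e :: FreeGroup.invRev A))),
        FreeGroup.mk (A ++ e :: (FreeGroup.invRev C ++ FreeGroup.invRev D ++
          FreeGroup.invRev A))) :: l, ?_, ?_, ?_⟩
      · simp only [cprod, List.map_cons, List.prod_cons] at h1 ⊢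
        rw [h1]
        have hi : ∀ L : List (β × Bool), ev FreeGroup.of (FreeGroup.invRev L) =
            (ev FreeGroup.of L)⁻¹ := by
          intro L; rw [ev_of, ev_of, FreeGroup.inv_mk]
        simp only [cm, ← ev_of, ev_append, ev_cons, lv_linv, hi]
        group
      · intro p hp
        rcases List.mem_cons.1 hp with rfl | hp
        · refine ⟨⟨_, rfl, ?_⟩, ⟨_, rfl, ?_⟩⟩ <;> simp <;> omega
        · have := h2 p hp
          exact ⟨this.1.mono (by simp; omega), this.2.mono (by simp; omega)⟩
      · intro G _ l' hl'
        cases l' with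
        | nil => simp at hl'
        | cons p l' =>
          obtain ⟨φ, hφ⟩ := h3 G l' (by simpa using hl')
          obtain ⟨a, b⟩ := p
          let te : G := (ev φ A)⁻¹ * b * ev φ A * ev φ D * ev φ C
          let tf : G := (ev φ C * te⁻¹ * (ev φ A)⁻¹ * a * ev φ A * te * ev φ B)⁻¹
          obtain ⟨φ1, h4, h5⟩ := exists_set φ e te
          obtain ⟨φ2, h6, h7⟩ := exists_set φ1 f tf
          have h8 : lv φ2 e = te := by rw [← h4]; exact lv_congr (h7 _ hfe.symm)
          have h9 : ∀ L : List (β × Bool), (∀ y ∈ L, y ∈ A ++ D ++ C ++ B ++ E) →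
              ev φ2 L = ev φ L := by
            intro L hL
            refine ev_congr fun y hy => ?_
            have := hgen y (hL y hy)
            rw [h7 _ this.2, h5 _ this.1]
          refine ⟨φ2, ?_⟩
          simp only [cprod, List.map_cons, List.prod_cons] at hφ ⊢
          rw [← hφ]
          simp only [ev_append, ev_cons, lv_linv]
          rw [h6, h8, h9 A (fun y hy => by simp [hy]), h9 B (fun y hy => by simp [hy]),
            h9 C (fun y hy => by simp [hy]), h9 D (fun y hy => by simp [hy]),
            h9 E (fun y hy => by simp [hy])]
          simp only [te, tf, cm]
          group

end evaluation

section heis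

@[ext] structure Heis where
  l : ℚ
  m : ℚ
  c : ℚ

namespace Heis

instance : Mul Heis := ⟨fun x y => ⟨x.l + y.l, x.m + y.m, x.c + y.c + x.l * y.m⟩⟩
instance : One Heis := ⟨⟨0, 0, 0⟩⟩
instance : Inv Heis := ⟨fun x => ⟨-x.l, -x.m, -x.c + x.l * x.m⟩⟩

@[simp] theorem mul_l (x y : Heis) : (x * y).l = x.l + y.l := rfl
@[simp] theorem mul_m (x y : Heis) : (x * y).m = x.m + y.m := rfl
@[simp] theorem mul_c (x y : Heis) : (x * y).c = x.c + y.c + x.l * y.m := rfl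
@[simp] theorem one_l : (1 : Heis).l = 0 := rfl
@[simp] theorem one_m : (1 : Heis).m = 0 := rfl
@[simp] theorem one_c : (1 : Heis).c = 0 := rfl
@[simp] theorem inv_l (x : Heis) : (x⁻¹).l = -x.l := rfl
@[simp] theorem inv_m (x : Heis) : (x⁻¹).m = -x.m := rfl
@[simp] theorem inv_c (x : Heis) : (x⁻¹).c = -x.c + x.l * x.m := rfl

instance : Group Heis := Group.ofLeftAxioms
  (by intro x y z; ext <;> simp <;> ring)
  (by intro x; ext <;> simp)
  (by intro x; ext <;> simp)

theorem cm_l (p : Heis × Heis) : (cm p).l = 0 := by simp [cm]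
theorem cm_m (p : Heis × Heis) : (cm p).m = 0 := by simp [cm]
theorem cm_c (p : Heis × Heis) : (cm p).c = p.1.l * p.2.m - p.2.l * p.1.m := by
  simp [cm]; ring

theorem cprod_l (l : List (Heis × Heis)) : (cprod l).l = 0 := by
  induction l with
  | nil => rfl
  | cons p l ih => simp only [cprod, List.map_cons, List.prod_cons, mul_l, cm_l] at ih ⊢; simp [ih]

theorem cprod_c (l : List (Heis × Heis)) :
    (cprod l).c = (l.map fun p => p.1.l * p.2.m - p.2.l * p.1.m).sum := by
  induction l with
  | nil => rfl
  | cons p l ih =>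
    simp only [cprod, List.map_cons, List.prod_cons, mul_c, cm_l, cm_c, List.sum_cons] at ih ⊢
    simp [ih]

end Heis

def lfun {X : Type} : FreeGroup X →* Multiplicative ((X → ℚ) →ₗ[ℚ] ℚ) :=
  FreeGroup.lift fun x => Multiplicative.ofAdd (LinearMap.proj x)

theorem lfun_eq {X : Type} (lam mu : X → ℚ) (p : FreeGroup X) :
    (FreeGroup.lift (fun x => (⟨lam x, mu x, 0⟩ : Heis)) p).l = (lfun p).toAdd lam := by
  induction p using FreeGroup.induction_on with
  | C1 => simp
  | of x => simp [lfun]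
  | inv_of x h => simp only [map_inv, Heis.inv_l, h]; simp
  | mul x y hx hy => simp only [map_mul, Heis.mul_l, hx, hy]; simp

theorem genus_le {h : ℕ} (l : List (FreeGroup (Fin h × Bool) × FreeGroup (Fin h × Bool)))
    (hl : cprod l = cprod (List.ofFn fun i : Fin h =>
      (FreeGroup.of (i, false), FreeGroup.of (i, true)))) : h ≤ l.length := by
  by_contra hlt
  push Not at hlt
  let T : (Fin h × Bool → ℚ) →ₗ[ℚ] (Fin l.length × Bool → ℚ) :=
    LinearMap.pi fun i => (lfun (cond i.2 (l.get i.1).1 (l.get i.1).2)).toAdd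
  have hT : LinearMap.ker T ≠ ⊥ := by
    apply LinearMap.ker_ne_bot_of_finrank_lt
    simp; omega
  obtain ⟨lam, h1, h2⟩ := (Submodule.ne_bot_iff _).1 hT
  have h3 : ∀ p ∈ l, (lfun p.1).toAdd lam = 0 ∧ (lfun p.2).toAdd lam = 0 := by
    intro p hp
    obtain ⟨i, rfl⟩ := List.get_of_mem hp
    rw [LinearMap.mem_ker] at h1
    exact ⟨congrFun h1 (i, true), congrFun h1 (i, false)⟩
  let mu : Fin h × Bool → ℚ := fun x => cond x.2 (lam (x.1, false)) (-lam (x.1, true))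
  have h4 := congrArg (fun w => (FreeGroup.lift
    (fun x => (⟨lam x, mu x, 0⟩ : Heis)) w).c) hl
  simp only [map_cprod, Heis.cprod_c, List.map_map] at h4
  rw [List.sum_eq_zero] at h4
  · rw [List.map_ofFn, List.sum_ofFn] at h4
    simp only [Function.comp, FreeGroup.lift_apply_of, mu, cond_true, cond_false] at h4
    have h5 := h4.symm
    rw [Finset.sum_eq_zero_iff_of_nonneg (fun i _ => by nlinarith [sq_nonneg (lam (i, false)), sq_nonneg (lam (i, true))])] at h5
    apply h2
    funext ⟨i, b⟩
    have h6 := h5 i (Finset.mem_univ _)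
    have h7 : lam (i, false) ^ 2 + lam (i, true) ^ 2 = 0 := by linarith
    have h8 : lam (i, false) = 0 := by nlinarith [sq_nonneg (lam (i, false)), sq_nonneg (lam (i, true))]
    have h9 : lam (i, true) = 0 := by nlinarith [sq_nonneg (lam (i, false)), sq_nonneg (lam (i, true))]
    cases b
    · exact h8
    · exact h9
  · intro x hx
    obtain ⟨p, hp, rfl⟩ := List.mem_map.1 hx
    simp only [Function.comp, lfun_eq, (h3 p hp).1, (h3 p hp).2]
    ring

end heis

section claims
variable {α : Type*}

theorem ev_lab (V : List ((α × ℕ) × Bool)) :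
    ev (fun x : α × ℕ => FreeGroup.of x.1) V = FreeGroup.mk (V.map lab) := by
  rw [← ev_of]
  unfold ev
  rw [List.map_map]
  rfl

theorem com_bound {g : ℕ} {W : List (α × Bool)} (h : Com g (FreeGroup.mk W)) :
    ∃ l : List (FreeGroup α × FreeGroup α), l.length = g ∧ cprod l = FreeGroup.mk W ∧
      ∀ p ∈ l, SL (2 * W.length) p.1 ∧ SL (2 * W.length) p.2 := by
  obtain ⟨V, rfl, hq, hc⟩ := lifts_of_com h
  obtain ⟨l, h1, h2, h3⟩ := quad_red _ V le_rfl hq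
  obtain ⟨f, hf⟩ := h3 (FreeGroup (Fin l.length × Bool)) (List.ofFn fun i : Fin l.length =>
      (FreeGroup.of (i, false), FreeGroup.of (i, true))) (by simp)
  have hle : l.length ≤ g := by
    obtain ⟨l2, hl2, hl3⟩ := hc.map (FreeGroup.lift f)
    rw [ev_eq, hf] at hl3
    rw [← hl2]
    exact genus_le l2 hl3
  let φ : FreeGroup (α × ℕ) →* FreeGroup α := FreeGroup.map Prod.fst
  have hφ : ∀ L : List ((α × ℕ) × Bool), φ (FreeGroup.mk L) = FreeGroup.mk (L.map lab) := by
    intro L; exact FreeGroup.map.mk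
  refine ⟨(l.map fun p => (φ p.1, φ p.2)) ++ List.replicate (g - l.length) (1, 1), ?_, ?_, ?_⟩
  · simp; omega
  · rw [← hφ, ← h1, map_cprod]
    simp [cprod, cm]
  · have hs : ∀ w, SL (2 * V.length) w → SL (2 * (V.map lab).length) (φ w) := by
      rintro w ⟨L, rfl, hL⟩
      exact ⟨_, (hφ L).symm, by simpa using hL⟩
    intro p hp
    rcases List.mem_append.1 hp with hp | hp
    · obtain ⟨q, hq1, rfl⟩ := List.mem_map.1 hp
      exact ⟨hs _ (h2 q hq1).1, hs _ (h2 q hq1).2⟩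
    · rw [List.eq_of_mem_replicate hp]
      exact ⟨⟨[], rfl, by simp⟩, ⟨[], rfl, by simp⟩⟩

theorem lemma_two {g : ℕ} (u : α × Bool) (X Y : List (α × Bool))
    (h : Com g (FreeGroup.mk (u :: (X ++ linv u :: Y)))) :
    (∃ Y1 Y2, Y = Y1 ++ Y2 ∧ Com g (FreeGroup.mk (Y1 ++ X ++ Y2))) ∨
    (∃ X1 X2, X = X1 ++ X2 ∧ Com g (FreeGroup.mk (X1 ++ Y ++ X2))) := by
  obtain ⟨V, hV, hq, hc⟩ := lifts_of_com h
  obtain ⟨a, V', rfl, rfl, hB⟩ := List.map_eq_cons_iff.1 hV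
  obtain ⟨X', B', rfl, rfl, hB2⟩ := List.map_eq_append_iff.1 hB
  obtain ⟨b, Y', rfl, hb, rfl⟩ := List.map_eq_cons_iff.1 hB2
  have ha := hq.2 a (by simp)
  simp only [List.mem_cons, List.mem_append] at ha
  let f0 : α × ℕ → FreeGroup α := fun x => FreeGroup.of x.1
  have hf0 : ∀ L, FreeGroup.mk (L.map lab) = ev f0 L := fun L => (ev_lab L).symm
  have hlb : lv f0 b = (lv f0 a)⁻¹ := by
    rw [← lv_linv]
    simp only [lab, linv, Prod.mk.injEq] at hb
    simp [lv, linv, f0, hb.1, hb.2]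
  have fin : ∀ f : α × ℕ → FreeGroup α, Com g (ev f (a :: (X' ++ b :: Y'))) := by
    intro f; rw [← ev_eq]; exact hc.map _
  rcases ha with h1 | h1 | h1 | h1
  · exact absurd h1 (linv_ne a)
  · -- partner inside X
    obtain ⟨X1, X2, rfl⟩ := List.append_of_mem h1
    right
    have hp : (a :: (X1 ++ linv a :: X2 ++ b :: Y')).Perm
        (a :: linv a :: (X1 ++ X2 ++ b :: Y')) := by
      refine List.Perm.cons _ ?_
      simp
    obtain ⟨-, hg⟩ := quad_remove hq hp
    obtain ⟨f, hf1, hf2⟩ := exists_set f0 a ((ev f0 Y')⁻¹ * lv f0 a)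
    have e : ∀ L : List ((α × ℕ) × Bool), (∀ y ∈ L, y ∈ X1 ++ X2 ++ b :: Y') → ev f L = ev f0 L :=
      fun L hL => ev_congr fun y hy => hf2 _ (hg y (hL y hy))
    have eb : lv f b = lv f0 b := lv_congr (hf2 _ (hg b (by simp)))
    refine ⟨(X1 ++ [linv a]).map lab, X2.map lab, by simp, ?_⟩
    rw [← List.map_append, ← List.map_append, hf0]
    have := fin f
    simp only [ev_append, ev_cons, ev_nil, lv_linv] at this ⊢
    rw [hf1, eb, hlb, e X1 (fun y hy => by simp [hy]), e X2 (fun y hy => by simp [hy]),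
      e Y' (fun y hy => by simp [hy])] at this
    have := Com.conj (a := (ev f0 Y')⁻¹ * lv f0 a)
      (b := ev f0 X1 * (lv f0 a)⁻¹ * ev f0 Y' * ev f0 X2 * (lv f0 a)⁻¹ * ev f0 Y')
      (by convert this using 1; group)
    convert this using 1; group
  · -- partner is b
    left
    have hp : (a :: (X' ++ b :: Y')).Perm (a :: linv a :: (X' ++ Y')) := by
      refine List.Perm.cons _ ?_
      rw [h1]
      exact List.perm_middle
    obtain ⟨-, hg⟩ := quad_remove hq hp
    obtain ⟨f, hf1, hf2⟩ := exists_set f0 a 1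
    have e : ∀ L : List ((α × ℕ) × Bool), (∀ y ∈ L, y ∈ X' ++ Y') → ev f L = ev f0 L :=
      fun L hL => ev_congr fun y hy => hf2 _ (hg y (hL y hy))
    refine ⟨[], Y'.map lab, by simp, ?_⟩
    rw [List.nil_append, ← List.map_append, hf0]
    have := fin f
    rw [← h1] at this
    simp only [ev_append, ev_cons, ev_nil, lv_linv] at this ⊢
    rw [hf1, e X' (fun y hy => by simp [hy]), e Y' (fun y hy => by simp [hy])] at this
    convert this using 1; group
  · -- partner inside Y
    obtain ⟨Y1, Y2, rfl⟩ := List.append_of_mem h1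
    left
    have hp : (a :: (X' ++ b :: (Y1 ++ linv a :: Y2))).Perm
        (a :: linv a :: (X' ++ b :: (Y1 ++ Y2))) := by
      refine List.Perm.cons _ ?_
      have := List.perm_middle (a := linv a) (l₁ := X' ++ b :: Y1) (l₂ := Y2)
      simpa using this
    obtain ⟨-, hg⟩ := quad_remove hq hp
    obtain ⟨f, hf1, hf2⟩ := exists_set f0 a (lv f0 a * (ev f0 X')⁻¹)
    have e : ∀ L : List ((α × ℕ) × Bool), (∀ y ∈ L, y ∈ X' ++ b :: (Y1 ++ Y2)) → ev f L = ev f0 L :=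
      fun L hL => ev_congr fun y hy => hf2 _ (hg y (hL y hy))
    have eb : lv f b = lv f0 b := lv_congr (hf2 _ (hg b (by simp)))
    refine ⟨Y1.map lab, (linv a :: Y2).map lab, by simp, ?_⟩
    rw [← List.map_append, ← List.map_append, hf0]
    have := fin f
    simp only [ev_append, ev_cons, ev_nil, lv_linv] at this ⊢
    rw [hf1, eb, hlb, e X' (fun y hy => by simp [hy]), e Y1 (fun y hy => by simp [hy]),
      e Y2 (fun y hy => by simp [hy])] at this
    convert this using 1; group

end claims

section cactus
variable {α ι : Type*}

/-- Cactus words with `n` sticks, containing the coefficients of the multiset `S`. -/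
inductive K (c : ι → List (α × Bool)) : ℕ → List ((α × Bool) ⊕ ι) → Multiset ι → Prop
  | nil : K c 0 [] 0
  | base (j : ι) : K c 0 (Sum.inr j :: (c j).map Sum.inl) {j}
  | join {n m : ℕ} {X Y : List ((α × Bool) ⊕ ι)} {S T : Multiset ι} :
      K c n X S → K c m Y T → K c (n + m) (X ++ Y) (S + T)
  | stick {n m : ℕ} {X Y : List ((α × Bool) ⊕ ι)} {S T : Multiset ι} (x : α × Bool) :
      K c n X S → K c m Y T →
      K c (n + m + 1) (Sum.inl x :: (X ++ Sum.inl (linv x) :: Y)) (S + T)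
  | rot {n : ℕ} {X Y : List ((α × Bool) ⊕ ι)} {S : Multiset ι} :
      K c n (X ++ Y) S → K c n (Y ++ X) S

variable {c : ι → List (α × Bool)}

theorem K.insert {n m : ℕ} {X Y1 Y2 : List ((α × Bool) ⊕ ι)} {S T : Multiset ι}
    (hX : K c n X S) (hY : K c m (Y1 ++ Y2) T) : K c (n + m) (Y1 ++ X ++ Y2) (S + T) := by
  have := K.join hX (K.rot hY)
  rw [← List.append_assoc] at this
  have := K.rot this
  rwa [← List.append_assoc] at this

theorem K.conj {n : ℕ} {X : List ((α × Bool) ⊕ ι)} {S : Multiset ι} (hX : K c n X S)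
    (L : List (α × Bool)) : ∃ k,
    K c k (L.map Sum.inl ++ X ++ (FreeGroup.invRev L).map Sum.inl) S := by
  induction L with
  | nil => exact ⟨n, by simpa using hX⟩
  | cons x L ih =>
    obtain ⟨k, hk⟩ := ih
    have := K.stick x hk K.nil
    refine ⟨k + 0 + 1, ?_⟩
    convert this using 1
    · simp [FreeGroup.invRev, linv]
    · simp

def Dec (c : ι → List (α × Bool)) (n : ℕ) (W : List ((α × Bool) ⊕ ι)) (S : Multiset ι) : Prop :=
  ∃ x X Y S1 S2 n1 n2, W.IsRotated (Sum.inl x :: (X ++ Sum.inl (linv x) :: Y)) ∧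
    K c n1 X S1 ∧ K c n2 Y S2 ∧ S = S1 + S2 ∧ n = n1 + n2 + 1

theorem Dec.join {n m : ℕ} {X Y : List ((α × Bool) ⊕ ι)} {S T : Multiset ι}
    (hX : Dec c n X S) (hY : K c m Y T) : Dec c (n + m) (X ++ Y) (S + T) := by
  obtain ⟨x, X1, Y1, S1, S2, n1, n2, hr, h1, h2, rfl, rfl⟩ := hX
  obtain ⟨Z1, Z2, hZ, rfl⟩ : ∃ Z1 Z2, Sum.inl x :: (X1 ++ Sum.inl (linv x) :: Y1) = Z1 ++ Z2 ∧
      X = Z2 ++ Z1 := by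
    obtain ⟨k, hk⟩ := hr.symm
    rw [← List.rotate_mod] at hk
    rw [List.rotate_eq_drop_append_take
      (Nat.mod_lt _ (by simp)).le] at hk
    exact ⟨_, _, (List.take_append_drop _ _).symm, hk.symm⟩
  have rot1 : (Z2 ++ Z1 ++ Y).IsRotated (Z1 ++ Y ++ Z2) := by
    rw [List.append_assoc]; exact List.isRotated_append
  rcases Z1 with _ | ⟨z, Z1⟩
  · simp only [List.nil_append] at hZ
    subst hZ
    refine ⟨x, X1, Y1 ++ Y, S1, S2 + T, n1, n2 + m, ?_, h1, K.join h2 hY, by rw [add_assoc],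
      by omega⟩
    simp [List.IsRotated.refl]
  · simp only [List.cons_append, List.cons.injEq] at hZ
    obtain ⟨rfl, hZ⟩ := hZ
    rcases List.append_eq_append_iff.1 hZ with ⟨a, rfl, h⟩ | ⟨b, rfl, rfl⟩
    · rcases a with _ | ⟨a, A⟩
      · simp only [List.nil_append] at h
        subst h
        refine ⟨x, X1 ++ Y, Y1, S1 + T, S2, n1 + m, n2, ?_, K.join h1 hY, h2,
          by rw [add_right_comm], by omega⟩
        refine rot1.trans ?_
        simp [List.IsRotated.refl]
      · simp only [List.cons_append, List.cons.injEq] at h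
        obtain ⟨rfl, rfl⟩ := h
        refine ⟨x, X1, A ++ Y ++ Z2, S1, T + S2, n1, m + n2, ?_, h1, K.insert hY h2,
          by rw [add_assoc, add_comm S2], by omega⟩
        refine rot1.trans ?_
        simp [List.IsRotated.refl]
    · refine ⟨x, Z1 ++ Y ++ b, Y1, T + S1, S2, m + n1, n2, ?_, K.insert hY h1, h2,
          by rw [add_right_comm, add_comm S1], by omega⟩
      refine rot1.trans ?_
      simp [List.IsRotated.refl]

theorem K.dec {n : ℕ} {W : List ((α × Bool) ⊕ ι)} {S : Multiset ι} (h : K c n W S) :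
    n ≠ 0 → Dec c n W S := by
  induction h with
  | nil => intro h; exact absurd rfl h
  | base j => intro h; exact absurd rfl h
  | stick x hX hY _ _ => intro _; exact ⟨x, _, _, _, _, _, _, List.IsRotated.refl _, hX, hY, rfl, rfl⟩
  | rot hX ih =>
    intro hn
    obtain ⟨x, X, Y, S1, S2, n1, n2, hr, h⟩ := ih hn
    exact ⟨x, X, Y, S1, S2, n1, n2, List.isRotated_append.trans hr, h⟩
  | @join n m X Y S T hX hY ihX ihY =>
    intro hn
    by_cases h0 : n = 0
    · have := (ihY (by omega)).join hX
      obtain ⟨x, X, Y, S1, S2, n1, n2, hr, h⟩ := this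
      rw [add_comm n, add_comm S]
      exact ⟨x, X, Y, S1, S2, n1, n2, List.isRotated_append.trans hr, h⟩
    · exact (ihX h0).join hY

theorem com_rot {T : Type*} {g : ℕ} {W W' : List T} (f : T → α × Bool) (hr : W.IsRotated W')
    (h : Com g (FreeGroup.mk (W.map f))) : Com g (FreeGroup.mk (W'.map f)) := by
  obtain ⟨k, rfl⟩ := hr
  rw [← List.rotate_mod]
  by_cases hW : W = []
  · subst hW; simpa using h
  rw [List.rotate_eq_drop_append_take (Nat.mod_lt _ (List.length_pos_iff.2 hW)).le, List.map_append,
    ← FreeGroup.mul_mk]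
  apply Com.conj
  rw [FreeGroup.mul_mk, ← List.map_append, List.take_append_drop]
  exact h

theorem K.unstick {g : ℕ} (e : ι → α × Bool) : ∀ (n : ℕ) (W : List ((α × Bool) ⊕ ι))
    (S : Multiset ι), K c n W S → Com g (FreeGroup.mk (W.map (Sum.elim id e))) →
    ∃ W', K c 0 W' S ∧ Com g (FreeGroup.mk (W'.map (Sum.elim id e))) := by
  intro n
  induction n with
  | zero => intro W S h1 h2; exact ⟨W, h1, h2⟩
  | succ n ih =>
    intro W S h1 h2
    obtain ⟨x, X, Y, S1, S2, n1, n2, hr, hX, hY, rfl, hn⟩ := h1.dec (by omega)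
    have hn : n = n1 + n2 := by omega
    subst hn
    have h3 := com_rot _ hr h2
    simp only [List.map_cons, List.map_append, Sum.elim_inl, id] at h3
    rcases lemma_two x _ _ h3 with ⟨Y1, Y2, hs, h4⟩ | ⟨X1, X2, hs, h4⟩
    · obtain ⟨Y1, Y2, rfl, rfl, rfl⟩ := List.map_eq_append_iff.1 hs
      rw [← List.map_append, ← List.map_append] at h4
      exact ih _ _ (K.insert hX hY) h4
    · obtain ⟨X1, X2, rfl, rfl, rfl⟩ := List.map_eq_append_iff.1 hs
      rw [← List.map_append, ← List.map_append] at h4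
      have := K.insert hY hX
      rw [add_comm n2, add_comm S2] at this
      exact ih _ _ this h4

def kap (c : ι → List (α × Bool)) : (α × Bool) ⊕ ι → List (α × Bool) :=
  Sum.elim (fun x => [x]) (fun j => FreeGroup.invRev (c j))

theorem flatMap_inl (v : (α × Bool) ⊕ ι → List (α × Bool)) (hv : ∀ x, v (Sum.inl x) = [x])
    (L : List (α × Bool)) : (L.map Sum.inl).flatMap v = L := by
  induction L with
  | nil => rfl
  | cons a L ih => simp [hv, ih]

theorem K.kappa {n : ℕ} {W : List ((α × Bool) ⊕ ι)} {S : Multiset ι} (h : K c n W S) :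
    FreeGroup.mk (W.flatMap (kap c)) = 1 := by
  induction h with
  | nil => rfl
  | base j =>
    rw [List.flatMap_cons, flatMap_inl _ (fun x => rfl)]
    simp only [kap, Sum.elim_inr]
    rw [← FreeGroup.mul_mk, ← FreeGroup.inv_mk]; exact inv_mul_cancel _
  | join _ _ h1 h2 => rw [List.flatMap_append, ← FreeGroup.mul_mk, h1, h2, one_mul]
  | @stick n m X Y S T x _ _ h1 h2 =>
    have : FreeGroup.mk ((Sum.inl x :: (X ++ Sum.inl (linv x) :: Y)).flatMap (kap c)) =
        FreeGroup.mk [x] * FreeGroup.mk (X.flatMap (kap c)) * FreeGroup.mk [linv x] *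
        FreeGroup.mk (Y.flatMap (kap c)) := by
      simp [FreeGroup.mul_mk, kap]
    rw [this, h1, h2]
    rw [← ev_of, ← ev_of]
    simp
  | rot _ h =>
    rw [List.flatMap_append, ← FreeGroup.mul_mk] at h ⊢
    rw [mul_eq_one_iff_eq_inv] at h ⊢
    rw [h, inv_inv]

theorem tags_inl (L : List (α × Bool)) :
    (L.map (Sum.inl (β := ι))).filterMap Sum.getRight? = [] := by
  induction L with
  | nil => rfl
  | cons a L ih => simpa using ih

theorem K.tags {n : ℕ} {W : List ((α × Bool) ⊕ ι)} {S : Multiset ι} (h : K c n W S) :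
    ((W.filterMap Sum.getRight? : List ι) : Multiset ι) = S := by
  induction h with
  | nil => rfl
  | base i =>
    rw [List.filterMap_cons_some (a := Sum.inr i) (f := Sum.getRight?) (b := i) rfl, tags_inl]; rfl
  | join _ _ h1 h2 => rw [List.filterMap_append, ← Multiset.coe_add, h1, h2]
  | stick x _ _ h1 h2 =>
    rw [List.filterMap_cons_none rfl, List.filterMap_append, List.filterMap_cons_none rfl,
      ← Multiset.coe_add, h1, h2]
  | rot _ h => rw [List.filterMap_append, ← Multiset.coe_add, add_comm, Multiset.coe_add,
      ← List.filterMap_append, h]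

theorem K.length {n : ℕ} {W : List ((α × Bool) ⊕ ι)} {S : Multiset ι} (h : K c n W S) :
    W.length = 2 * n + (S.map fun j => (c j).length + 1).sum := by
  induction h with
  | nil => rfl
  | base i => simp
  | join _ _ h1 h2 => simp [h1, h2]; omega
  | stick x _ _ h1 h2 => simp [h1, h2]; omega
  | rot _ h => rw [← h]; simp; omega

theorem K.length_flatMap {n : ℕ} {W : List ((α × Bool) ⊕ ι)} {S : Multiset ι} (h : K c n W S)
    (v : (α × Bool) ⊕ ι → List (α × Bool)) (hv : ∀ x, v (Sum.inl x) = [x])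
    (hv2 : ∀ j, (v (Sum.inr j)).length ≤ (c j).length + 1) :
    (W.flatMap v).length ≤ 2 * n + 2 * (S.map fun j => (c j).length + 1).sum := by
  induction h with
  | nil => simp
  | base i =>
    rw [List.flatMap_cons, flatMap_inl _ hv]
    have := hv2 i
    simp only [List.length_append, Multiset.map_singleton, Multiset.sum_singleton]
    omega
  | join _ _ h1 h2 =>
    rw [List.flatMap_append, List.length_append, Multiset.map_add, Multiset.sum_add]; omega
  | stick x _ _ h1 h2 =>
    rw [List.flatMap_cons, List.flatMap_append, List.flatMap_cons, Multiset.map_add,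
      Multiset.sum_add]
    simp only [List.length_append, hv, List.length_cons, List.length_nil]; omega
  | rot _ h =>
    rw [List.flatMap_append, List.length_append] at h ⊢; omega

theorem telescope {G : Type*} [Group G] : ∀ (n : ℕ) (D : Fin n → G) (f : ℕ → G),
    (∀ i : Fin n, f i = D i * f (i + 1)) → f 0 = (List.ofFn D).prod * f n := by
  intro n
  induction n with
  | zero => intro D f _; simp
  | succ n ih =>
    intro D f h
    rw [List.ofFn_succ, List.prod_cons, mul_assoc]
    have h0 := h 0
    simp only [Fin.val_zero, zero_add] at h0
    rw [h0]
    congr 1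
    have := ih (fun i => D i.succ) (fun k => f (k + 1)) (fun i => by simpa using h i.succ)
    simpa using this

theorem main {g n : ℕ} (e : Option (Fin n) → α × Bool) (c : Option (Fin n) → List (α × Bool))
    (z : Fin n → FreeGroup α)
    (h : Com g ((List.ofFn fun j => (z j)⁻¹ * FreeGroup.mk (e (some j) :: c (some j)) * z j).prod *
      FreeGroup.mk (e none :: c none)))
    (s : ℕ) (hs : s = (∑ j, ((c (some j)).length + 1)) + ((c none).length + 1)) :
    ∃ (W : List (α × Bool)) (z' : Fin n → FreeGroup α), W.length ≤ s ∧ Com g (FreeGroup.mk W) ∧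
      (∀ j, SL (2 * s) (z' j)) ∧
      (List.ofFn fun j => (z' j)⁻¹ * FreeGroup.mk (e (some j) :: c (some j)) * z' j).prod *
      FreeGroup.mk (e none :: c none) = FreeGroup.mk W := by
  classical
  have hinit : ∀ js : List (Fin n), ∃ k W, K c k W ((js.map some : List (Option (Fin n))) : Multiset _) ∧
      FreeGroup.mk (W.map (Sum.elim id e)) =
        (js.map fun j => (z j)⁻¹ * FreeGroup.mk (e (some j) :: c (some j)) * z j).prod := by
    intro js
    induction js with
    | nil => exact ⟨0, [], K.nil, rfl⟩
    | cons j js ih =>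
      obtain ⟨k, W, h1, h2⟩ := ih
      obtain ⟨L, hL⟩ : ∃ L, FreeGroup.mk L = (z j)⁻¹ := ⟨_, FreeGroup.mk_toWord⟩
      obtain ⟨k', hk'⟩ := (K.base (c := c) (some j)).conj L
      refine ⟨_, _, hk'.join h1, ?_⟩
      rw [List.map_append, ← FreeGroup.mul_mk, h2, List.map_cons, List.prod_cons]
      congr 1
      have hz : z j = FreeGroup.mk (FreeGroup.invRev L) := by
        rw [← FreeGroup.inv_mk, hL, inv_inv]
      rw [← hL, hz]
      simp [FreeGroup.mul_mk, Function.comp_def]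
  obtain ⟨k, W0, hK0, hW0⟩ := hinit (List.finRange n)
  have hK1 := hK0.join (K.base (c := c) none)
  obtain ⟨W1, hK, hc⟩ := hK1.unstick (g := g) e _ _ _ (by
    rw [List.map_append, ← FreeGroup.mul_mk, hW0]
    simp only [List.ofFn_eq_map] at h
    simpa [Function.comp_def] using h)
  set S : Multiset (Option (Fin n)) := ((List.finRange n).map some : List (Option (Fin n))) + {none}
    with hS
  have hsum : (S.map fun j => (c j).length + 1).sum = s := by
    rw [hs, hS, Multiset.map_add, Multiset.sum_add]
    congr 1
    simp [Function.comp_def, ← List.ofFn_eq_map, List.sum_ofFn]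
  have hnodup : S.Nodup := by
    rw [hS, add_comm, Multiset.singleton_add, Multiset.nodup_cons]
    refine ⟨by simp, ?_⟩
    rw [Multiset.coe_nodup]
    exact (List.nodup_finRange n).map (Option.some_injective _)
  have hmemS : ∀ j, j ∈ S := by
    intro j
    rw [hS, add_comm, Multiset.singleton_add, Multiset.mem_cons]
    cases j <;> simp
  have hfind : ∀ (W : List ((α × Bool) ⊕ Option (Fin n))), K c 0 W S → ∀ j,
      ∃ A B, W = A ++ Sum.inr j :: B ∧ Sum.inr j ∉ A ∧ Sum.inr j ∉ B := by
    intro W hW j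
    have ht := hW.tags
    have hm := hmemS j
    rw [← ht, Multiset.mem_coe, List.mem_filterMap] at hm
    obtain ⟨a, ha, haj⟩ := hm
    rw [Sum.getRight?_eq_some_iff] at haj
    subst haj
    obtain ⟨A, B, rfl⟩ := List.append_of_mem ha
    have hn := hnodup
    rw [← ht, Multiset.coe_nodup, List.filterMap_append, List.filterMap_cons_some (a := Sum.inr j) (f := Sum.getRight?) (b := j) rfl,
      List.nodup_middle, List.nodup_cons] at hn
    have hn1 := hn.1
    rw [List.mem_append, not_or] at hn1
    refine ⟨A, B, rfl, fun hA => hn1.1 ?_, fun hB => hn1.2 ?_⟩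
    · exact List.mem_filterMap.2 ⟨_, hA, rfl⟩
    · exact List.mem_filterMap.2 ⟨_, hB, rfl⟩
  obtain ⟨P, R, rfl, hP, hR⟩ := hfind W1 hK none
  have hQ0 : Sum.inr none ∉ R ++ P := by
    rw [List.mem_append, not_or]; exact ⟨hR, hP⟩
  have hK2 : K c 0 (Sum.inr none :: (R ++ P)) S := by simpa using hK.rot
  have hc2 : Com g (FreeGroup.mk ((Sum.inr none :: (R ++ P)).map (Sum.elim id e))) := by
    refine com_rot _ ?_ hc
    exact List.isRotated_append (l := P) (l' := Sum.inr none :: R)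
  generalize R ++ P = Q at hK2 hc2 hQ0
  clear hc hK
  let v : ℕ → (α × Bool) ⊕ Option (Fin n) → List (α × Bool) := fun k =>
    Sum.elim (fun x => [x]) (fun j => match j with
      | none => [e none]
      | some j => if (j : ℕ) < k then FreeGroup.invRev (c (some j)) else [e (some j)])
  have hv1 : ∀ k x, v k (Sum.inl x) = [x] := fun k x => rfl
  have hv2 : ∀ k j, (v k (Sum.inr j)).length ≤ (c j).length + 1 := by
    intro k j
    cases j with
    | none => simp [v]
    | some j => simp only [v, Sum.elim_inr]; split_ifs <;> simp
  have hv0 : ∀ L : List ((α × Bool) ⊕ Option (Fin n)), L.flatMap (v 0) = L.map (Sum.elim id e) := by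
    intro L
    induction L with
    | nil => rfl
    | cons a L ih =>
      rw [List.flatMap_cons, ih, List.map_cons]
      rcases a with a | _ | j <;> simp [v]
  have hlen : ∀ k, ((Sum.inr none :: Q).flatMap (v k)).length ≤ 2 * s := by
    intro k
    have := hK2.length_flatMap (v k) (hv1 k) (hv2 k)
    rw [hsum] at this; omega
  have hsplit : ∀ j : Fin n, ∃ z' : FreeGroup α, SL (2 * s) z' ∧
      FreeGroup.mk ((Sum.inr none :: Q).flatMap (v j)) =
        (z'⁻¹ * FreeGroup.mk (e (some j) :: c (some j)) * z') *
        FreeGroup.mk ((Sum.inr none :: Q).flatMap (v (j + 1))) := by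
    intro j
    obtain ⟨A, B, hAB, hA, hB⟩ := hfind _ hK2 (some j)
    have hcg : ∀ L : List ((α × Bool) ⊕ Option (Fin n)), Sum.inr (some j) ∉ L →
        L.flatMap (v (j + 1)) = L.flatMap (v j) := by
      intro L hL
      induction L with
      | nil => rfl
      | cons a L ih =>
        simp only [List.mem_cons, not_or] at hL
        rw [List.flatMap_cons, List.flatMap_cons, ih hL.2]
        congr 1
        rcases a with a | _ | i
        · rfl
        · rfl
        · have hij : i ≠ j := by rintro rfl; exact hL.1 rfl
          have hij : (i : ℕ) ≠ j := fun h => hij (Fin.ext h)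
          have : (i : ℕ) < j + 1 ↔ (i : ℕ) < j := by omega
          simp only [v, Sum.elim_inr, this]
    have hl := hlen j
    rw [hAB] at hl ⊢
    refine ⟨FreeGroup.mk (FreeGroup.invRev (A.flatMap (v j))), ⟨_, rfl, ?_⟩, ?_⟩
    · rw [List.flatMap_append, List.length_append] at hl
      simp only [FreeGroup.invRev_length]; omega
    · have e1 : v j (Sum.inr (some j)) = [e (some j)] := by simp [v]
      have e2 : v (j + 1) (Sum.inr (some j)) = FreeGroup.invRev (c (some j)) := by simp [v]
      rw [List.flatMap_append, List.flatMap_append, List.flatMap_cons, List.flatMap_cons, e1, e2,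
        hcg A hA, hcg B hB]
      have e3 : FreeGroup.mk (e (some j) :: c (some j)) =
        FreeGroup.mk [e (some j)] * FreeGroup.mk (c (some j)) := by rw [FreeGroup.mul_mk]; rfl
      rw [e3]
      simp only [← FreeGroup.mul_mk, ← FreeGroup.inv_mk]
      group
  choose z' hz1 hz2 using hsplit
  refine ⟨(Sum.inr none :: Q).map (Sum.elim id e), z', ?_, hc2, hz1, ?_⟩
  · rw [List.length_map, hK2.length, hsum]; omega
  · have := telescope n _ (fun k => FreeGroup.mk ((Sum.inr none :: Q).flatMap (v k))) hz2
    simp only [hv0] at this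
    rw [this]
    congr 1
    have hQ : Q.flatMap (v n) = Q.flatMap (kap c) := by
      apply List.flatMap_congr
      intro a ha
      rcases a with a | _ | i
      · rfl
      · exact absurd ha hQ0
      · simp [v, kap]
    have hk := hK2.kappa
    rw [List.flatMap_cons, ← FreeGroup.mul_mk] at hk
    rw [List.flatMap_cons, hQ, ← FreeGroup.mul_mk]
    have e4 : FreeGroup.mk (kap c (Sum.inr none)) = (FreeGroup.mk (c none))⁻¹ := by
      rw [FreeGroup.inv_mk]; rfl
    rw [e4, inv_mul_eq_one] at hk
    rw [← hk, FreeGroup.mul_mk]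
    rfl

end cactus
end QE

theorem stmt_3 {α : Type*} [DecidableEq α] (g m : ℕ) (hm : 1 ≤ m)
    (Cj : Fin (m - 1) → FreeGroup α) (C : FreeGroup α)
    (hCj : ∀ j, Cj j ≠ 1 ∧ CyclicallyReduced (Cj j))
    (hC : C ≠ 1) (hCred : CyclicallyReduced C)
    (s : ℕ) (hs : s = (∑ j, (Cj j).norm) + C.norm)
    (x y : Fin g → FreeGroup α) (z : Fin (m - 1) → FreeGroup α)
    (hsol : (List.ofFn fun i => (x i)⁻¹ * (y i)⁻¹ * x i * y i).prod *
        (List.ofFn fun j => (z j)⁻¹ * Cj j * z j).prod * C = 1) :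
    ∃ x' y' : Fin g → FreeGroup α, ∃ z' : Fin (m - 1) → FreeGroup α,
      (List.ofFn fun i => (x' i)⁻¹ * (y' i)⁻¹ * x' i * y' i).prod *
        (List.ofFn fun j => (z' j)⁻¹ * Cj j * z' j).prod * C = 1 ∧
      (∀ i, (x' i).norm ≤ 2 * s ∧ (y' i).norm ≤ 2 * s) ∧
      (∀ j, (z' j).norm ≤ 2 * s) := by
  have split : ∀ w : FreeGroup α, w ≠ 1 → ∃ a L, w.toWord = a :: L := by
    intro w hw
    cases h : w.toWord with
    | nil => exact absurd (FreeGroup.toWord_eq_nil_iff.1 h) hw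
    | cons a L => exact ⟨a, L, rfl⟩
  let D : Option (Fin (m - 1)) → FreeGroup α := fun j => j.elim C Cj
  have hD : ∀ j, ∃ a L, (D j).toWord = a :: L := by
    intro j
    cases j with
    | none => exact split _ hC
    | some j => exact split _ (hCj j).1
  choose e c hec using hD
  have hmk : ∀ j, FreeGroup.mk (e j :: c j) = D j := fun j => by rw [← hec, FreeGroup.mk_toWord]
  have hnorm : ∀ j, (c j).length + 1 = (D j).norm := fun j => by
    rw [FreeGroup.norm, hec]; rfl
  have hSL : ∀ N (w : FreeGroup α), QE.SL N w → w.norm ≤ N := by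
    rintro N w ⟨L, rfl, hL⟩
    exact FreeGroup.norm_mk_le.trans hL
  have h1 : QE.Com g ((List.ofFn fun j => (z j)⁻¹ *
      FreeGroup.mk (e (some j) :: c (some j)) * z j).prod * FreeGroup.mk (e none :: c none)) := by
    simp only [hmk]
    have : QE.Com g (List.ofFn fun i => (x i)⁻¹ * (y i)⁻¹ * x i * y i).prod :=
      ⟨List.ofFn fun i => (x i, y i), by simp, by
        simp only [QE.cprod, List.map_ofFn]; rfl⟩
    have h2 := this.inv
    rw [mul_assoc, mul_eq_one_iff_inv_eq] at hsol
    rw [hsol] at h2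
    exact h2
  obtain ⟨W, z', hW, hc, hz, heq⟩ := QE.main e c z h1 s (by
    simp only [hnorm]; exact hs)
  obtain ⟨l, rfl, hl2, hl3⟩ := QE.com_bound (W := FreeGroup.invRev W)
    (by rw [← FreeGroup.inv_mk]; exact hc.inv)
  rw [FreeGroup.invRev_length] at hl3
  have hWs : 2 * W.length ≤ 2 * s := by omega
  refine ⟨fun i => (l.get i).1, fun i => (l.get i).2, z', ?_, ?_, fun j => hSL _ _ (hz j)⟩
  · simp only [hmk] at heq
    rw [mul_assoc]
    have h3 : (List.ofFn fun i => (l.get i).1⁻¹ * (l.get i).2⁻¹ * (l.get i).1 * (l.get i).2).prod =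
        QE.cprod l := by
      rw [QE.cprod]
      congr 1
      conv_rhs => rw [← List.ofFn_get l, List.map_ofFn]
      rfl
    rw [h3, hl2, ← FreeGroup.inv_mk]
    change _ * (_ * D none) = 1
    change _ * ((List.ofFn fun j => (z' j)⁻¹ * D (some j) * z' j).prod * D none) = 1
    rw [heq, inv_mul_cancel]
  · intro i
    have := hl3 _ (List.get_mem l i)
    exact ⟨hSL _ _ (this.1.mono hWs), hSL _ _ (this.2.mono hWs)⟩
end
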